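/- Approaching the set of non-zero stationary solutions near a non-characteristic point (Proposition 1.3). Let u be a maximal solution of the one-dimensional vector-valued wave equation with blow-up curve T as in the blow-up framework, and let x0 ∈ ℝ be non-characteristic. Then: (A.i) inf over d ∈ (−1,1) and unit vectors Ω ∈ ℝ^m of ( ‖w_{x0}(·,s) − κ(d,·)Ω‖_{H¹(−1,1)} ) plus ‖∂_s w_{x0}(·,s)‖_{L²(−1,1)} tends to 0 as s → ∞; and (A.ii) E(w_{x0}(·,s), ∂_s w_{x0}(·,s)) → E(κ(0,·), 0) as s → ∞, where κ(0,·) is the constant function y ↦ κ0. -/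

import Mathlib

open MeasureTheory Real Set Filter

/-- `κ₀ = (2(p+1)/(p-1)²)^{1/(p-1)}` -/
noncomputable def kappa0 (p : ℝ) : ℝ := (2 * (p + 1) / (p - 1) ^ 2) ^ (1 / (p - 1))

/-- `κ(d,y) = κ₀ (1-d²)^{1/(p-1)} (1+dy)^{-2/(p-1)}` -/
noncomputable def kappa (p d y : ℝ) : ℝ :=
  kappa0 p * (1 - d ^ 2) ^ (1 / (p - 1)) * (1 + d * y) ^ (-(2 / (p - 1)))

/-- the weight `ρ(y) = (1-y²)^{2/(p-1)}` -/
noncomputable def rho (p y : ℝ) : ℝ := (1 - y ^ 2) ^ (2 / (p - 1))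

/-- The energy `E(w,v)` of a pair of functions `(-1,1) → V`. -/
noncomputable def energyE {V : Type*} [NormedAddCommGroup V] [NormedSpace ℝ V]
    (p : ℝ) (w v : ℝ → V) : ℝ :=
  ∫ y in Set.Ioo (-1 : ℝ) 1,
    ((1 : ℝ) / 2 * ‖v y‖ ^ 2 + 1 / 2 * ‖deriv w y‖ ^ 2 * (1 - y ^ 2)
      + (p + 1) / (p - 1) ^ 2 * ‖w y‖ ^ 2 - ‖w y‖ ^ (p + 1) / (p + 1)) * rho p y

/-- The self-similar version `w_{x0}(y,s) = (T x0 - t)^{2/(p-1)} u(x,t)` with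
`y = (x-x0)/(T x0 - t)`, `s = -log (T x0 - t)`, i.e. `T x0 - t = e^{-s}`. -/
noncomputable def selfSim (p : ℝ) {m : ℕ} (u : ℝ → ℝ → EuclideanSpace ℝ (Fin m))
    (T : ℝ → ℝ) (x0 y s : ℝ) : EuclideanSpace ℝ (Fin m) :=
  Real.exp (-(2 / (p - 1)) * s) • u (x0 + y * Real.exp (-s)) (T x0 - Real.exp (-s))

section PartOne
variable {V : Type*} [NormedAddCommGroup V] [InnerProductSpace ℝ V]

noncomputable def al (p : ℝ) : ℝ := 2 / (p - 1)

theorem al_pos {p : ℝ} (hp : 1 < p) : 0 < al p := div_pos two_pos (by linarith)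
theorem al_mul {p : ℝ} (hp : 1 < p) : al p * (p - 1) = 2 := by
  unfold al; exact div_mul_cancel₀ _ (by linarith)
theorem al_mul_p {p : ℝ} (hp : 1 < p) : al p * p = al p + 2 := by
  have := al_mul hp; linarith

noncomputable def nl (p : ℝ) (v : V) : V := ‖v‖ ^ (p - 1) • v

theorem norm_nl {p : ℝ} (hp : 1 < p) (v : V) : ‖nl p v‖ = ‖v‖ ^ p := by
  unfold nl
  rw [norm_smul, Real.norm_of_nonneg (by positivity)]
  rcases eq_or_lt_of_le (norm_nonneg v) with h | h
  · rw [← h, mul_zero, Real.zero_rpow (by linarith)]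
  · nth_rewrite 2 [← Real.rpow_one ‖v‖]
    rw [← Real.rpow_add h]; congr 1; ring

theorem nl_smul {p : ℝ} (hp : 1 < p) {c : ℝ} (hc : 0 < c) (v : V) :
    nl p (c • v) = c ^ p • nl p v := by
  unfold nl
  rw [norm_smul, Real.norm_of_nonneg hc.le, Real.mul_rpow hc.le (norm_nonneg _), smul_smul,
    smul_smul]
  congr 1
  have : c ^ p = c ^ (p - 1) * c := by
    nth_rewrite 3 [← Real.rpow_one c]
    rw [← Real.rpow_add hc]; congr 1; ring
  rw [this]; ring

theorem inner_nl {p : ℝ} (hp : 1 < p) (v : V) : inner ℝ v (nl p v) = ‖v‖ ^ (p + 1) := by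
  unfold nl
  rw [inner_smul_right, real_inner_self_eq_norm_sq]
  rcases eq_or_lt_of_le (norm_nonneg v) with h | h
  · rw [← h, Real.zero_rpow (by linarith : p + 1 ≠ 0)]; simp
  · rw [← Real.rpow_natCast, ← Real.rpow_add h]; congr 1; push_cast; ring

noncomputable def dnl (p : ℝ) (x : V) : V →L[ℝ] V :=
  ‖x‖ ^ (p - 1) • ContinuousLinearMap.id ℝ V
    + ((p - 1) * ‖x‖ ^ (p - 3)) • (innerSL ℝ x).smulRight x

theorem norm_dnl_le {p : ℝ} (hp : 1 < p) (x : V) : ‖dnl p x‖ ≤ p * ‖x‖ ^ (p - 1) := by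
  refine ContinuousLinearMap.opNorm_le_bound _ (by positivity) (fun h => ?_)
  have e : dnl p x h = ‖x‖ ^ (p - 1) • h + ((p - 1) * ‖x‖ ^ (p - 3)) • (inner ℝ x h • x) := by
    simp [dnl]
  rw [e]
  rcases eq_or_lt_of_le (norm_nonneg x) with h0 | h0
  · have : x = 0 := norm_eq_zero.1 h0.symm
    subst this
    simp [Real.zero_rpow (by linarith : p - 1 ≠ 0)]
  · calc _ ≤ ‖‖x‖ ^ (p - 1) • h‖ + ‖((p - 1) * ‖x‖ ^ (p - 3)) • (inner ℝ x h • x)‖ := norm_add_le _ _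
      _ ≤ ‖x‖ ^ (p - 1) * ‖h‖ + ((p - 1) * ‖x‖ ^ (p - 3)) * ((‖x‖ * ‖h‖) * ‖x‖) := by
        rw [norm_smul, norm_smul, norm_smul, Real.norm_of_nonneg (by positivity),
          Real.norm_of_nonneg (mul_nonneg (by linarith) (by positivity))]
        have := norm_inner_le_norm (𝕜 := ℝ) x h
        have h2 : 0 ≤ p - 1 := by linarith
        gcongr
      _ = p * ‖x‖ ^ (p - 1) * ‖h‖ := by
        have : ‖x‖ ^ (p - 1) = ‖x‖ ^ (p - 3) * ‖x‖ ^ 2 := by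
          rw [← Real.rpow_natCast, ← Real.rpow_add h0]; congr 1; push_cast; ring
        rw [this]; ring

theorem hasFDerivAt_nl {p : ℝ} (hp : 1 < p) (x : V) : HasFDerivAt (nl p) (dnl p x) x := by
  by_cases hx : x = 0
  · subst hx
    have : dnl p (0 : V) = 0 := by
      simp [dnl, Real.zero_rpow (by linarith : p - 1 ≠ 0)]
    rw [this]
    rw [hasFDerivAt_iff_isLittleO_nhds_zero]
    simp only [zero_add, ContinuousLinearMap.zero_apply, sub_zero]
    have h0 : nl p (0 : V) = 0 := by simp [nl]
    rw [h0]; simp only [sub_zero]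
    rw [Asymptotics.isLittleO_iff]
    intro c hc
    have hcont : Tendsto (fun h : V => ‖h‖ ^ (p - 1)) (nhds 0) (nhds 0) := by
      have : Continuous (fun h : V => ‖h‖ ^ (p - 1)) :=
        continuous_norm.rpow_const (fun _ => Or.inr (by linarith))
      have h2 := this.tendsto 0
      simpa [Real.zero_rpow (by linarith : p - 1 ≠ 0)] using h2
    filter_upwards [hcont.eventually (gt_mem_nhds hc)] with h hh
    unfold nl
    rw [norm_smul, Real.norm_of_nonneg (by positivity)]
    gcongr
  · have hx' : 0 < ‖x‖ := norm_pos_iff.2 hx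
    have h1 : HasFDerivAt (fun x : V => (‖x‖ ^ 2) ^ ((p - 1) / 2))
        ((((p - 1) / 2) * (‖x‖ ^ 2) ^ ((p - 1) / 2 - 1)) • (2 • innerSL ℝ x)) x :=
      (hasStrictFDerivAt_norm_sq x).hasFDerivAt.rpow_const (Or.inl (by positivity))
    have h2 := h1.smul (hasFDerivAt_id x)
    have key : ∀ (y : V) (q : ℝ), (‖y‖ ^ 2) ^ q = ‖y‖ ^ (2 * q) := by
      intro y q
      rw [← Real.rpow_natCast, ← Real.rpow_mul (norm_nonneg _)]; simp
    have e1 : (nl p : V → V) = (fun x : V => (‖x‖ ^ 2) ^ ((p - 1) / 2)) • id := by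
      funext y
      simp only [nl, Pi.smul_apply', id, key]
      congr 2; ring
    have e2 : dnl p x = (‖x‖ ^ 2) ^ ((p - 1) / 2) • ContinuousLinearMap.id ℝ V +
      (((p - 1) / 2 * (‖x‖ ^ 2) ^ ((p - 1) / 2 - 1)) • 2 • (innerSL ℝ) x).smulRight (id x) := by
      have q1 : 2 * ((p - 1) / 2) = p - 1 := by ring
      have q2 : 2 * ((p - 1) / 2 - 1) = p - 3 := by ring
      ext h
      simp only [dnl, key, q1, q2, ContinuousLinearMap.add_apply, ContinuousLinearMap.smul_apply,
        ContinuousLinearMap.smulRight_apply, innerSL_apply_apply, smul_smul, id, two_smul,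
        smul_eq_mul]
      congr 2; ring
    rw [e1, e2]; exact h2

theorem continuous_dnl {p : ℝ} (hp : 1 < p) : Continuous (dnl p : V → V →L[ℝ] V) := by
  rw [continuous_iff_continuousAt]
  intro x
  by_cases hx : x = 0
  · subst hx
    have h0 : dnl p (0 : V) = 0 := by
      simp [dnl, Real.zero_rpow (by linarith : p - 1 ≠ 0)]
    rw [ContinuousAt, h0]
    refine squeeze_zero_norm (fun x => norm_dnl_le hp x) ?_
    have : Continuous (fun h : V => p * ‖h‖ ^ (p - 1)) :=
      continuous_const.mul (continuous_norm.rpow_const (fun _ => Or.inr (by linarith)))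
    have h2 := this.tendsto 0
    simpa [Real.zero_rpow (by linarith : p - 1 ≠ 0)] using h2
  · have hx' : ‖x‖ ≠ 0 := norm_ne_zero_iff.2 hx
    have c1 : ContinuousAt (fun x : V => ‖x‖ ^ (p - 1)) x :=
      continuous_norm.continuousAt.rpow_const (Or.inl hx')
    have c2 : ContinuousAt (fun x : V => ‖x‖ ^ (p - 3)) x :=
      continuous_norm.continuousAt.rpow_const (Or.inl hx')
    have c3 : Continuous (fun x : V => (innerSL ℝ x).smulRight x) := by
      have : Continuous fun x : V => ContinuousLinearMap.smulRightL ℝ V V (innerSL ℝ x) x := by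
        fun_prop
      exact this
    unfold dnl
    exact (c1.smul continuousAt_const).add ((continuousAt_const.mul c2).smul c3.continuousAt)

theorem continuous_nl {p : ℝ} (hp : 1 < p) : Continuous (nl p : V → V) :=
  continuous_iff_continuousAt.2 fun x => (hasFDerivAt_nl hp x).continuousAt

theorem nl_lip {p : ℝ} (hp : 1 < p) {M : ℝ} {a b : V} (ha : ‖a‖ ≤ M) (hb : ‖b‖ ≤ M) :
    ‖nl p a - nl p b‖ ≤ p * M ^ (p - 1) * ‖a - b‖ := by
  have hc : Convex ℝ (Metric.closedBall (0 : V) M) := convex_closedBall _ _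
  refine hc.norm_image_sub_le_of_norm_hasFDerivWithin_le
    (f' := fun x => dnl p x) (fun x hx => (hasFDerivAt_nl hp x).hasFDerivWithinAt)
    (fun x hx => ?_) (by simpa using hb) (by simpa using ha)
  have hx' : ‖x‖ ≤ M := by simpa using hx
  refine (norm_dnl_le hp x).trans ?_
  have : 0 ≤ p - 1 := by linarith
  gcongr

theorem hasDerivAt_norm_pow {p : ℝ} (hp : 1 < p) {g : ℝ → V} {g' : V} {s : ℝ}
    (hg : HasDerivAt g g' s) :
    HasDerivAt (fun s => ‖g s‖ ^ (p + 1) / (p + 1)) (inner ℝ (nl p (g s)) g') s := by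
  have h := ((hasFDerivAt_norm_rpow (g s) (by linarith : 1 < p + 1)).comp_hasDerivAt s hg).div_const
    (p + 1)
  have : p + 1 ≠ 0 := by linarith
  have e : inner ℝ (nl p (g s)) g' =
      (((p + 1) * ‖g s‖ ^ (p + 1 - 2)) • innerSL ℝ (g s)) g' / (p + 1) := by
    rw [show p + 1 - 2 = p - 1 by ring]
    simp only [nl, real_inner_smul_left, ContinuousLinearMap.smul_apply, innerSL_apply_apply,
      smul_eq_mul]
    field_simp
  rw [e]; exact h

end PartOne

section PartTwo
variable {V : Type*} [NormedAddCommGroup V] [InnerProductSpace ℝ V]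

noncomputable def lin (b a : V) : ℝ × ℝ →L[ℝ] V :=
  (ContinuousLinearMap.fst ℝ ℝ ℝ).smulRight b + (ContinuousLinearMap.snd ℝ ℝ ℝ).smulRight a

theorem lin_apply (b a : V) (q : ℝ × ℝ) : lin b a q = q.1 • b + q.2 • a := by simp [lin]

theorem lin_comp {g : ℝ → ℝ → V} {b a : V} {X S : ℝ → ℝ} {x' s' τ : ℝ}
    (hg : HasFDerivAt (fun q : ℝ × ℝ => g q.1 q.2) (lin b a) (X τ, S τ))
    (hX : HasDerivAt X x' τ) (hS : HasDerivAt S s' τ) :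
    HasDerivAt (fun τ => g (X τ) (S τ)) (x' • b + s' • a) τ := by
  have := hg.comp_hasDerivAt τ (hX.prodMk hS)
  rw [lin_apply] at this
  exact this

structure Sol (p : ℝ) (O : Set (ℝ × ℝ)) (u A B C G : ℝ → ℝ → V) : Prop where
  op : IsOpen O
  du : ∀ x t, (x, t) ∈ O → HasFDerivAt (fun q : ℝ × ℝ => u q.1 q.2) (lin (B x t) (A x t)) (x, t)
  dA : ∀ x t, (x, t) ∈ O →
    HasFDerivAt (fun q : ℝ × ℝ => A q.1 q.2) (lin (C x t) (G x t + nl p (u x t))) (x, t)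
  dB : ∀ x t, (x, t) ∈ O → HasFDerivAt (fun q : ℝ × ℝ => B q.1 q.2) (lin (G x t) (C x t)) (x, t)
  cC : ContinuousOn (fun q : ℝ × ℝ => C q.1 q.2) O
  cG : ContinuousOn (fun q : ℝ × ℝ => G q.1 q.2) O

theorem Sol.cu {p : ℝ} {O : Set (ℝ × ℝ)} {u A B C G : ℝ → ℝ → V} (h : Sol p O u A B C G) :
    ContinuousOn (fun q : ℝ × ℝ => u q.1 q.2) O :=
  fun q hq => (h.du q.1 q.2 hq).continuousAt.continuousWithinAt
theorem Sol.cA {p : ℝ} {O : Set (ℝ × ℝ)} {u A B C G : ℝ → ℝ → V} (h : Sol p O u A B C G) :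
    ContinuousOn (fun q : ℝ × ℝ => A q.1 q.2) O :=
  fun q hq => (h.dA q.1 q.2 hq).continuousAt.continuousWithinAt
theorem Sol.cB {p : ℝ} {O : Set (ℝ × ℝ)} {u A B C G : ℝ → ℝ → V} (h : Sol p O u A B C G) :
    ContinuousOn (fun q : ℝ × ℝ => B q.1 q.2) O :=
  fun q hq => (h.dB q.1 q.2 hq).continuousAt.continuousWithinAt

/-- the solution structure from a `C²` solution -/
theorem sol_of_C2 {p : ℝ} {O : Set (ℝ × ℝ)} (hO : IsOpen O) {u : ℝ → ℝ → V}
    (hreg : ContDiffOn ℝ 2 (fun q : ℝ × ℝ => u q.1 q.2) O)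
    (heq : ∀ x t, (x, t) ∈ O →
      deriv (fun τ => deriv (fun τ' => u x τ') τ) t =
        deriv (fun z => deriv (fun z' => u z' t) z) x + ‖u x t‖ ^ (p - 1) • u x t) :
    Sol p O u (fun x t => deriv (fun τ => u x τ) t) (fun x t => deriv (fun z => u z t) x)
      (fun x t => deriv (fun z => deriv (fun τ => u z τ) t) x)
      (fun x t => deriv (fun z => deriv (fun z' => u z' t) z) x) := by
  set U : ℝ × ℝ → V := fun q : ℝ × ℝ => u q.1 q.2 with hU
  have hd : ∀ q ∈ O, HasFDerivAt U (fderiv ℝ U q) q := fun q hq =>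
    ((hreg.contDiffAt (hO.mem_nhds hq)).differentiableAt (by norm_num)).hasFDerivAt
  have hD1 : ContDiffOn ℝ 1 (fderiv ℝ U) O :=
    hreg.fderiv_of_isOpen hO (by norm_num)
  have hDd : ∀ q ∈ O, HasFDerivAt (fderiv ℝ U) (fderiv ℝ (fderiv ℝ U) q) q := fun q hq =>
    ((hD1.contDiffAt (hO.mem_nhds hq)).differentiableAt (by norm_num)).hasFDerivAt
  have hD2 : ContinuousOn (fderiv ℝ (fderiv ℝ U)) O :=
    (hD1.fderiv_of_isOpen hO (m := 0) (by norm_num)).continuousOn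
  have inx : ∀ x t : ℝ, HasDerivAt (fun z : ℝ => (z, t)) ((1 : ℝ), (0 : ℝ)) x := fun x t =>
    (hasDerivAt_id x).prodMk (hasDerivAt_const x t)
  have int : ∀ x t : ℝ, HasDerivAt (fun τ : ℝ => (x, τ)) ((0 : ℝ), (1 : ℝ)) t := fun x t =>
    (hasDerivAt_const t x).prodMk (hasDerivAt_id t)
  have hA : ∀ x t, (x, t) ∈ O → deriv (fun τ => u x τ) t = fderiv ℝ U (x, t) (0, 1) :=
    fun x t h => ((hd _ h).comp_hasDerivAt t (int x t)).deriv
  have hB : ∀ x t, (x, t) ∈ O → deriv (fun z => u z t) x = fderiv ℝ U (x, t) (1, 0) :=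
    fun x t h => (HasFDerivAt.comp_hasDerivAt (f := fun z : ℝ => (z, t)) x (hd (x, t) h) (inx x t)).deriv
  have app : ∀ (e : ℝ × ℝ) q, q ∈ O → HasFDerivAt (fun q => fderiv ℝ U q e)
      ((ContinuousLinearMap.apply ℝ V e).comp (fderiv ℝ (fderiv ℝ U) q)) q := fun e q hq =>
    (ContinuousLinearMap.apply ℝ V e).hasFDerivAt.comp q (hDd q hq)
  have hA' : ∀ q ∈ O, HasFDerivAt (fun q : ℝ × ℝ => deriv (fun τ => u q.1 τ) q.2)
      ((ContinuousLinearMap.apply ℝ V ((0, 1) : ℝ × ℝ)).comp (fderiv ℝ (fderiv ℝ U) q)) q := by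
    intro q hq
    refine (app (0, 1) q hq).congr_of_eventuallyEq ?_
    filter_upwards [hO.mem_nhds hq] with r hr using hA r.1 r.2 hr
  have hB' : ∀ q ∈ O, HasFDerivAt (fun q : ℝ × ℝ => deriv (fun z => u z q.2) q.1)
      ((ContinuousLinearMap.apply ℝ V ((1, 0) : ℝ × ℝ)).comp (fderiv ℝ (fderiv ℝ U) q)) q := by
    intro q hq
    refine (app (1, 0) q hq).congr_of_eventuallyEq ?_
    filter_upwards [hO.mem_nhds hq] with r hr using hB r.1 r.2 hr
  have hC : ∀ x t, (x, t) ∈ O → deriv (fun z => deriv (fun τ => u z τ) t) x =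
      fderiv ℝ (fderiv ℝ U) (x, t) (1, 0) (0, 1) :=
    fun x t h => (HasFDerivAt.comp_hasDerivAt (f := fun z : ℝ => (z, t)) x (hA' (x, t) h) (inx x t)).deriv
  have hG : ∀ x t, (x, t) ∈ O → deriv (fun z => deriv (fun z' => u z' t) z) x =
      fderiv ℝ (fderiv ℝ U) (x, t) (1, 0) (1, 0) :=
    fun x t h => (HasFDerivAt.comp_hasDerivAt (f := fun z : ℝ => (z, t)) x (hB' (x, t) h) (inx x t)).deriv
  have hAt : ∀ x t, (x, t) ∈ O → deriv (fun τ => deriv (fun τ' => u x τ') τ) t =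
      fderiv ℝ (fderiv ℝ U) (x, t) (0, 1) (0, 1) :=
    fun x t h => ((hA' _ h).comp_hasDerivAt t (int x t)).deriv
  have symm : ∀ q ∈ O, fderiv ℝ (fderiv ℝ U) q (0, 1) (1, 0) = fderiv ℝ (fderiv ℝ U) q (1, 0) (0, 1) := by
    intro q hq
    have := (hreg.contDiffAt (hO.mem_nhds hq)).isSymmSndFDerivAt (by simp)
    exact this _ _
  have dec : ∀ e : ℝ × ℝ, e = e.1 • ((1, 0) : ℝ × ℝ) + e.2 • ((0, 1) : ℝ × ℝ) := by
    intro e; ext <;> simp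
  refine ⟨hO, ?_, ?_, ?_, ?_, ?_⟩
  · intro x t h
    convert hd _ h using 1
    refine ContinuousLinearMap.ext fun e => ?_
    rw [lin_apply, hA x t h, hB x t h]
    conv_rhs => rw [dec e, map_add, map_smul, map_smul]
  · intro x t h
    convert hA' _ h using 1
    refine ContinuousLinearMap.ext fun e => ?_
    have := heq x t h
    rw [lin_apply, nl, ← this, hAt x t h, hC x t h]
    rw [ContinuousLinearMap.comp_apply, ContinuousLinearMap.apply_apply]
    conv_rhs => rw [dec e, map_add, map_smul, map_smul]
    rfl
  · intro x t h
    convert hB' _ h using 1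
    refine ContinuousLinearMap.ext fun e => ?_
    rw [lin_apply, hG x t h, hC x t h, ← symm _ h]
    rw [ContinuousLinearMap.comp_apply, ContinuousLinearMap.apply_apply]
    conv_rhs => rw [dec e, map_add, map_smul, map_smul]
    rfl
  · refine ContinuousOn.congr (f := fun q => fderiv ℝ (fderiv ℝ U) q (1, 0) (0, 1)) ?_
      (fun q hq => hC q.1 q.2 hq)
    exact (hD2.clm_apply continuousOn_const).clm_apply continuousOn_const
  · refine ContinuousOn.congr (f := fun q => fderiv ℝ (fderiv ℝ U) q (1, 0) (1, 0)) ?_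
      (fun q hq => hG q.1 q.2 hq)
    exact (hD2.clm_apply continuousOn_const).clm_apply continuousOn_const

theorem lin_affine {g : ℝ → ℝ → V} {b a : V} {x0 t0 k : ℝ} (c : ℝ) {x t : ℝ}
    (hg : HasFDerivAt (fun q : ℝ × ℝ => g q.1 q.2) (lin b a) (x0 + k * x, t0 + k * t)) :
    HasFDerivAt (fun q : ℝ × ℝ => c • g (x0 + k * q.1) (t0 + k * q.2))
      (lin ((c * k) • b) ((c * k) • a)) (x, t) := by
  have h1 : HasFDerivAt (fun q : ℝ × ℝ => (x0 + k * q.1, t0 + k * q.2))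
      ((k • ContinuousLinearMap.fst ℝ ℝ ℝ).prod (k • ContinuousLinearMap.snd ℝ ℝ ℝ)) (x, t) :=
    HasFDerivAt.prodMk (((hasFDerivAt_fst (𝕜 := ℝ) (p := (x, t))).const_mul k).const_add x0)
      (((hasFDerivAt_snd (𝕜 := ℝ) (p := (x, t))).const_mul k).const_add t0)
  have h2 := (HasFDerivAt.comp (x, t) hg h1).const_smul c
  refine HasFDerivAt.congr_fderiv h2 ?_
  refine ContinuousLinearMap.ext fun e => ?_
  simp [lin_apply, smul_smul, mul_assoc, mul_comm, mul_left_comm]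

theorem Sol.scale {p : ℝ} (hp : 1 < p) {O : Set (ℝ × ℝ)} {u A B C G : ℝ → ℝ → V}
    (h : Sol p O u A B C G) (x0 t0 : ℝ) {k : ℝ} (hk : 0 < k) :
    Sol p {q : ℝ × ℝ | (x0 + k * q.1, t0 + k * q.2) ∈ O}
      (fun x t => k ^ al p • u (x0 + k * x) (t0 + k * t))
      (fun x t => k ^ (al p + 1) • A (x0 + k * x) (t0 + k * t))
      (fun x t => k ^ (al p + 1) • B (x0 + k * x) (t0 + k * t))
      (fun x t => k ^ (al p + 2) • C (x0 + k * x) (t0 + k * t))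
      (fun x t => k ^ (al p + 2) • G (x0 + k * x) (t0 + k * t)) := by
  have e1 : k ^ al p * k = k ^ (al p + 1) := by rw [Real.rpow_add hk, Real.rpow_one]
  have e2 : k ^ (al p + 1) * k = k ^ (al p + 2) := by
    rw [show al p + 2 = al p + 1 + 1 by ring, Real.rpow_add hk (al p + 1), Real.rpow_one]
  have cont : Continuous (fun q : ℝ × ℝ => (x0 + k * q.1, t0 + k * q.2)) := by fun_prop
  refine ⟨h.op.preimage cont, ?_, ?_, ?_, ?_, ?_⟩
  · intro x t hx
    have := lin_affine (k ^ al p) (h.du _ _ hx)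
    rwa [e1] at this
  · intro x t hx
    have := lin_affine (k ^ (al p + 1)) (h.dA _ _ hx)
    rw [e2] at this
    rw [nl_smul hp (by positivity), ← Real.rpow_mul hk.le, al_mul_p hp, ← smul_add]
    exact this
  · intro x t hx
    have := lin_affine (k ^ (al p + 1)) (h.dB _ _ hx)
    rwa [e2] at this
  · exact (h.cC.comp cont.continuousOn (fun q hq => hq)).const_smul _
  · exact (h.cG.comp cont.continuousOn (fun q hq => hq)).const_smul _

/-- self-similar system -/
structure WSys (p : ℝ) (S : Set (ℝ × ℝ)) (w v z vy zy : ℝ → ℝ → V) : Prop where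
  ws : ∀ y s, (y, s) ∈ S → HasDerivAt (fun s => w y s) (v y s) s
  wy : ∀ y s, (y, s) ∈ S → HasDerivAt (fun y => w y s) (z y s) y
  zs : ∀ y s, (y, s) ∈ S → HasDerivAt (fun s => z y s) (vy y s) s
  dzy : ∀ y s, (y, s) ∈ S → HasDerivAt (fun y => z y s) (zy y s) y
  dvy : ∀ y s, (y, s) ∈ S → HasDerivAt (fun y => v y s) (vy y s) y
  vs : ∀ y s, (y, s) ∈ S → HasDerivAt (fun s => v y s)
    ((1 - y ^ 2) • zy y s - (2 * (al p + 1) * y) • z y s - (al p * (al p + 1)) • w y s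
      + nl p (w y s) - (2 * al p + 1) • v y s - (2 * y) • vy y s) s
  cw : ContinuousOn (fun q : ℝ × ℝ => w q.1 q.2) S
  cv : ContinuousOn (fun q : ℝ × ℝ => v q.1 q.2) S
  cz : ContinuousOn (fun q : ℝ × ℝ => z q.1 q.2) S
  cvy : ContinuousOn (fun q : ℝ × ℝ => vy q.1 q.2) S
  czy : ContinuousOn (fun q : ℝ × ℝ => zy q.1 q.2) S

noncomputable def ss (k x0 T0 : ℝ) (u : ℝ → ℝ → V) (y s : ℝ) : V :=
  Real.exp (-k * s) • u (x0 + y * Real.exp (-s)) (T0 - Real.exp (-s))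

theorem ss_hasDerivAt_y {k x0 T0 y s : ℝ} {g : ℝ → ℝ → V} {b a : V}
    (hg : HasFDerivAt (fun q : ℝ × ℝ => g q.1 q.2) (lin b a)
      (x0 + y * Real.exp (-s), T0 - Real.exp (-s))) :
    HasDerivAt (fun y => ss k x0 T0 g y s) (Real.exp (-(k + 1) * s) • b) y := by
  have h1 : HasDerivAt (fun y : ℝ => x0 + y * Real.exp (-s)) (Real.exp (-s)) y := by
    simpa using ((hasDerivAt_id y).mul_const (Real.exp (-s))).const_add x0
  have := (lin_comp (X := fun y : ℝ => x0 + y * Real.exp (-s)) (S := fun _ => T0 - Real.exp (-s))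
    hg h1 (hasDerivAt_const y _)).const_smul (Real.exp (-k * s))
  refine HasDerivAt.congr_deriv this ?_
  rw [zero_smul, add_zero, smul_smul, ← Real.exp_add]; congr 2; ring

theorem ss_hasDerivAt_s {k x0 T0 y s : ℝ} {g : ℝ → ℝ → V} {b a : V}
    (hg : HasFDerivAt (fun q : ℝ × ℝ => g q.1 q.2) (lin b a)
      (x0 + y * Real.exp (-s), T0 - Real.exp (-s))) :
    HasDerivAt (fun s => ss k x0 T0 g y s) (-k • ss k x0 T0 g y s
      - y • (Real.exp (-(k + 1) * s) • b) + Real.exp (-(k + 1) * s) • a) s := by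
  have h0 : HasDerivAt (fun s : ℝ => Real.exp (-s)) (-Real.exp (-s)) s := by
    simpa using (hasDerivAt_neg s).exp
  have h1 : HasDerivAt (fun s : ℝ => x0 + y * Real.exp (-s)) (y * -Real.exp (-s)) s :=
    (h0.const_mul y).const_add x0
  have h2 : HasDerivAt (fun s : ℝ => T0 - Real.exp (-s)) (Real.exp (-s)) s := by
    simpa using h0.const_sub T0
  have h3 : HasDerivAt (fun s : ℝ => Real.exp (-k * s)) (-k * Real.exp (-k * s)) s := by
    have := ((hasDerivAt_id s).const_mul (-k)).exp
    refine HasDerivAt.congr_deriv this ?_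
    simp only [id]; ring
  have := h3.smul (lin_comp (X := fun s : ℝ => x0 + y * Real.exp (-s))
    (S := fun s => T0 - Real.exp (-s)) hg h1 h2)
  refine HasDerivAt.congr_deriv this ?_
  have e : Real.exp (-(k + 1) * s) = Real.exp (-k * s) * Real.exp (-s) := by
    rw [← Real.exp_add]; congr 1; ring
  unfold ss
  rw [e]
  module

theorem ss_cont {k x0 T0 : ℝ} {g : ℝ → ℝ → V} {O : Set (ℝ × ℝ)} {S : Set (ℝ × ℝ)}
    (hg : ContinuousOn (fun q : ℝ × ℝ => g q.1 q.2) O)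
    (hS : ∀ y s, (y, s) ∈ S → (x0 + y * Real.exp (-s), T0 - Real.exp (-s)) ∈ O) :
    ContinuousOn (fun q : ℝ × ℝ => ss k x0 T0 g q.1 q.2) S := by
  unfold ss
  have c1 : Continuous (fun q : ℝ × ℝ => (x0 + q.1 * Real.exp (-q.2), T0 - Real.exp (-q.2))) := by
    fun_prop
  have c2 : Continuous (fun q : ℝ × ℝ => Real.exp (-k * q.2)) := by fun_prop
  exact c2.continuousOn.smul (hg.comp c1.continuousOn (fun q hq => hS q.1 q.2 hq))

theorem Sol.wsys {p : ℝ} (hp : 1 < p) {O : Set (ℝ × ℝ)} {u A B C G : ℝ → ℝ → V}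
    (h : Sol p O u A B C G) (x0 T0 : ℝ) {S : Set (ℝ × ℝ)}
    (hS : ∀ y s, (y, s) ∈ S → (x0 + y * Real.exp (-s), T0 - Real.exp (-s)) ∈ O) :
    WSys p S (ss (al p) x0 T0 u)
      (fun y s => -al p • ss (al p) x0 T0 u y s - y • ss (al p + 1) x0 T0 B y s
        + ss (al p + 1) x0 T0 A y s)
      (ss (al p + 1) x0 T0 B)
      (fun y s => -(al p + 1) • ss (al p + 1) x0 T0 B y s - y • ss (al p + 2) x0 T0 G y s
        + ss (al p + 2) x0 T0 C y s)
      (ss (al p + 2) x0 T0 G) := by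
  have two : al p + 1 + 1 = al p + 2 := by ring
  have cu := ss_cont (k := al p) h.cu hS
  have cA := ss_cont (k := al p + 1) h.cA hS
  have cB := ss_cont (k := al p + 1) h.cB hS
  have cC := ss_cont (k := al p + 2) h.cC hS
  have cG := ss_cont (k := al p + 2) h.cG hS
  have us := fun y s hs => ss_hasDerivAt_s (k := al p) (h.du _ _ (hS y s hs))
  have uy := fun y s hs => ss_hasDerivAt_y (k := al p) (h.du _ _ (hS y s hs))
  have As := fun y s hs => ss_hasDerivAt_s (k := al p + 1) (h.dA _ _ (hS y s hs))
  have Ay := fun y s hs => ss_hasDerivAt_y (k := al p + 1) (h.dA _ _ (hS y s hs))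
  have Bs := fun y s hs => ss_hasDerivAt_s (k := al p + 1) (h.dB _ _ (hS y s hs))
  have By := fun y s hs => ss_hasDerivAt_y (k := al p + 1) (h.dB _ _ (hS y s hs))
  rw [two] at As Ay Bs By
  have hnl : ∀ y s, nl p (ss (al p) x0 T0 u y s) =
      Real.exp (-(al p + 2) * s) • nl p (u (x0 + y * Real.exp (-s)) (T0 - Real.exp (-s))) := by
    intro y s
    unfold ss
    rw [nl_smul hp (Real.exp_pos _), ← Real.exp_mul, ← al_mul_p hp]
    congr 2; ring
  refine ⟨us, uy, Bs, By, ?_, ?_, cu, ?_, cB, ?_, cG⟩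
  · intro y s hs
    have := (((uy y s hs).const_smul (-al p)).sub ((hasDerivAt_id y).smul (By y s hs))).add (Ay y s hs)
    refine HasDerivAt.congr_deriv this ?_
    simp only [ss, id]
    module
  · intro y s hs
    have := (((us y s hs).const_smul (-al p)).sub ((Bs y s hs).const_smul y)).add (As y s hs)
    refine HasDerivAt.congr_deriv this ?_
    rw [hnl]
    simp only [ss]
    module
  · exact ((cu.const_smul (-al p)).sub (continuousOn_fst.smul cB)).add cA
  · exact ((cB.const_smul (-(al p + 1))).sub (continuousOn_fst.smul cG)).add cC

end PartTwo

section PartThree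

noncomputable def sig (p y : ℝ) : ℝ := (1 - y ^ 2) ^ (al p - 1)

theorem sig_nonneg {p y : ℝ} (hy : y ∈ Icc (-1 : ℝ) 1) : 0 ≤ sig p y :=
  Real.rpow_nonneg (by nlinarith [hy.1, hy.2]) _

theorem rho_eq {p y : ℝ} (hp : 1 < p) (hy : y ∈ Icc (-1 : ℝ) 1) :
    rho p y = sig p y * (1 - y ^ 2) := by
  have h0 : 0 ≤ 1 - y ^ 2 := by nlinarith [hy.1, hy.2]
  unfold rho sig
  change _ ^ al p = _
  rcases eq_or_lt_of_le h0 with h | h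
  · rw [← h, Real.zero_rpow (al_pos hp).ne', mul_zero]
  · nth_rewrite 3 [← Real.rpow_one (1 - y ^ 2)]
    rw [← Real.rpow_add h]; congr 1; ring

theorem continuous_rho {p : ℝ} (hp : 1 < p) : Continuous (rho p) := by
  unfold rho
  exact Continuous.rpow_const (by fun_prop) (fun _ => Or.inr (al_pos hp).le)

theorem sig_int {p : ℝ} (hp : 1 < p) : IntervalIntegrable (sig p) volume (-1) 1 := by
  have ha := al_pos hp
  have e : ∀ y ∈ Icc (-1 : ℝ) 1, sig p y = (1 - y) ^ (al p - 1) * (1 + y) ^ (al p - 1) := by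
    intro y hy
    unfold sig
    rw [← Real.mul_rpow (by linarith [hy.2]) (by linarith [hy.1])]; congr 1; ring
  have i1 : IntervalIntegrable (fun y : ℝ => (1 - y) ^ (al p - 1)) volume 0 1 := by
    have := (intervalIntegral.intervalIntegrable_rpow' (a := 1) (b := 0)
      (by linarith : -1 < al p - 1)).comp_sub_left 1
    simpa using this
  have i2 : IntervalIntegrable (fun y : ℝ => (1 + y) ^ (al p - 1)) volume (-1) 0 := by
    have := (intervalIntegral.intervalIntegrable_rpow' (a := 0) (b := 1)
      (by linarith : -1 < al p - 1)).comp_add_left 1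
    simpa using this
  have j1 : IntervalIntegrable (sig p) volume 0 1 := by
    have : IntervalIntegrable (fun y : ℝ => (1 - y) ^ (al p - 1) * (1 + y) ^ (al p - 1))
        volume 0 1 := by
      refine i1.mul_continuousOn ?_
      rw [uIcc_of_le zero_le_one]
      exact ContinuousOn.rpow_const (by fun_prop) (fun y hy => Or.inl (by linarith [hy.1]))
    refine this.congr ?_
    intro y hy
    rw [uIoc_of_le zero_le_one] at hy
    exact (e y ⟨by linarith [hy.1], hy.2⟩).symm
  have j2 : IntervalIntegrable (sig p) volume (-1) 0 := by
    have : IntervalIntegrable (fun y : ℝ => (1 - y) ^ (al p - 1) * (1 + y) ^ (al p - 1))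
        volume (-1) 0 := by
      refine i2.continuousOn_mul ?_
      rw [uIcc_of_le (by norm_num)]
      exact ContinuousOn.rpow_const (by fun_prop)
        (fun y hy => Or.inl (by have := hy.2; intro h; linarith))
    refine this.congr ?_
    intro y hy
    rw [uIoc_of_le (by norm_num)] at hy
    exact (e y ⟨hy.1.le, by linarith [hy.2]⟩).symm
  exact j2.trans j1

/-- differentiation under the integral sign -/
theorem hasDerivAt_int {F : Type*} [NormedAddCommGroup F] [NormedSpace ℝ F] [CompleteSpace F]
    {g g' : ℝ → ℝ → F} {k : ℝ → ℝ} {a b : ℝ} (hab : a ≤ b) {J : Set ℝ} (hJ : IsOpen J)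
    (hk : IntervalIntegrable k volume a b)
    (hg : ∀ y ∈ Icc a b, ∀ s ∈ J, HasDerivAt (fun s => g y s) (g' y s) s)
    (cg : ContinuousOn (fun q : ℝ × ℝ => g q.1 q.2) (Icc a b ×ˢ J))
    (cg' : ContinuousOn (fun q : ℝ × ℝ => g' q.1 q.2) (Icc a b ×ˢ J))
    {s : ℝ} (hs : s ∈ J) :
    HasDerivAt (fun s => ∫ y in a..b, k y • g y s) (∫ y in a..b, k y • g' y s) s := by
  obtain ⟨ε, hε, hball⟩ := Metric.isOpen_iff.1 hJ s hs
  have hsub : Icc (s - ε / 2) (s + ε / 2) ⊆ J := by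
    intro x hx
    apply hball
    rw [Metric.mem_ball, Real.dist_eq, abs_lt]
    constructor <;> linarith [hx.1, hx.2]
  have hcomp : IsCompact (Icc a b ×ˢ Icc (s - ε / 2) (s + ε / 2)) := isCompact_Icc.prod isCompact_Icc
  obtain ⟨M, hM⟩ := hcomp.exists_bound_of_continuousOn
    (cg'.mono (Set.prod_mono le_rfl hsub))
  have slice : ∀ (G : ℝ → ℝ → F), ContinuousOn (fun q : ℝ × ℝ => G q.1 q.2) (Icc a b ×ˢ J) →
      ∀ x ∈ J, ContinuousOn (fun y => G y x) (Icc a b) := by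
    intro G hG x hx
    exact hG.comp (f := fun y => (y, x)) (by fun_prop) (fun y hy => ⟨hy, hx⟩)
  have hint : ∀ (G : ℝ → F), ContinuousOn G (Icc a b) →
      IntervalIntegrable (fun y => k y • G y) volume a b := by
    intro G hG
    exact hk.smul_continuousOn (by rwa [uIcc_of_le hab])
  have hmem : Metric.ball s (ε / 2) ⊆ Icc (s - ε / 2) (s + ε / 2) := by
    rw [Real.ball_eq_Ioo]; exact Ioo_subset_Icc_self
  refine (intervalIntegral.hasDerivAt_integral_of_dominated_loc_of_deriv_le
    (F' := fun x y => k y • g' y x) (F := fun x y => k y • g y x)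
    (bound := fun y => ‖k y‖ * M) (Metric.ball_mem_nhds s (half_pos hε)) ?_ ?_ ?_ ?_ ?_ ?_).2
  · filter_upwards [hJ.mem_nhds hs] with x hx
    have := (hint _ (slice g cg x hx)).aestronglyMeasurable
    rwa [uIoc_of_le hab]
  · exact hint _ (slice g cg s hs)
  · have := (hint _ (slice g' cg' s hs)).aestronglyMeasurable
    rwa [uIoc_of_le hab]
  · refine ae_of_all _ (fun y hy x hx => ?_)
    rw [uIoc_of_le hab] at hy
    rw [norm_smul]
    exact mul_le_mul_of_nonneg_left (hM (y, x) ⟨Ioc_subset_Icc_self hy, hmem hx⟩) (norm_nonneg _)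
  · exact hk.norm.mul_const M
  · refine ae_of_all _ (fun y hy x hx => ?_)
    rw [uIoc_of_le hab] at hy
    exact (hg y (Ioc_subset_Icc_self hy) x (hsub (hmem hx))).const_smul (k y)

/-- weighted integral -/
noncomputable def II (p : ℝ) (g : ℝ → ℝ) : ℝ := ∫ y in (-1 : ℝ)..1, sig p y * g y

theorem II_int {p : ℝ} (hp : 1 < p) {g : ℝ → ℝ} (hg : ContinuousOn g (Icc (-1) 1)) :
    IntervalIntegrable (fun y => sig p y * g y) volume (-1) 1 :=
  (sig_int hp).mul_continuousOn (by rwa [uIcc_of_le (by norm_num)])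

theorem II_add {p : ℝ} (hp : 1 < p) {g h : ℝ → ℝ} (hg : ContinuousOn g (Icc (-1) 1))
    (hh : ContinuousOn h (Icc (-1) 1)) : II p (fun y => g y + h y) = II p g + II p h := by
  unfold II
  rw [← intervalIntegral.integral_add (II_int hp hg) (II_int hp hh)]
  congr 1; funext y; ring

theorem II_mul {p : ℝ} (c : ℝ) {g : ℝ → ℝ} : II p (fun y => c * g y) = c * II p g := by
  unfold II
  rw [← intervalIntegral.integral_const_mul]
  congr 1; funext y; ring

theorem II_congr {p : ℝ} {g h : ℝ → ℝ} (e : ∀ y ∈ Icc (-1 : ℝ) 1, g y = h y) :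
    II p g = II p h := by
  unfold II
  apply intervalIntegral.integral_congr
  intro y hy
  rw [uIcc_of_le (by norm_num)] at hy
  simp only [e y hy]

theorem II_mono {p : ℝ} (hp : 1 < p) {g h : ℝ → ℝ} (hg : ContinuousOn g (Icc (-1) 1))
    (hh : ContinuousOn h (Icc (-1) 1)) (e : ∀ y ∈ Icc (-1 : ℝ) 1, g y ≤ h y) :
    II p g ≤ II p h := by
  unfold II
  apply intervalIntegral.integral_mono_on (by norm_num) (II_int hp hg) (II_int hp hh)
  intro y hy
  exact mul_le_mul_of_nonneg_left (e y hy) (sig_nonneg hy)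

theorem II_nonneg {p : ℝ} {g : ℝ → ℝ} (e : ∀ y ∈ Icc (-1 : ℝ) 1, 0 ≤ g y) : 0 ≤ II p g := by
  unfold II
  apply intervalIntegral.integral_nonneg (by norm_num)
  intro y hy
  exact mul_nonneg (sig_nonneg hy) (e y hy)

theorem II_deriv {p : ℝ} (hp : 1 < p) {g g' : ℝ → ℝ → ℝ} {J : Set ℝ} (hJ : IsOpen J)
    (hg : ∀ y ∈ Icc (-1 : ℝ) 1, ∀ s ∈ J, HasDerivAt (fun s => g y s) (g' y s) s)
    (cg : ContinuousOn (fun q : ℝ × ℝ => g q.1 q.2) (Icc (-1) 1 ×ˢ J))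
    (cg' : ContinuousOn (fun q : ℝ × ℝ => g' q.1 q.2) (Icc (-1) 1 ×ˢ J))
    {s : ℝ} (hs : s ∈ J) :
    HasDerivAt (fun s => II p (fun y => g y s)) (II p (fun y => g' y s)) s :=
  hasDerivAt_int (by norm_num) hJ (sig_int hp) hg cg cg' hs

theorem II_parts {p : ℝ} (hp : 1 < p) {h h' : ℝ → ℝ}
    (hh : ∀ y ∈ Icc (-1 : ℝ) 1, HasDerivAt h (h' y) y) (ch : ContinuousOn h' (Icc (-1) 1)) :
    II p (fun y => (1 - y ^ 2) * h' y - 2 * al p * y * h y) = 0 := by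
  have chh : ContinuousOn h (Icc (-1) 1) := fun y hy => (hh y hy).continuousAt.continuousWithinAt
  have e := intervalIntegral.integral_eq_sub_of_hasDerivAt_of_le (a := -1) (b := 1)
    (f := fun y => rho p y * h y)
    (f' := fun y => sig p y * ((1 - y ^ 2) * h' y - 2 * al p * y * h y)) (by norm_num)
    ((continuous_rho hp).continuousOn.mul chh) ?_ (II_int hp (by fun_prop))
  · unfold II
    rw [e]
    have h1 : rho p 1 = 0 := by rw [rho_eq hp (by norm_num)]; norm_num
    have h2 : rho p (-1) = 0 := by rw [rho_eq hp (by norm_num)]; norm_num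
    rw [h1, h2]; ring
  · intro y hy
    have hpos : 0 < 1 - y ^ 2 := by nlinarith [hy.1, hy.2]
    have d0 : HasDerivAt (fun y : ℝ => 1 - y ^ 2) (-(2 * y)) y := by
      simpa using ((hasDerivAt_id y).pow 2).const_sub 1
    have d1 : HasDerivAt (rho p) (-(2 * y) * al p * sig p y) y :=
      d0.rpow_const (Or.inl hpos.ne')
    have := d1.mul (hh y (Ioo_subset_Icc_self hy))
    refine HasDerivAt.congr_deriv this ?_
    rw [rho_eq hp (Ioo_subset_Icc_self hy)]; ring

end PartThree

section PartFour
variable {V : Type*} [NormedAddCommGroup V] [InnerProductSpace ℝ V]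

theorem II_cont {p : ℝ} (hp : 1 < p) {g : ℝ → ℝ → ℝ} {J : Set ℝ} (hJ : IsOpen J)
    (cg : ContinuousOn (fun q : ℝ × ℝ => g q.1 q.2) (Icc (-1) 1 ×ˢ J)) :
    ContinuousOn (fun s => II p (fun y => g y s)) J := by
  intro s hs
  apply ContinuousAt.continuousWithinAt
  obtain ⟨ε, hε, hball⟩ := Metric.isOpen_iff.1 hJ s hs
  have hsub : Icc (s - ε / 2) (s + ε / 2) ⊆ J := by
    intro x hx
    apply hball
    rw [Metric.mem_ball, Real.dist_eq, abs_lt]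
    constructor <;> linarith [hx.1, hx.2]
  have hcomp : IsCompact (Icc (-1 : ℝ) 1 ×ˢ Icc (s - ε / 2) (s + ε / 2)) :=
    isCompact_Icc.prod isCompact_Icc
  obtain ⟨M, hM⟩ := hcomp.exists_bound_of_continuousOn (cg.mono (Set.prod_mono le_rfl hsub))
  have slice : ∀ x ∈ J, ContinuousOn (fun y => g y x) (Icc (-1) 1) := by
    intro x hx
    exact cg.comp (f := fun y => (y, x)) (by fun_prop) (fun y hy => ⟨hy, hx⟩)
  unfold II
  refine intervalIntegral.continuousAt_of_dominated_interval (bound := fun y => ‖sig p y‖ * M)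
    ?_ ?_ ?_ ?_
  · filter_upwards [hJ.mem_nhds hs] with x hx
    have := (II_int hp (slice x hx)).aestronglyMeasurable
    rwa [uIoc_of_le (by norm_num)]
  · filter_upwards [Icc_mem_nhds (show s - ε / 2 < s by linarith) (show s < s + ε / 2 by linarith)]
      with x hx
    refine ae_of_all _ (fun y hy => ?_)
    rw [uIoc_of_le (by norm_num)] at hy
    rw [norm_mul]
    exact mul_le_mul_of_nonneg_left (hM (y, x) ⟨Ioc_subset_Icc_self hy, hx⟩) (norm_nonneg _)
  · exact (sig_int hp).norm.mul_const M
  · refine ae_of_all _ (fun y hy => ?_)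
    rw [uIoc_of_le (by norm_num)] at hy
    have h1 : ContinuousOn (fun x => g y x) J :=
      cg.comp (f := fun x => (y, x)) (by fun_prop) (fun x hx => ⟨Ioc_subset_Icc_self hy, hx⟩)
    exact continuousAt_const.mul (h1.continuousAt (hJ.mem_nhds hs))

noncomputable def fE (p : ℝ) (w v z : ℝ → ℝ → V) (s : ℝ) : ℝ :=
  II p (fun y => (1 - y ^ 2) * (1 / 2 * ‖v y s‖ ^ 2 + 1 / 2 * ‖z y s‖ ^ 2 * (1 - y ^ 2)
    + al p * (al p + 1) / 2 * ‖w y s‖ ^ 2 - ‖w y s‖ ^ (p + 1) / (p + 1)))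
noncomputable def fF (p : ℝ) (w v : ℝ → ℝ → V) (s : ℝ) : ℝ :=
  II p (fun y => (1 - y ^ 2) * inner ℝ (w y s) (v y s))
noncomputable def fN (p : ℝ) (w : ℝ → ℝ → V) (s : ℝ) : ℝ :=
  II p (fun y => (1 - y ^ 2) * ‖w y s‖ ^ (p + 1))
noncomputable def fM (p : ℝ) (w : ℝ → ℝ → V) (s : ℝ) : ℝ :=
  II p (fun y => (1 - y ^ 2) * ‖w y s‖ ^ 2)
noncomputable def fZ (p : ℝ) (z : ℝ → ℝ → V) (s : ℝ) : ℝ :=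
  II p (fun y => (1 - y ^ 2) ^ 2 * ‖z y s‖ ^ 2)
noncomputable def fH (p : ℝ) (w : ℝ → ℝ → V) (s : ℝ) : ℝ :=
  II p (fun y => y ^ 2 * ‖w y s‖ ^ 2)
noncomputable def fD (p : ℝ) (v : ℝ → ℝ → V) (s : ℝ) : ℝ :=
  II p (fun y => ‖v y s‖ ^ 2)

variable {p : ℝ} {J : Set ℝ} {w v z vy zy : ℝ → ℝ → V}

theorem WSys.slice {g : ℝ → ℝ → V}
    (hg : ContinuousOn (fun q : ℝ × ℝ => g q.1 q.2) (Icc (-1) 1 ×ˢ J)) {s : ℝ} (hs : s ∈ J) :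
    ContinuousOn (fun y => g y s) (Icc (-1) 1) :=
  hg.comp (f := fun y => (y, s)) (by fun_prop) (fun y hy => ⟨hy, hs⟩)

theorem cont_pow (hp : 1 < p) {X : Type*} [TopologicalSpace X] {S : Set X} {g : X → V}
    (hg : ContinuousOn g S) : ContinuousOn (fun q => ‖g q‖ ^ (p + 1)) S :=
  hg.norm.rpow_const (fun _ _ => Or.inr (by linarith))

theorem fE_deriv (hp : 1 < p) (hJ : IsOpen J) (h : WSys p (Icc (-1) 1 ×ˢ J) w v z vy zy)
    {s : ℝ} (hs : s ∈ J) : HasDerivAt (fE p w v z) (-2 * al p * fD p v s) s := by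
  have cw := h.cw
  have cv := h.cv
  have cz := h.cz
  have cvy := h.cvy
  have czy := h.czy
  have cwp := cont_pow hp h.cw
  have cnl : ContinuousOn (fun q : ℝ × ℝ => nl p (w q.1 q.2)) (Icc (-1) 1 ×ˢ J) :=
    (continuous_nl hp).comp_continuousOn h.cw
  set vs : ℝ → ℝ → V := fun y s =>
    ((1 - y ^ 2) • zy y s - (2 * (al p + 1) * y) • z y s - (al p * (al p + 1)) • w y s
      + nl p (w y s) - (2 * al p + 1) • v y s - (2 * y) • vy y s) with hvs
  have cvs : ContinuousOn (fun q : ℝ × ℝ => vs q.1 q.2) (Icc (-1) 1 ×ˢ J) := by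
    simp only [hvs]; fun_prop
  have key := II_deriv hp hJ (g := fun y s => (1 - y ^ 2) * (1 / 2 * ‖v y s‖ ^ 2
    + 1 / 2 * ‖z y s‖ ^ 2 * (1 - y ^ 2)
    + al p * (al p + 1) / 2 * ‖w y s‖ ^ 2 - ‖w y s‖ ^ (p + 1) / (p + 1)))
    (g' := fun y s => (1 - y ^ 2) * (inner ℝ (v y s) (vs y s) + inner ℝ (z y s) (vy y s) * (1 - y ^ 2)
      + al p * (al p + 1) * inner ℝ (w y s) (v y s) - inner ℝ (nl p (w y s)) (v y s)))
    ?_ (by fun_prop) ?_ hs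
  · refine HasDerivAt.congr_deriv key ?_
    have par := II_parts hp (h := fun y => (1 - y ^ 2) * inner ℝ (v y s) (z y s) - y * ‖v y s‖ ^ 2)
      (h' := fun y => (-(2 * y)) * inner ℝ (v y s) (z y s)
        + (1 - y ^ 2) * (inner ℝ (v y s) (zy y s) + inner ℝ (vy y s) (z y s))
        - (‖v y s‖ ^ 2 + y * (2 * inner ℝ (v y s) (vy y s)))) ?_ ?_
    · have e1 : -2 * al p * fD p v s = II p (fun y => (-2 * al p) * ‖v y s‖ ^ 2) := by
        unfold fD; rw [II_mul]
      rw [e1, ← add_zero (II p (fun y => (-2 * al p) * ‖v y s‖ ^ 2)), ← par, ← II_add hp]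
      · apply II_congr
        intro y hy
        simp only [hvs, inner_add_right, inner_sub_right, inner_smul_right,
          real_inner_self_eq_norm_sq]
        rw [real_inner_comm (v y s) (nl p (w y s)), real_inner_comm (v y s) (w y s),
          real_inner_comm (z y s) (vy y s)]
        ring
      · have := WSys.slice cv hs
        fun_prop
      · have := WSys.slice cv hs
        have := WSys.slice cz hs
        have := WSys.slice cvy hs
        have := WSys.slice czy hs
        fun_prop
    · intro y hy
      have d0 : HasDerivAt (fun y : ℝ => 1 - y ^ 2) (-(2 * y)) y := by
        simpa using ((hasDerivAt_id y).pow 2).const_sub 1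
      have d1 := (h.dvy y s ⟨hy, hs⟩).inner ℝ (h.dzy y s ⟨hy, hs⟩)
      have d2 := (h.dvy y s ⟨hy, hs⟩).norm_sq
      refine HasDerivAt.congr_deriv ((d0.mul d1).sub ((hasDerivAt_id y).mul d2)) ?_
      simp
    · have := WSys.slice cv hs
      have := WSys.slice cz hs
      have := WSys.slice cvy hs
      have := WSys.slice czy hs
      fun_prop
  · intro y hy s hs
    have d1 := (h.vs y s ⟨hy, hs⟩).norm_sq.const_mul (1 / 2)
    have d2 := ((h.zs y s ⟨hy, hs⟩).norm_sq.const_mul (1 / 2)).mul_const (1 - y ^ 2)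
    have d3 := (h.ws y s ⟨hy, hs⟩).norm_sq.const_mul (al p * (al p + 1) / 2)
    have d4 := hasDerivAt_norm_pow hp (h.ws y s ⟨hy, hs⟩)
    refine HasDerivAt.congr_deriv ((((d1.add d2).add d3).sub d4).const_mul (1 - y ^ 2)) ?_
    simp only [hvs]
    ring
  · fun_prop

theorem fF_deriv (hp : 1 < p) (hJ : IsOpen J) (h : WSys p (Icc (-1) 1 ×ˢ J) w v z vy zy)
    {s : ℝ} (hs : s ∈ J) : HasDerivAt (fF p w v)
      (II p (fun y => (1 - y ^ 2) * (‖v y s‖ ^ 2 - al p * (al p + 1) * ‖w y s‖ ^ 2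
        + ‖w y s‖ ^ (p + 1) + (1 - 2 * al p) * inner ℝ (w y s) (v y s)
        - (1 - y ^ 2) * ‖z y s‖ ^ 2 + 2 * y * inner ℝ (z y s) (v y s))
        - 4 * al p * y ^ 2 * inner ℝ (w y s) (v y s))) s := by
  have cw := h.cw
  have cv := h.cv
  have cz := h.cz
  have cvy := h.cvy
  have czy := h.czy
  have cwp := cont_pow hp h.cw
  have cnl : ContinuousOn (fun q : ℝ × ℝ => nl p (w q.1 q.2)) (Icc (-1) 1 ×ˢ J) :=
    (continuous_nl hp).comp_continuousOn h.cw
  have c1 := WSys.slice cv hs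
  have c2 := WSys.slice cz hs
  have c3 := WSys.slice cvy hs
  have c4 := WSys.slice czy hs
  have c5 := WSys.slice cw hs
  have c6 := cont_pow hp c5
  set vs : ℝ → ℝ → V := fun y s =>
    ((1 - y ^ 2) • zy y s - (2 * (al p + 1) * y) • z y s - (al p * (al p + 1)) • w y s
      + nl p (w y s) - (2 * al p + 1) • v y s - (2 * y) • vy y s) with hvs
  have cvs : ContinuousOn (fun q : ℝ × ℝ => vs q.1 q.2) (Icc (-1) 1 ×ˢ J) := by
    simp only [hvs]; fun_prop
  have key := II_deriv hp hJ (g := fun y s => (1 - y ^ 2) * inner ℝ (w y s) (v y s))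
    (g' := fun y s => (1 - y ^ 2) * (inner ℝ (w y s) (vs y s) + inner ℝ (v y s) (v y s)))
    ?_ (by fun_prop) (by fun_prop) hs
  · refine HasDerivAt.congr_deriv key ?_
    have par := II_parts hp (h := fun y => (1 - y ^ 2) * inner ℝ (w y s) (z y s)
        - 2 * (y * inner ℝ (w y s) (v y s)))
      (h' := fun y => (-(2 * y)) * inner ℝ (w y s) (z y s)
        + (1 - y ^ 2) * (inner ℝ (w y s) (zy y s) + inner ℝ (z y s) (z y s))
        - 2 * (inner ℝ (w y s) (v y s)
          + y * (inner ℝ (w y s) (vy y s) + inner ℝ (z y s) (v y s)))) ?_ (by fun_prop)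
    · conv_rhs => rw [← add_zero (II p _), ← par]
      rw [← II_add hp (by fun_prop) (by fun_prop)]
      · apply II_congr
        intro y hy
        simp only [hvs, inner_add_right, inner_sub_right, inner_smul_right,
          real_inner_self_eq_norm_sq, inner_nl hp]
        ring
    · intro y hy
      have d0 : HasDerivAt (fun y : ℝ => 1 - y ^ 2) (-(2 * y)) y := by
        simpa using ((hasDerivAt_id y).pow 2).const_sub 1
      have d1 := (h.wy y s ⟨hy, hs⟩).inner ℝ (h.dzy y s ⟨hy, hs⟩)
      have d2 := (h.wy y s ⟨hy, hs⟩).inner ℝ (h.dvy y s ⟨hy, hs⟩)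
      refine HasDerivAt.congr_deriv
        ((d0.mul d1).sub (((hasDerivAt_id y).mul d2).const_mul 2)) ?_
      simp
  · intro y hy s hs
    exact ((h.ws y s ⟨hy, hs⟩).inner ℝ (h.vs y s ⟨hy, hs⟩)).const_mul (1 - y ^ 2)

theorem fH_parts (hp : 1 < p) (h : WSys p (Icc (-1) 1 ×ˢ J) w v z vy zy)
    {s : ℝ} (hs : s ∈ J) : al p * fH p w s ≤ fM p w s + fZ p z s / al p := by
  have c2 := WSys.slice h.cz hs
  have c5 := WSys.slice h.cw hs
  have ha := al_pos hp
  have par := II_parts hp (h := fun y => y * ‖w y s‖ ^ 2)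
    (h' := fun y => ‖w y s‖ ^ 2 + y * (2 * inner ℝ (w y s) (z y s))) ?_ (by fun_prop)
  · have e : 0 ≤ II p (fun y => (1 - y ^ 2) * ‖w y s‖ ^ 2
        + (1 / al p * ((1 - y ^ 2) ^ 2 * ‖z y s‖ ^ 2) + (-al p) * (y ^ 2 * ‖w y s‖ ^ 2))) := by
      rw [← par]
      refine II_mono hp (by fun_prop) (by fun_prop) ?_
      intro y hy
      have h1 : inner ℝ (w y s) (z y s) * y * (1 - y ^ 2) ≤ |y| * ‖w y s‖ * ((1 - y ^ 2) * ‖z y s‖) := by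
        have : |inner ℝ (w y s) (z y s) * y| ≤ ‖w y s‖ * ‖z y s‖ * |y| := by
          rw [abs_mul]; exact mul_le_mul_of_nonneg_right (abs_real_inner_le_norm _ _) (abs_nonneg _)
        have h0 : 0 ≤ 1 - y ^ 2 := by nlinarith [hy.1, hy.2]
        nlinarith [le_abs_self (inner ℝ (w y s) (z y s) * y)]
      have h2 : 2 * (|y| * ‖w y s‖ * ((1 - y ^ 2) * ‖z y s‖)) ≤
          al p * (|y| * ‖w y s‖) ^ 2 + 1 / al p * ((1 - y ^ 2) * ‖z y s‖) ^ 2 := by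
        have := sq_nonneg (al p * (|y| * ‖w y s‖) - ((1 - y ^ 2) * ‖z y s‖))
        have e3 : 0 ≤ (1 / al p) * (al p * (|y| * ‖w y s‖) - ((1 - y ^ 2) * ‖z y s‖)) ^ 2 := by positivity
        have e4 : (1 / al p) * (al p * (|y| * ‖w y s‖) - ((1 - y ^ 2) * ‖z y s‖)) ^ 2 =
          al p * (|y| * ‖w y s‖) ^ 2 + 1 / al p * ((1 - y ^ 2) * ‖z y s‖) ^ 2
            - 2 * (|y| * ‖w y s‖ * ((1 - y ^ 2) * ‖z y s‖)) := by field_simp; ring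
        linarith
      rw [mul_pow, mul_pow, sq_abs] at h2
      nlinarith [mul_pow (1 - y ^ 2) ‖z y s‖ 2]
    rw [II_add hp (by fun_prop) (by fun_prop), II_add hp (by fun_prop) (by fun_prop), II_mul,
      II_mul] at e
    unfold fH fM fZ
    have : II p (fun y => (1 - y ^ 2) ^ 2 * ‖z y s‖ ^ 2) / al p =
      1 / al p * II p (fun y => (1 - y ^ 2) ^ 2 * ‖z y s‖ ^ 2) := by ring
    linarith
  · intro y hy
    refine HasDerivAt.congr_deriv ((hasDerivAt_id y).mul (h.wy y s ⟨hy, hs⟩).norm_sq) ?_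
    simp

end PartFour

section PartFive
variable {V : Type*} [NormedAddCommGroup V] [InnerProductSpace ℝ V]

theorem young_inner (c : ℝ) {ε : ℝ} (hε : 0 < ε) (a b : V) :
    c * inner ℝ a b ≤ ε * ‖a‖ ^ 2 + c ^ 2 / (4 * ε) * ‖b‖ ^ 2 := by
  have h1 : c * inner ℝ a b ≤ |c| * (‖a‖ * ‖b‖) := by
    refine (le_abs_self _).trans ?_
    rw [abs_mul]
    exact mul_le_mul_of_nonneg_left (abs_real_inner_le_norm _ _) (abs_nonneg _)
  have h2 : 0 ≤ (1 / (4 * ε)) * (2 * ε * ‖a‖ - |c| * ‖b‖) ^ 2 := by positivity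
  have h3 : (1 / (4 * ε)) * (2 * ε * ‖a‖ - |c| * ‖b‖) ^ 2 =
      ε * ‖a‖ ^ 2 + |c| ^ 2 / (4 * ε) * ‖b‖ ^ 2 - |c| * (‖a‖ * ‖b‖) := by field_simp; ring
  rw [sq_abs] at h3
  linarith

variable {p : ℝ} {J : Set ℝ} {w v z vy zy : ℝ → ℝ → V}

theorem fN_nonneg {s : ℝ} : 0 ≤ fN p w s := II_nonneg (fun y hy => by
  have h0 : 0 ≤ 1 - y ^ 2 := by nlinarith [hy.1, hy.2]
  positivity)
theorem fM_nonneg {s : ℝ} : 0 ≤ fM p w s := II_nonneg (fun y hy => by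
  have h0 : 0 ≤ 1 - y ^ 2 := by nlinarith [hy.1, hy.2]
  positivity)
theorem fZ_nonneg {s : ℝ} : 0 ≤ fZ p w s := II_nonneg (fun y hy => by positivity)
theorem fH_nonneg {s : ℝ} : 0 ≤ fH p w s := II_nonneg (fun y hy => by positivity)
theorem fD_nonneg {s : ℝ} : 0 ≤ fD p w s := II_nonneg (fun y hy => by positivity)

theorem c_q {f : ℝ → ℝ} (c : ContinuousOn f (Icc (-1) 1)) :
    ContinuousOn (fun y => (1 - y ^ 2) * f y) (Icc (-1) 1) :=
  (continuous_const.sub (continuous_pow 2)).continuousOn.mul c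
theorem c_q2 {f : ℝ → ℝ} (c : ContinuousOn f (Icc (-1) 1)) :
    ContinuousOn (fun y => (1 - y ^ 2) ^ 2 * f y) (Icc (-1) 1) :=
  ((continuous_const.sub (continuous_pow 2)).pow 2).continuousOn.mul c
theorem c_y {f : ℝ → ℝ} (c : ContinuousOn f (Icc (-1) 1)) :
    ContinuousOn (fun y => y ^ 2 * f y) (Icc (-1) 1) :=
  (continuous_pow 2).continuousOn.mul c
theorem c_n2 {g : ℝ → V} (c : ContinuousOn g (Icc (-1) 1)) :
    ContinuousOn (fun y => ‖g y‖ ^ 2) (Icc (-1) 1) := c.norm.pow 2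
theorem c_c {f : ℝ → ℝ} (a : ℝ) (c : ContinuousOn f (Icc (-1) 1)) :
    ContinuousOn (fun y => a * f y) (Icc (-1) 1) := continuousOn_const.mul c

theorem fE_split (hp : 1 < p) (h : WSys p (Icc (-1) 1 ×ˢ J) w v z vy zy)
    {s : ℝ} (hs : s ∈ J) : fE p w v z s = 1 / 2 * fM p v s + 1 / 2 * fZ p z s
      + al p * (al p + 1) / 2 * fM p w s - 1 / (p + 1) * fN p w s := by
  have c1 := WSys.slice h.cv hs
  have c2 := WSys.slice h.cz hs
  have c5 := WSys.slice h.cw hs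
  have c6 := cont_pow hp c5
  unfold fE fM fZ fN
  have k1 := c_c (1 / 2) (c_q (c_n2 c1))
  have k2 := c_c (1 / 2) (c_q2 (c_n2 c2))
  have k3 := c_c (al p * (al p + 1) / 2) (c_q (c_n2 c5))
  rw [sub_eq_add_neg, ← neg_mul, ← II_mul, ← II_mul, ← II_mul, ← II_mul, ← II_add hp k1 k2,
    ← II_add hp (k1.fun_add k2) k3, ← II_add hp ((k1.fun_add k2).fun_add k3) (c_c _ (c_q c6))]
  apply II_congr
  intro y hy
  ring

noncomputable def cK (p : ℝ) : ℝ :=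
  2 + 2 / (al p * (al p + 1)) + (2 / (al p * (al p + 1)) + 2 / al p) / al p

theorem cK_pos (hp : 1 < p) : 0 < cK p := by
  have := al_pos hp
  unfold cK; positivity

theorem mzh (hp : 1 < p) (h : WSys p (Icc (-1) 1 ×ˢ J) w v z vy zy)
    {s : ℝ} (hs : s ∈ J) :
    fM p w s + fZ p z s + fH p w s ≤ cK p * (fE p w v z s + fN p w s) := by
  have ha := al_pos hp
  have e := fE_split hp h hs
  have hH := fH_parts hp h hs
  have hN : 0 ≤ fN p w s := fN_nonneg
  have hM : 0 ≤ fM p w s := fM_nonneg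
  have hMv : 0 ≤ fM p v s := fM_nonneg
  have hZ : 0 ≤ fZ p z s := fZ_nonneg
  have hp1 : 1 / (p + 1) * fN p w s ≤ fN p w s := by
    have : 1 / (p + 1) ≤ 1 := by rw [div_le_one (by linarith)]; linarith
    nlinarith
  set X := fE p w v z s + fN p w s with hX
  have h1 : fZ p z s ≤ 2 * X := by
    have : 0 ≤ al p * (al p + 1) / 2 * fM p w s := by positivity
    linarith
  have h2 : fM p w s ≤ 2 / (al p * (al p + 1)) * X := by
    have : al p * (al p + 1) / 2 * fM p w s ≤ X := by linarith
    rw [div_mul_eq_mul_div, le_div_iff₀ (by positivity)]; linarith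
  have h3 : fH p w s ≤ (2 / (al p * (al p + 1)) + 2 / al p) / al p * X := by
    rw [div_mul_eq_mul_div, le_div_iff₀ ha]
    have : fZ p z s / al p ≤ 2 / al p * X := by
      rw [div_mul_eq_mul_div]; gcongr
    nlinarith
  unfold cK
  nlinarith

noncomputable def fF' (p : ℝ) (w v z : ℝ → ℝ → V) (s : ℝ) : ℝ :=
  (II p (fun y => (1 - y ^ 2) * (‖v y s‖ ^ 2 - al p * (al p + 1) * ‖w y s‖ ^ 2
        + ‖w y s‖ ^ (p + 1) + (1 - 2 * al p) * inner ℝ (w y s) (v y s)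
        - (1 - y ^ 2) * ‖z y s‖ ^ 2 + 2 * y * inner ℝ (z y s) (v y s))
        - 4 * al p * y ^ 2 * inner ℝ (w y s) (v y s)))

noncomputable def cD (p ε : ℝ) : ℝ := ((1 - 2 * al p) ^ 2 + 4 + 16 * al p ^ 2) / (4 * ε)

theorem fF'_ge (hp : 1 < p) (h : WSys p (Icc (-1) 1 ×ˢ J) w v z vy zy)
    {s : ℝ} (hs : s ∈ J) {ε : ℝ} (hε : 0 < ε) :
    (p - 1) / (p + 1) * fN p w s - 2 * fE p w v z s - ε * (fM p w s + fZ p z s + fH p w s)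
      - cD p ε * fD p v s ≤ fF' p w v z s := by
  have ha := al_pos hp
  have c1 := WSys.slice h.cv hs
  have c2 := WSys.slice h.cz hs
  have c5 := WSys.slice h.cw hs
  have c6 := cont_pow hp c5
  have e := fE_split hp h hs
  have hMv : 0 ≤ fM p v s := fM_nonneg
  have key : -(al p * (al p + 1)) * fM p w s + (1 * fN p w s + ((-1) * fZ p z s + ((-ε) * fM p w s
      + ((-ε) * fZ p z s + ((-ε) * fH p w s + (- cD p ε) * fD p v s))))) ≤ fF' p w v z s := by
    unfold fM fZ fN fH fD fF'
    simp only [← II_mul]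
    have n1 := c_n2 c1
    have n2 := c_n2 c2
    have n5 := c_n2 c5
    have k6 := (c_c (-ε) (c_y n5)).fun_add (c_c (-cD p ε) n1)
    have k5 := (c_c (-ε) (c_q2 n2)).fun_add k6
    have k4 := (c_c (-ε) (c_q n5)).fun_add k5
    have k3 := (c_c (-1) (c_q2 n2)).fun_add k4
    have k2 := (c_c 1 (c_q c6)).fun_add k3
    have k1 := (c_c (-(al p * (al p + 1))) (c_q n5)).fun_add k2
    rw [← II_add hp (c_c _ (c_y n5)) (c_c _ n1), ← II_add hp (c_c _ (c_q2 n2)) k6,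
      ← II_add hp (c_c _ (c_q n5)) k5, ← II_add hp (c_c _ (c_q2 n2)) k4,
      ← II_add hp (c_c _ (c_q c6)) k3, ← II_add hp (c_c _ (c_q n5)) k2]
    have r1 : ContinuousOn (fun y => ‖v y s‖ ^ 2 - al p * (al p + 1) * ‖w y s‖ ^ 2
        + ‖w y s‖ ^ (p + 1) + (1 - 2 * al p) * inner ℝ (w y s) (v y s)
        - (1 - y ^ 2) * ‖z y s‖ ^ 2 + 2 * y * inner ℝ (z y s) (v y s)) (Icc (-1) 1) :=
      (((((n1.fun_sub (c_c _ n5)).fun_add c6).fun_add (c_c _ (c5.inner (𝕜 := ℝ) c1))).fun_sub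
        (c_q n2)).fun_add ((continuous_const.mul continuous_id).continuousOn.fun_mul
          (c2.inner (𝕜 := ℝ) c1)))
    refine II_mono hp k1 ((c_q r1).fun_sub ((continuous_const.mul
      (continuous_pow 2)).continuousOn.fun_mul (c5.inner (𝕜 := ℝ) c1))) ?_
    intro y hy
    have h0 : 0 ≤ 1 - y ^ 2 := by nlinarith [hy.1, hy.2]
    have h1 : 1 - y ^ 2 ≤ 1 := by nlinarith [sq_nonneg y]
    have hy1 : y ^ 2 ≤ 1 := by linarith
    have i1 := young_inner (-(1 - 2 * al p)) hε (w y s) (v y s)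
    have i2 := young_inner (-(2 * y)) hε ((1 - y ^ 2) • z y s) (v y s)
    have i3 := young_inner (4 * al p) hε (w y s) (v y s)
    rw [norm_smul, Real.norm_of_nonneg h0, real_inner_smul_left, mul_pow] at i2
    have j1 := mul_le_mul_of_nonneg_left i1 h0
    have j3 := mul_le_mul_of_nonneg_left i3 (sq_nonneg y)
    have k1 : (1 - y ^ 2) * ((-(1 - 2 * al p)) ^ 2 / (4 * ε) * ‖v y s‖ ^ 2) ≤
      (1 - 2 * al p) ^ 2 / (4 * ε) * ‖v y s‖ ^ 2 := by
      rw [neg_sq]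
      exact mul_le_of_le_one_left (by positivity) h1
    have k2 : (-(2 * y)) ^ 2 / (4 * ε) * ‖v y s‖ ^ 2 ≤ 4 / (4 * ε) * ‖v y s‖ ^ 2 := by
      gcongr; nlinarith
    have k3 : y ^ 2 * ((4 * al p) ^ 2 / (4 * ε) * ‖v y s‖ ^ 2) ≤
      (16 * al p ^ 2) / (4 * ε) * ‖v y s‖ ^ 2 := by
      refine (mul_le_of_le_one_left (by positivity) hy1).trans (le_of_eq ?_); ring
    have k4 : cD p ε * ‖v y s‖ ^ 2 = (1 - 2 * al p) ^ 2 / (4 * ε) * ‖v y s‖ ^ 2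
      + 4 / (4 * ε) * ‖v y s‖ ^ 2 + (16 * al p ^ 2) / (4 * ε) * ‖v y s‖ ^ 2 := by
      unfold cD; ring
    have k5 : 0 ≤ (1 - y ^ 2) * ‖v y s‖ ^ 2 := by positivity
    linarith
  have e2 : (p - 1) / (p + 1) = 1 - 2 * (1 / (p + 1)) := by
    have : p + 1 ≠ 0 := by linarith
    field_simp; ring
  rw [e2]
  linarith

noncomputable def cc (p : ℝ) : ℝ := (p - 1) / (p + 1) / 2
noncomputable def cL (p : ℝ) : ℝ := 2 + cc p + cD p (cc p / cK p)

theorem cc_pos (hp : 1 < p) : 0 < cc p := by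
  have h1 : 0 < p - 1 := by linarith
  have h2 : 0 < p + 1 := by linarith
  unfold cc; positivity

theorem cL_pos (hp : 1 < p) : 0 < cL p := by
  have h1 := cc_pos hp
  have h2 := cK_pos hp
  unfold cL cD; positivity

theorem N_le (hp : 1 < p) (h : WSys p (Icc (-1) 1 ×ˢ J) w v z vy zy)
    {s : ℝ} (hs : s ∈ J) (hE : 0 ≤ fE p w v z s) :
    cc p * fN p w s ≤ fF' p w v z s + cL p * (fE p w v z s + fD p v s) := by
  have h1 := cc_pos hp
  have h2 := cK_pos hp
  have h3 := fF'_ge hp h hs (div_pos h1 h2)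
  have h4 := mul_le_mul_of_nonneg_left (mzh hp h hs) (div_pos h1 h2).le
  have e : cc p / cK p * (cK p * (fE p w v z s + fN p w s)) = cc p * (fE p w v z s + fN p w s) := by
    field_simp
  rw [e] at h4
  have e5 : (p - 1) / (p + 1) = 2 * cc p := by unfold cc; ring
  rw [e5] at h3
  have hD : 0 ≤ fD p v s := fD_nonneg
  have h6 : 0 ≤ cD p (cc p / cK p) := by unfold cD; positivity
  unfold cL
  nlinarith [mul_nonneg h6 hE, mul_nonneg h1.le hD]

theorem qF_ge (hp : 1 < p) (h : WSys p (Icc (-1) 1 ×ˢ J) w v z vy zy)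
    {s : ℝ} (hs : s ∈ J) (q r : ℝ) (hr : |r| ≤ 4) {ε : ℝ} (hε : 0 < ε) :
    - (ε * q ^ 2) * fM p w s + (-(16 / ε)) * fD p v s ≤ 2 * q * r * fF p w v s := by
  have c1 := WSys.slice h.cv hs
  have c5 := WSys.slice h.cw hs
  unfold fM fD fF
  simp only [← II_mul]
  have k := (c_c (-(ε * q ^ 2)) (c_q (c_n2 c5))).fun_add (c_c (-(16 / ε)) (c_n2 c1))
  rw [← II_add hp (c_c _ (c_q (c_n2 c5))) (c_c _ (c_n2 c1))]
  refine II_mono hp k (c_c _ (c_q (c5.inner (𝕜 := ℝ) c1))) ?_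
  intro y hy
  have h0 : 0 ≤ 1 - y ^ 2 := by nlinarith [hy.1, hy.2]
  have h1 : 1 - y ^ 2 ≤ 1 := by nlinarith [sq_nonneg y]
  have i1 := young_inner (-(2 * r)) hε (q • w y s) (v y s)
  rw [norm_smul, real_inner_smul_left, mul_pow, Real.norm_eq_abs, sq_abs] at i1
  have j1 := mul_le_mul_of_nonneg_left i1 h0
  have k1 : (1 - y ^ 2) * ((-(2 * r)) ^ 2 / (4 * ε) * ‖v y s‖ ^ 2) ≤ 16 / ε * ‖v y s‖ ^ 2 := by
    refine (mul_le_of_le_one_left (by positivity) h1).trans ?_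
    refine mul_le_mul_of_nonneg_right ?_ (by positivity)
    rw [div_le_div_iff₀ (by positivity) hε]
    have : r ^ 2 ≤ 16 := by
      have := sq_le_sq' (by linarith [abs_nonneg r]) hr
      rw [sq_abs] at this; linarith
    nlinarith
  linarith

theorem fD_cont (hp : 1 < p) (hJ : IsOpen J) (h : WSys p (Icc (-1) 1 ×ˢ J) w v z vy zy) :
    ContinuousOn (fD p v) J := by
  have := h.cv
  exact II_cont hp hJ (g := fun y s => ‖v y s‖ ^ 2) (by fun_prop)
theorem fN_cont (hp : 1 < p) (hJ : IsOpen J) (h : WSys p (Icc (-1) 1 ×ˢ J) w v z vy zy) :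
    ContinuousOn (fN p w) J := by
  have := cont_pow hp h.cw
  exact II_cont hp hJ (g := fun y s => (1 - y ^ 2) * ‖w y s‖ ^ (p + 1)) (by fun_prop)
theorem fF'_cont (hp : 1 < p) (hJ : IsOpen J) (h : WSys p (Icc (-1) 1 ×ˢ J) w v z vy zy) :
    ContinuousOn (fF' p w v z) J := by
  have := cont_pow hp h.cw
  have := h.cw
  have := h.cv
  have := h.cz
  refine II_cont hp hJ (g := fun y s => (1 - y ^ 2) * (‖v y s‖ ^ 2 - al p * (al p + 1) * ‖w y s‖ ^ 2
        + ‖w y s‖ ^ (p + 1) + (1 - 2 * al p) * inner ℝ (w y s) (v y s)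
        - (1 - y ^ 2) * ‖z y s‖ ^ 2 + 2 * y * inner ℝ (z y s) (v y s))
        - 4 * al p * y ^ 2 * inner ℝ (w y s) (v y s)) (by fun_prop)

theorem fE_anti (hp : 1 < p) (hJ : IsOpen J) (h : WSys p (Icc (-1) 1 ×ˢ J) w v z vy zy)
    {a b : ℝ} (hab : Icc a b ⊆ J) : AntitoneOn (fE p w v z) (Icc a b) := by
  have ha := al_pos hp
  refine antitoneOn_of_deriv_nonpos (convex_Icc a b)
    (fun s hs => (fE_deriv hp hJ h (hab hs)).continuousAt.continuousWithinAt)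
    (fun s hs => (fE_deriv hp hJ h (hab (interior_subset hs))).differentiableAt.differentiableWithinAt)
    (fun s hs => ?_)
  rw [(fE_deriv hp hJ h (hab (interior_subset hs))).deriv]
  nlinarith [fD_nonneg (p := p) (w := v) (s := s), mul_nonneg ha.le (fD_nonneg (p := p) (w := v) (s := s))]

theorem fE_drop (hp : 1 < p) (hJ : IsOpen J) (h : WSys p (Icc (-1) 1 ×ˢ J) w v z vy zy)
    {a b : ℝ} (hl : a ≤ b) (hab : Icc a b ⊆ J) :
    ∫ s in a..b, fD p v s = (fE p w v z a - fE p w v z b) / (2 * al p) := by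
  have ha := al_pos hp
  have hi : IntervalIntegrable (fun s => -2 * al p * fD p v s) volume a b := by
    apply ContinuousOn.intervalIntegrable
    rw [uIcc_of_le hl]
    exact continuousOn_const.mul ((fD_cont hp hJ h).mono hab)
  have := intervalIntegral.integral_eq_sub_of_hasDerivAt
    (f := fE p w v z) (f' := fun s => -2 * al p * fD p v s) (a := a) (b := b)
    (fun s hs => fE_deriv hp hJ h (hab (by rwa [uIcc_of_le hl] at hs))) hi
  rw [intervalIntegral.integral_const_mul] at this
  rw [eq_div_iff (by positivity)]
  linarith

theorem unit_bound (hp : 1 < p) (E0 : ℝ) : ∃ K : ℝ, 0 < K ∧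
    ∀ (J : Set ℝ) (w v z vy zy : ℝ → ℝ → V), IsOpen J → Icc (-3) 1 ⊆ J →
      WSys p (Icc (-1) 1 ×ˢ J) w v z vy zy → (∀ s ∈ Icc (-3 : ℝ) 1, 0 ≤ fE p w v z s) →
      fE p w v z (-3) ≤ E0 →
      (∫ s in (-2 : ℝ)..0, fN p w s) ≤ K ∧ (∫ s in (-2 : ℝ)..0, fD p v s) ≤ K ∧
      (∀ s ∈ Icc (-2 : ℝ) 0, fM p w s + fZ p z s ≤ K * (1 + fN p w s)) := by
  have ha := al_pos hp
  have h1 := cc_pos hp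
  have h2 := cK_pos hp
  have h3 := cL_pos hp
  set ε := cc p / 2 / cK p with hεd
  have hε : 0 < ε := by positivity
  set X := |E0| with hX
  have hX0 : 0 ≤ X := abs_nonneg _
  set K1 := (2 / cc p) * (4 * (16 * (cL p + cc p) * X) + (16 * cL p + 16 / ε) * (X / (2 * al p)))
  have hK1 : 0 ≤ K1 := by positivity
  refine ⟨1 + K1 + X / (2 * al p) + cK p * (X + 1), by positivity, ?_⟩
  intro J w v z vy zy hJ hsub h hE hE0
  have hEX : ∀ s ∈ Icc (-3 : ℝ) 1, fE p w v z s ≤ X := by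
    intro s hs
    exact ((fE_anti hp hJ h hsub) (left_mem_Icc.2 (by norm_num)) hs hs.1).trans
      (hE0.trans (le_abs_self _))
  have hsub2 : Icc (-2 : ℝ) 0 ⊆ Icc (-3) 1 := Icc_subset_Icc (by norm_num) (by norm_num)
  have iD : IntervalIntegrable (fD p v) volume (-3) 1 := by
    apply ContinuousOn.intervalIntegrable
    rw [uIcc_of_le (by norm_num)]
    exact (fD_cont hp hJ h).mono hsub
  have cN := (fN_cont hp hJ h).mono hsub
  have D1 : ∫ s in (-3 : ℝ)..1, fD p v s ≤ X / (2 * al p) := by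
    rw [fE_drop hp hJ h (by norm_num) hsub]
    gcongr
    linarith [hEX (-3) (by norm_num), hE 1 (by norm_num)]
  refine ⟨?_, ?_, ?_⟩
  · set Φ : ℝ → ℝ := fun s => ((s + 3) * (1 - s)) ^ 2 * fF p w v s with hΦ
    set Φ' : ℝ → ℝ := fun s => 2 * ((s + 3) * (1 - s)) * (-2 - 2 * s) * fF p w v s
      + ((s + 3) * (1 - s)) ^ 2 * fF' p w v z s with hΦ'
    have dΦ : ∀ s ∈ Icc (-3 : ℝ) 1, HasDerivAt Φ (Φ' s) s := by
      intro s hs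
      have d0 : HasDerivAt (fun s : ℝ => (s + 3) * (1 - s)) (-2 - 2 * s) s := by
        refine HasDerivAt.congr_deriv
          (((hasDerivAt_id s).add_const 3).mul ((hasDerivAt_id s).const_sub 1)) ?_
        simp; ring
      refine HasDerivAt.congr_deriv ((d0.pow 2).mul (fF_deriv hp hJ h (hsub hs))) ?_
      simp only [hΦ']
      unfold fF'
      simp
    have cF : ContinuousOn (fF p w v) (Icc (-3) 1) := fun s hs =>
      (fF_deriv hp hJ h (hsub hs)).continuousAt.continuousWithinAt
    have cF' := (fF'_cont hp hJ h).mono hsub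
    have iΦ : IntervalIntegrable Φ' volume (-3) 1 := by
      apply ContinuousOn.intervalIntegrable
      rw [uIcc_of_le (by norm_num)]
      simp only [hΦ']; fun_prop
    have z0 : ∫ s in (-3 : ℝ)..1, Φ' s = 0 := by
      rw [intervalIntegral.integral_eq_sub_of_hasDerivAt
        (fun s hs => dΦ s (by rwa [uIcc_of_le (by norm_num)] at hs)) iΦ]
      simp [hΦ]
    have pt : ∀ s ∈ Icc (-3 : ℝ) 1, cc p / 2 * (((s + 3) * (1 - s)) ^ 2 * fN p w s) ≤
        Φ' s + (16 * (cL p + cc p) * X + (16 * cL p + 16 / ε) * fD p v s) := by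
      intro s hs
      have q0 : 0 ≤ (s + 3) * (1 - s) := mul_nonneg (by linarith [hs.1]) (by linarith [hs.2])
      have q4 : (s + 3) * (1 - s) ≤ 4 := by nlinarith [sq_nonneg (s + 1)]
      set q := (s + 3) * (1 - s) with hq
      have q16 : q ^ 2 ≤ 16 := by nlinarith
      have r4 : |-2 - 2 * s| ≤ 4 := by rw [abs_le]; constructor <;> linarith [hs.1, hs.2]
      have a1 := qF_ge hp h (hsub hs) q (-2 - 2 * s) r4 hε
      have a2 := mul_le_mul_of_nonneg_left (N_le hp h (hsub hs) (hE s hs)) (sq_nonneg q)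
      have a3 := mzh hp h (hsub hs)
      have hZ : 0 ≤ fZ p z s := fZ_nonneg
      have hH : 0 ≤ fH p w s := fH_nonneg
      have hD : 0 ≤ fD p v s := fD_nonneg
      have hN : 0 ≤ fN p w s := fN_nonneg
      have a4 : ε * q ^ 2 * fM p w s ≤ ε * q ^ 2 * (cK p * (fE p w v z s + fN p w s)) := by
        apply mul_le_mul_of_nonneg_left (by linarith) (by positivity)
      have e1 : ε * q ^ 2 * (cK p * (fE p w v z s + fN p w s)) =
          cc p / 2 * q ^ 2 * (fE p w v z s + fN p w s) := by
        rw [hεd]; field_simp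
      rw [e1] at a4
      have hEs := hE s hs
      have hEXs := hEX s hs
      have b1 : q ^ 2 * fE p w v z s ≤ 16 * X := mul_le_mul q16 hEXs hEs (by norm_num)
      have b2 : q ^ 2 * fD p v s ≤ 16 * fD p v s := mul_le_mul_of_nonneg_right q16 hD
      have b3 := mul_le_mul_of_nonneg_left b1 h3.le
      have b4 := mul_le_mul_of_nonneg_left b2 h3.le
      have b5 := mul_le_mul_of_nonneg_left b1 h1.le
      have b6 : 0 ≤ cc p * X := by positivity
      have b7 : 0 ≤ cc p * (q ^ 2 * fE p w v z s) := by positivity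
      simp only [hΦ', ← hq]
      linarith
    have hq1 : ∀ s ∈ Icc (-2 : ℝ) 0, 1 ≤ ((s + 3) * (1 - s)) ^ 2 := by
      intro s hs
      have : 1 ≤ (s + 3) * (1 - s) := by nlinarith [hs.1, hs.2]
      nlinarith
    have iqN : ContinuousOn (fun s => ((s + 3) * (1 - s)) ^ 2 * fN p w s) (Icc (-3) 1) := by fun_prop
    have m1 : ∫ s in (-2 : ℝ)..0, fN p w s ≤
        ∫ s in (-2 : ℝ)..0, ((s + 3) * (1 - s)) ^ 2 * fN p w s := by
      apply intervalIntegral.integral_mono_on (by norm_num)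
      · apply ContinuousOn.intervalIntegrable
        rw [uIcc_of_le (by norm_num)]; exact cN.mono hsub2
      · apply ContinuousOn.intervalIntegrable
        rw [uIcc_of_le (by norm_num)]; exact iqN.mono hsub2
      · intro s hs
        exact le_mul_of_one_le_left fN_nonneg (hq1 s hs)
    have m2 : ∫ s in (-2 : ℝ)..0, ((s + 3) * (1 - s)) ^ 2 * fN p w s ≤
        ∫ s in (-3 : ℝ)..1, ((s + 3) * (1 - s)) ^ 2 * fN p w s := by
      apply intervalIntegral.integral_mono_interval (by norm_num) (by norm_num) (by norm_num)
      · exact Eventually.of_forall fun s => mul_nonneg (sq_nonneg _) fN_nonneg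
      · apply ContinuousOn.intervalIntegrable
        rwa [uIcc_of_le (by norm_num)]
    have m3 : cc p / 2 * ∫ s in (-3 : ℝ)..1, ((s + 3) * (1 - s)) ^ 2 * fN p w s ≤
        0 + (4 * (16 * (cL p + cc p) * X) + (16 * cL p + 16 / ε) * ∫ s in (-3 : ℝ)..1, fD p v s) := by
      rw [← intervalIntegral.integral_const_mul, ← z0, ← intervalIntegral.integral_const_mul]
      have e4 : 4 * (16 * (cL p + cc p) * X) = ∫ s in (-3 : ℝ)..1, 16 * (cL p + cc p) * X := by
        rw [intervalIntegral.integral_const]; norm_num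
      rw [e4, ← intervalIntegral.integral_add (by simp) (iD.const_mul _),
        ← intervalIntegral.integral_add iΦ (IntervalIntegrable.add (by simp) (iD.const_mul _))]
      apply intervalIntegral.integral_mono_on (by norm_num)
      · apply ContinuousOn.intervalIntegrable
        rw [uIcc_of_le (by norm_num)]; fun_prop
      · exact iΦ.add (IntervalIntegrable.add (by simp) (iD.const_mul _))
      · exact pt
    have m4 : (16 * cL p + 16 / ε) * ∫ s in (-3 : ℝ)..1, fD p v s ≤
        (16 * cL p + 16 / ε) * (X / (2 * al p)) := mul_le_mul_of_nonneg_left D1 (by positivity)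
    have m5 : ∫ s in (-3 : ℝ)..1, ((s + 3) * (1 - s)) ^ 2 * fN p w s ≤ K1 := by
      have : (2 / cc p) * (cc p / 2 * ∫ s in (-3 : ℝ)..1, ((s + 3) * (1 - s)) ^ 2 * fN p w s) ≤ K1 :=
        mul_le_mul_of_nonneg_left (by linarith) (by positivity)
      rwa [← mul_assoc, show 2 / cc p * (cc p / 2) = 1 by field_simp, one_mul] at this
    have : 0 ≤ X / (2 * al p) + cK p * (X + 1) := by positivity
    linarith
  · have : ∫ s in (-2 : ℝ)..0, fD p v s ≤ ∫ s in (-3 : ℝ)..1, fD p v s := by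
      apply intervalIntegral.integral_mono_interval (by norm_num) (by norm_num) (by norm_num)
      · exact Eventually.of_forall fun s => fD_nonneg
      · exact iD
    have : 0 ≤ cK p * (X + 1) := by positivity
    linarith
  · intro s hs
    have a3 := mzh hp h (hsub (hsub2 hs))
    have hH : 0 ≤ fH p w s := fH_nonneg
    have hN : 0 ≤ fN p w s := fN_nonneg
    have hEXs := hEX s (hsub2 hs)
    have g1 : cK p * (fE p w v z s + fN p w s) ≤ cK p * (X + 1) * (1 + fN p w s) := by
      rw [mul_assoc]
      refine mul_le_mul_of_nonneg_left ?_ h2.le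
      nlinarith
    have : 0 ≤ (1 + K1 + X / (2 * al p)) * (1 + fN p w s) := by positivity
    nlinarith

end PartFive

section PartSix
variable {V : Type*} [NormedAddCommGroup V] [InnerProductSpace ℝ V]
variable {p : ℝ}

/-- weight comparison -/
theorem weight_le (hp : 1 < p) {f : ℝ → ℝ} (cf : ContinuousOn f (Icc (-1) 1))
    (f0 : ∀ y ∈ Icc (-1 : ℝ) 1, 0 ≤ f y) {s : ℝ} (hs : s ∈ Icc (-2 : ℝ) 0) :
    ∫ y in (-(1 - exp s))..(1 - exp s), f y ≤
      exp (2 * (al p + 1)) * II p (fun y => (1 - y ^ 2) ^ 2 * f y) := by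
  have ha := al_pos hp
  set b := 1 - exp s with hb
  have e1 : exp s ≤ 1 := by rw [← Real.exp_zero]; exact Real.exp_le_exp.2 hs.2
  have e0 := Real.exp_pos s
  have b0 : 0 ≤ b := by linarith
  have b1 : b ≤ 1 := by linarith
  have hsub : Icc (-b) b ⊆ Icc (-1) 1 := Icc_subset_Icc (by linarith) b1
  rw [← II_mul]
  unfold II
  have hc : ContinuousOn (fun y => exp (2 * (al p + 1)) * ((1 - y ^ 2) ^ 2 * f y)) (Icc (-1) 1) := by
    fun_prop
  have i1 := II_int hp hc
  have i2 : IntervalIntegrable (fun y => sig p y * (exp (2 * (al p + 1)) * ((1 - y ^ 2) ^ 2 * f y)))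
      volume (-b) b := i1.mono_set (by
        rw [uIcc_of_le (by linarith), uIcc_of_le (by norm_num)]; exact hsub)
  refine le_trans (intervalIntegral.integral_mono_on (by linarith) ?_ i2 ?_)
    (intervalIntegral.integral_mono_interval (by linarith) (by linarith) b1 ?_ i1)
  · apply ContinuousOn.intervalIntegrable
    rw [uIcc_of_le (by linarith)]
    exact cf.mono hsub
  · intro y hy
    have hfy := f0 y (hsub hy)
    have k1 : exp s ≤ 1 - y ^ 2 := by nlinarith [hy.1, hy.2]
    have k2 : exp (-2) ≤ 1 - y ^ 2 := (Real.exp_le_exp.2 hs.1).trans k1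
    have kpos : 0 < 1 - y ^ 2 := (Real.exp_pos _).trans_le k2
    have k3 : exp (-2 * (al p + 1)) ≤ sig p y * (1 - y ^ 2) ^ 2 := by
      unfold sig
      rw [← Real.rpow_natCast (1 - y ^ 2) 2, ← Real.rpow_add kpos, Real.exp_mul]
      have : al p - 1 + ((2 : ℕ) : ℝ) = al p + 1 := by push_cast; ring
      rw [this]
      exact Real.rpow_le_rpow (Real.exp_pos _).le k2 (by linarith)
    have k4 : 1 ≤ exp (2 * (al p + 1)) * (sig p y * (1 - y ^ 2) ^ 2) := by
      calc (1 : ℝ) = exp (2 * (al p + 1)) * exp (-2 * (al p + 1)) := by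
            rw [← Real.exp_add]; ring_nf; simp
        _ ≤ _ := mul_le_mul_of_nonneg_left k3 (Real.exp_pos _).le
    calc f y = 1 * f y := (one_mul _).symm
      _ ≤ exp (2 * (al p + 1)) * (sig p y * (1 - y ^ 2) ^ 2) * f y :=
        mul_le_mul_of_nonneg_right k4 hfy
      _ = _ := by ring
  · refine (ae_restrict_iff' measurableSet_Ioc).2 (Eventually.of_forall fun y hy => ?_)
    have hy' := Ioc_subset_Icc_self hy
    have := f0 y hy'
    have := sig_nonneg (p := p) hy'
    simp only [Pi.zero_apply]
    positivity

variable {O : Set (ℝ × ℝ)} {u A B C G : ℝ → ℝ → V}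

theorem cone_mem (hO : ∀ x t, |x| ≤ -t → -exp 4 ≤ t → t ≤ 0 → (x, t) ∈ O)
    {y s : ℝ} (h : (y, s) ∈ Icc (-1 : ℝ) 1 ×ˢ Ioi (-4 : ℝ)) :
    (0 + y * exp (-s), 0 - exp (-s)) ∈ O := by
  have hs : -4 < s := h.2
  have hy : y ∈ Icc (-1 : ℝ) 1 := h.1
  have := Real.exp_pos (-s)
  apply hO
  · rw [zero_add, abs_mul, abs_of_pos this, zero_sub, neg_neg]
    exact mul_le_of_le_one_left this.le (abs_le.2 hy)
  · have : exp (-s) ≤ exp 4 := Real.exp_le_exp.2 (by linarith)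
    linarith
  · linarith

/-- energy at a regular apex is nonnegative -/
theorem fE_nonneg (hp : 1 < p) (h : Sol p O u A B C G)
    (hO : ∀ x t, |x| ≤ -t → -exp 4 ≤ t → t ≤ 0 → (x, t) ∈ O) {v z vy zy : ℝ → ℝ → V}
    (hw : WSys p (Icc (-1) 1 ×ˢ Ioi (-4)) (ss (al p) 0 0 u) v z vy zy)
    {s : ℝ} (hs : -4 < s) : 0 ≤ fE p (ss (al p) 0 0 u) v z s := by
  have ha := al_pos hp
  have hcpt : IsCompact {q : ℝ × ℝ | |q.1| ≤ -q.2 ∧ -exp 4 ≤ q.2 ∧ q.2 ≤ 0} := by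
    refine IsCompact.of_isClosed_subset (isCompact_Icc (a := ((-exp 4, -exp 4) : ℝ × ℝ))
      (b := ((exp 4, 0) : ℝ × ℝ))) ?_ ?_
    · have k1 : IsClosed {q : ℝ × ℝ | |q.1| ≤ -q.2} := isClosed_le (by fun_prop) (by fun_prop)
      have k2 : IsClosed {q : ℝ × ℝ | -exp 4 ≤ q.2} := isClosed_le (by fun_prop) (by fun_prop)
      have k3 : IsClosed {q : ℝ × ℝ | q.2 ≤ 0} := isClosed_le (by fun_prop) (by fun_prop)
      exact k1.inter (k2.inter k3)
    · rintro ⟨x, t⟩ ⟨h1, h2, h3⟩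
      simp only at h1 h2 h3
      have := abs_le.1 h1
      exact ⟨⟨by linarith, h2⟩, ⟨by linarith, h3⟩⟩
  obtain ⟨M, hM⟩ := hcpt.exists_bound_of_continuousOn (f := fun q : ℝ × ℝ => u q.1 q.2)
    (h.cu.mono (fun q hq => hO q.1 q.2 hq.1 hq.2.1 hq.2.2))
  have hM0 : 0 ≤ M := (norm_nonneg _).trans (hM (0, 0) ⟨by simp, by simp [(exp_pos 4).le], le_rfl⟩)
  have bound : ∀ r, s ≤ r → -((exp (-al p * r) * M) ^ (p + 1) * II p (fun _ => 1)) ≤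
      fE p (ss (al p) 0 0 u) v z s := by
    intro r hr
    have hr4 : r ∈ Ioi (-4 : ℝ) := lt_of_lt_of_le hs hr
    have anti := fE_anti hp isOpen_Ioi hw (a := s) (b := r)
      (fun x hx => lt_of_lt_of_le hs hx.1) (left_mem_Icc.2 hr) (right_mem_Icc.2 hr) hr
    have sp := fE_split hp hw hr4
    have n1 : fN p (ss (al p) 0 0 u) r ≤ (exp (-al p * r) * M) ^ (p + 1) * II p (fun _ => 1) := by
      rw [← II_mul]
      have := cont_pow hp (WSys.slice hw.cw hr4)
      refine II_mono hp (by fun_prop) (by fun_prop) ?_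
      intro y hy
      have h0 : 0 ≤ 1 - y ^ 2 := by nlinarith [hy.1, hy.2]
      have h1 : 1 - y ^ 2 ≤ 1 := by nlinarith [sq_nonneg y]
      rw [mul_one]
      refine (mul_le_of_le_one_left (by positivity) h1).trans ?_
      refine Real.rpow_le_rpow (norm_nonneg _) ?_ (by linarith)
      unfold ss
      rw [norm_smul, Real.norm_of_nonneg (exp_pos _).le]
      refine mul_le_mul_of_nonneg_left ?_ (exp_pos _).le
      have e3 := exp_pos (-r)
      have e4 : exp (-r) ≤ exp 4 := Real.exp_le_exp.2 (by linarith [show -4 < r from hr4])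
      apply hM (0 + y * exp (-r), 0 - exp (-r))
      refine ⟨?_, ?_, ?_⟩
      · simp only
        rw [zero_add, abs_mul, abs_of_pos e3, zero_sub, neg_neg]
        exact mul_le_of_le_one_left e3.le (abs_le.2 hy)
      · simp only; linarith
      · simp only; linarith
    have h1 : 0 ≤ fM p v r := fM_nonneg
    have h2 : 0 ≤ fZ p z r := fZ_nonneg
    have h3 : 0 ≤ fM p (ss (al p) 0 0 u) r := fM_nonneg
    have h4 : 0 ≤ fN p (ss (al p) 0 0 u) r := fN_nonneg
    have h5 : 1 / (p + 1) * fN p (ss (al p) 0 0 u) r ≤ fN p (ss (al p) 0 0 u) r := by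
      refine mul_le_of_le_one_left h4 ?_
      rw [div_le_one (by linarith)]; linarith
    have h6 : 0 ≤ al p * (al p + 1) / 2 * fM p (ss (al p) 0 0 u) r := by positivity
    linarith
  have lim : Tendsto (fun r => -((exp (-al p * r) * M) ^ (p + 1) * II p (fun _ => 1))) atTop
      (nhds 0) := by
    have l1 : Tendsto (fun r => exp (-al p * r)) atTop (nhds 0) := by
      refine Real.tendsto_exp_atBot.comp ?_
      exact tendsto_id.const_mul_atTop_of_neg (by linarith)
    have l2 := (((l1.mul_const M).rpow_const (p := p + 1) (Or.inr (by linarith))).mul_const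
      (II p (fun _ => 1))).neg
    simpa [Real.zero_rpow (by linarith : p + 1 ≠ 0)] using l2
  exact le_of_tendsto lim (eventually_atTop.2 ⟨s, bound⟩)

variable [CompleteSpace V]

noncomputable def dal (u A B : ℝ → ℝ → V) (ζ s : ℝ) : V :=
  u ((exp (-s) - 1) * ζ) (-exp (-s)) + (exp (-s) - 1) •
    (ζ • B ((exp (-s) - 1) * ζ) (-exp (-s)) + A ((exp (-s) - 1) * ζ) (-exp (-s)))

theorem dal_deriv (hp : 1 < p) (h : Sol p O u A B C G)
    (hO : ∀ x t, |x| ≤ -t → -exp 4 ≤ t → t ≤ 0 → (x, t) ∈ O) {s : ℝ}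
    (hs : s ∈ Ioo (-4 : ℝ) (1 / 2)) :
    HasDerivAt (fun s => ∫ ζ in (-1 : ℝ)..1, dal u A B ζ s)
      ((exp (-s) * (exp (-s) - 1)) • ∫ ζ in (-1 : ℝ)..1, nl p (u ((exp (-s) - 1) * ζ) (-exp (-s)))) s := by
  have mem : ∀ ζ ∈ Icc (-1 : ℝ) 1, ∀ s ∈ Ioo (-4 : ℝ) (1 / 2),
      ((exp (-s) - 1) * ζ, -exp (-s)) ∈ O := by
    intro ζ hζ s hs
    have e0 := exp_pos (-s)
    have e1 : 1 / 2 ≤ exp (-s) := by have := Real.add_one_le_exp (-s); linarith [hs.2]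
    have e4 : exp (-s) ≤ exp 4 := Real.exp_le_exp.2 (by linarith [hs.1])
    apply hO
    · rw [abs_mul, neg_neg]
      have : |exp (-s) - 1| ≤ exp (-s) := by rw [abs_le]; constructor <;> linarith
      calc _ ≤ exp (-s) * 1 := mul_le_mul this (abs_le.2 hζ) (abs_nonneg _) e0.le
        _ = _ := mul_one _
    · linarith
    · linarith
  have mt : MapsTo (fun q : ℝ × ℝ => ((exp (-q.2) - 1) * q.1, -exp (-q.2)))
      (Icc (-1) 1 ×ˢ Ioo (-4) (1 / 2)) O := fun q hq => mem q.1 hq.1 q.2 hq.2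
  have ct : ContinuousOn (fun q : ℝ × ℝ => ((exp (-q.2) - 1) * q.1, -exp (-q.2)))
      (Icc (-1) 1 ×ˢ Ioo (-4) (1 / 2)) := by fun_prop
  have cu := h.cu.comp ct mt
  have cA := h.cA.comp ct mt
  have cB := h.cB.comp ct mt
  have cG := h.cG.comp ct mt
  simp only [Function.comp_def] at cu cA cB cG
  have cnl := (continuous_nl hp (V := V)).comp_continuousOn cu
  simp only [Function.comp_def] at cnl
  have key := hasDerivAt_int (k := fun _ => (1 : ℝ)) (a := -1) (b := 1)
    (g := dal u A B)
    (g' := fun ζ s => (-exp (-s)) • ((2 * ζ) • B ((exp (-s) - 1) * ζ) (-exp (-s))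
      + (ζ ^ 2 - 1) • (exp (-s) - 1) • G ((exp (-s) - 1) * ζ) (-exp (-s))
      - (exp (-s) - 1) • nl p (u ((exp (-s) - 1) * ζ) (-exp (-s)))))
    (by norm_num) isOpen_Ioo (by simp) ?_ ?_ ?_ hs
  · simp only [one_smul] at key
    refine HasDerivAt.congr_deriv key ?_
    have slice : ∀ (g : ℝ → ℝ → V), ContinuousOn (fun q : ℝ × ℝ => g q.1 q.2)
        (Icc (-1) 1 ×ˢ Ioo (-4) (1 / 2)) → ContinuousOn (fun y => g y s) (Icc (-1) 1) := by
      intro g hg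
      exact hg.comp (f := fun y => (y, s)) (by fun_prop) (fun y hy => ⟨hy, hs⟩)
    have sB := slice (fun ζ s => B ((exp (-s) - 1) * ζ) (-exp (-s))) cB
    have sG := slice (fun ζ s => G ((exp (-s) - 1) * ζ) (-exp (-s))) cG
    have sn := slice (fun ζ s => nl p (u ((exp (-s) - 1) * ζ) (-exp (-s)))) cnl
    have sn' : ContinuousOn (fun ζ => (exp (-s) - 1) • nl p (u ((exp (-s) - 1) * ζ) (-exp (-s))))
      (Icc (-1) 1) := sn.const_smul _
    have sBG : ContinuousOn (fun ζ => (2 * ζ) • B ((exp (-s) - 1) * ζ) (-exp (-s))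
      + (ζ ^ 2 - 1) • (exp (-s) - 1) • G ((exp (-s) - 1) * ζ) (-exp (-s))) (Icc (-1) 1) :=
      (ContinuousOn.smul (by fun_prop) sB).add
        (ContinuousOn.smul (by fun_prop) (ContinuousOn.smul (by fun_prop) sG))
    have iv : ∀ g : ℝ → V, ContinuousOn g (Icc (-1) 1) → IntervalIntegrable g volume (-1) 1 := by
      intro g hg
      apply ContinuousOn.intervalIntegrable
      rwa [uIcc_of_le (by norm_num)]
    have z0 : ∫ ζ in (-1 : ℝ)..1, ((2 * ζ) • B ((exp (-s) - 1) * ζ) (-exp (-s))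
      + (ζ ^ 2 - 1) • (exp (-s) - 1) • G ((exp (-s) - 1) * ζ) (-exp (-s))) = 0 := by
      rw [intervalIntegral.integral_eq_sub_of_hasDerivAt
        (f := fun ζ => (ζ ^ 2 - 1) • B ((exp (-s) - 1) * ζ) (-exp (-s)))]
      · simp
      · intro ζ hζ
        rw [uIcc_of_le (by norm_num)] at hζ
        have d0 : HasDerivAt (fun y : ℝ => y ^ 2 - 1) (2 * ζ) ζ := by
          simpa using ((hasDerivAt_id ζ).pow 2).sub_const 1
        have d1 : HasDerivAt (fun y : ℝ => (exp (-s) - 1) * y) (exp (-s) - 1) ζ := by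
          simpa using (hasDerivAt_id ζ).const_mul (exp (-s) - 1)
        have d2 := lin_comp (X := fun y : ℝ => (exp (-s) - 1) * y) (S := fun _ => -exp (-s))
          (h.dB _ _ (mem ζ hζ s hs)) d1 (hasDerivAt_const _ _)
        refine HasDerivAt.congr_deriv (d0.smul d2) ?_
        module
      · exact iv _ sBG
    rw [intervalIntegral.integral_smul, intervalIntegral.integral_sub (iv _ sBG)
      (iv _ sn'), z0, intervalIntegral.integral_smul]
    module
  · intro ζ hζ s hs
    have d1 : HasDerivAt (fun s : ℝ => exp (-s)) (-exp (-s)) s := by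
      simpa using (hasDerivAt_neg s).exp
    have dX : HasDerivAt (fun s : ℝ => (exp (-s) - 1) * ζ) (-exp (-s) * ζ) s :=
      (d1.sub_const 1).mul_const ζ
    have dS : HasDerivAt (fun s : ℝ => -exp (-s)) (exp (-s)) s :=
      HasDerivAt.congr_deriv d1.neg (neg_neg _)
    have m := mem ζ hζ s hs
    have du := lin_comp (X := fun s : ℝ => (exp (-s) - 1) * ζ) (S := fun s : ℝ => -exp (-s))
      (h.du _ _ m) dX dS
    have dA := lin_comp (X := fun s : ℝ => (exp (-s) - 1) * ζ) (S := fun s : ℝ => -exp (-s))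
      (h.dA _ _ m) dX dS
    have dB := lin_comp (X := fun s : ℝ => (exp (-s) - 1) * ζ) (S := fun s : ℝ => -exp (-s))
      (h.dB _ _ m) dX dS
    refine HasDerivAt.congr_deriv (du.add ((d1.sub_const 1).smul ((dB.const_smul ζ).add dA))) ?_
    module
  · unfold dal
    exact cu.add (ContinuousOn.smul (by fun_prop) ((ContinuousOn.smul (by fun_prop) cB).add cA))
  · exact ContinuousOn.smul (by fun_prop) (((ContinuousOn.smul (by fun_prop) cB).add
      (ContinuousOn.smul (by fun_prop) (ContinuousOn.smul (by fun_prop) cG))).sub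
      (ContinuousOn.smul (by fun_prop) cnl))

end PartSix

section PartSeven
variable {V : Type*} [NormedAddCommGroup V] [InnerProductSpace ℝ V]
variable {p : ℝ}

theorem II_one_nonneg : 0 ≤ II p (fun _ => 1) := II_nonneg (fun _ _ => zero_le_one)

theorem rpow_le_one_add {p x : ℝ} (hp : 1 < p) (hx : 0 ≤ x) : x ^ p ≤ 1 + x ^ (p + 1) := by
  rcases le_total x 1 with h | h
  · have := Real.rpow_le_one hx h (by linarith : 0 ≤ p)
    have := Real.rpow_nonneg hx (p + 1)
    linarith
  · have := Real.rpow_le_rpow_of_exponent_le h (by linarith : p ≤ p + 1)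
    linarith

variable [CompleteSpace V] 

set_option maxHeartbeats 1600000 in
theorem pt_bound (hp : 1 < p) (E0 : ℝ) : ∃ K : ℝ, 0 < K ∧
    ∀ (O : Set (ℝ × ℝ)) (u A B C G : ℝ → ℝ → V), Sol p O u A B C G →
    (∀ x t, |x| ≤ -t → -exp 4 ≤ t → t ≤ 0 → (x, t) ∈ O) →
    fE p (ss (al p) 0 0 u) (fun y s => -al p • ss (al p) 0 0 u y s - y • ss (al p + 1) 0 0 B y s
        + ss (al p + 1) 0 0 A y s) (ss (al p + 1) 0 0 B) (-3) ≤ E0 →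
    ‖u 0 (-1)‖ ≤ K := by
  have ha := al_pos hp
  obtain ⟨K0, hK0, hK⟩ := unit_bound (V := V) hp E0
  set W := exp (2 * (al p + 1)) with hW
  have W0 : 0 < W := exp_pos _
  set I1 := II p (fun _ => 1) with hI1
  have I10 : 0 ≤ I1 := II_one_nonneg
  set c := 1 + 2 * exp 2 * (1 + al p) with hc
  have c0 : 0 < c := by positivity
  set K1 := 2 * (c * (W * (3 * I1 + K0))) with hK1
  set K2 := 2 * (c * (W * (K0 + 1))) with hK2
  set K3 := exp 4 * W * (2 * I1 + K0) with hK3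
  refine ⟨K1 + K2 * (2 * K0) + K3 + 1, by positivity, ?_⟩
  intro O u A B C G h hO hE0
  set w := ss (al p) 0 0 u with hw
  set z := ss (al p + 1) 0 0 B with hz
  set v : ℝ → ℝ → V := (fun y s => -al p • w y s - y • z y s + ss (al p + 1) 0 0 A y s) with hv
  have sys := h.wsys hp 0 0 (S := Icc (-1) 1 ×ˢ Ioi (-4)) (fun y s hys => cone_mem hO hys)
  rw [← hw, ← hz] at sys
  change WSys p _ w v z _ _ at sys
  have hJ : Icc (-3 : ℝ) 1 ⊆ Ioi (-4) := fun s hs => lt_of_lt_of_le (by norm_num) hs.1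
  obtain ⟨hN, hD, hMZ⟩ := hK (Ioi (-4)) w v z _ _ isOpen_Ioi hJ sys
    (fun s hs => fE_nonneg hp h hO sys (hJ hs)) hE0
  have hJ2 : Icc (-2 : ℝ) 0 ⊆ Ioi (-4) := fun s hs => lt_of_lt_of_le (by norm_num) hs.1
  have cN := (fN_cont hp isOpen_Ioi sys).mono hJ2
  have cD := (fD_cont hp isOpen_Ioi sys).mono hJ2
  have eqpt : ∀ s ζ, ((exp (-s) - 1) * ζ) = 0 + ((1 - exp s) * ζ) * exp (-s) := by
    intro s ζ
    have : exp s * exp (-s) = 1 := by rw [← Real.exp_add]; simp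
    linear_combination ζ * this
  have bnd : ∀ s ∈ Icc (-2 : ℝ) 0, ∀ ζ ∈ Icc (-1 : ℝ) 1, (1 - exp s) * ζ ∈ Icc (-1 : ℝ) 1 := by
    intro s hs ζ hζ
    have e1 : exp s ≤ 1 := by rw [← Real.exp_zero]; exact Real.exp_le_exp.2 hs.2
    have e0 := Real.exp_pos s
    refine abs_le.1 ?_
    rw [abs_mul, abs_of_nonneg (by linarith)]
    exact mul_le_one₀ (by linarith) (abs_nonneg _) (abs_le.2 hζ)
  have ssn : ∀ (k : ℝ) (g : ℝ → ℝ → V) s ζ, 0 ≤ k → s ≤ 0 →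
      ‖g ((exp (-s) - 1) * ζ) (-exp (-s))‖ ≤ ‖ss k 0 0 g ((1 - exp s) * ζ) s‖ := by
    intro k g s ζ hk hs
    unfold ss
    rw [norm_smul, ← eqpt, zero_sub, Real.norm_of_nonneg (exp_pos _).le]
    refine le_mul_of_one_le_left (norm_nonneg _) ?_
    rw [← Real.exp_zero]
    exact Real.exp_le_exp.2 (by nlinarith)
  have iv : ∀ g : ℝ → ℝ, ContinuousOn g (Icc (-1) 1) → IntervalIntegrable g volume (-1) 1 := by
    intro g hg
    apply ContinuousOn.intervalIntegrable
    rwa [uIcc_of_le (by norm_num)]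
  have resc : ∀ s ∈ Icc (-2 : ℝ) 0, ∀ f : ℝ → ℝ, ContinuousOn f (Icc (-1) 1) →
      ContinuousOn (fun ζ => f ((1 - exp s) * ζ)) (Icc (-1) 1) := by
    intro s hs f hf
    exact hf.comp (f := fun ζ => (1 - exp s) * ζ) (by fun_prop) (fun ζ hζ => bnd s hs ζ hζ)
  -- derivative bound
  have step2 : ∀ s ∈ Icc (-2 : ℝ) 0, ‖(exp (-s) * (exp (-s) - 1)) •
      ∫ ζ in (-1 : ℝ)..1, nl p (u ((exp (-s) - 1) * ζ) (-exp (-s)))‖ ≤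
      exp 4 * W * (I1 + fN p w s) := by
    intro s hs
    have e1 : exp s ≤ 1 := by rw [← Real.exp_zero]; exact Real.exp_le_exp.2 hs.2
    have ee : exp (-s) - 1 = exp (-s) * (1 - exp s) := by
      have : exp s * exp (-s) = 1 := by rw [← Real.exp_add]; simp
      linear_combination this
    have c5 := WSys.slice sys.cw (hJ2 hs)
    have c6 := cont_pow hp c5
    have c7 : ContinuousOn (fun y => ‖w y s‖ ^ p) (Icc (-1) 1) :=
      c5.norm.rpow_const (fun _ _ => Or.inr (by linarith))
    have i1 : ‖∫ ζ in (-1 : ℝ)..1, nl p (u ((exp (-s) - 1) * ζ) (-exp (-s)))‖ ≤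
        ∫ ζ in (-1 : ℝ)..1, ‖w ((1 - exp s) * ζ) s‖ ^ p := by
      refine intervalIntegral.norm_integral_le_of_norm_le (by norm_num) ?_
        (iv _ (resc s hs (fun y => ‖w y s‖ ^ p) c7))
      refine Eventually.of_forall fun ζ hζ => ?_
      rw [norm_nl hp]
      exact Real.rpow_le_rpow (norm_nonneg _) (ssn _ u s ζ ha.le hs.2) (by linarith)
    have i2 : (1 - exp s) * ∫ ζ in (-1 : ℝ)..1, ‖w ((1 - exp s) * ζ) s‖ ^ p =
        ∫ y in (-(1 - exp s))..(1 - exp s), ‖w y s‖ ^ p := by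
      have := intervalIntegral.mul_integral_comp_mul_left (a := -1) (b := 1)
        (f := fun y => ‖w y s‖ ^ p) (c := 1 - exp s)
      simpa using this
    have i3 := weight_le hp c7 (fun y _ => by positivity) hs
    have i4 : II p (fun y => (1 - y ^ 2) ^ 2 * ‖w y s‖ ^ p) ≤ I1 + fN p w s := by
      rw [hI1]; unfold fN
      have c6 := c_q (cont_pow hp c5)
      rw [← II_add hp continuousOn_const c6]
      refine II_mono hp (c_q2 c7) (continuousOn_const.fun_add c6) ?_
      intro y hy
      have h0 : 0 ≤ 1 - y ^ 2 := by nlinarith [hy.1, hy.2]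
      have h1 : 1 - y ^ 2 ≤ 1 := by nlinarith [sq_nonneg y]
      have h2 := rpow_le_one_add hp (norm_nonneg (w y s))
      have h3 : (1 - y ^ 2) ^ 2 ≤ 1 - y ^ 2 := by nlinarith
      have h4 : 0 ≤ ‖w y s‖ ^ (p + 1) := by positivity
      calc _ ≤ (1 - y ^ 2) * (1 + ‖w y s‖ ^ (p + 1)) :=
            mul_le_mul h3 h2 (by positivity) h0
        _ ≤ _ := by nlinarith
    have e4 : exp (-s) * exp (-s) ≤ exp 4 := by
      rw [← Real.exp_add]; exact Real.exp_le_exp.2 (by linarith [hs.1])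
    have nn : 0 ≤ I1 + fN p w s := add_nonneg I10 fN_nonneg
    rw [norm_smul, ee, Real.norm_of_nonneg (mul_nonneg (exp_pos _).le
      (mul_nonneg (exp_pos _).le (by linarith)))]
    calc _ ≤ exp (-s) * (exp (-s) * (1 - exp s)) *
          ∫ ζ in (-1 : ℝ)..1, ‖w ((1 - exp s) * ζ) s‖ ^ p := by
          rw [← ee]
          refine mul_le_mul_of_nonneg_left i1 (mul_nonneg (exp_pos _).le ?_)
          rw [ee]; exact mul_nonneg (exp_pos _).le (by linarith)
      _ = exp (-s) * exp (-s) * ((1 - exp s) *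
          ∫ ζ in (-1 : ℝ)..1, ‖w ((1 - exp s) * ζ) s‖ ^ p) := by ring
      _ ≤ exp 4 * (W * (I1 + fN p w s)) := by
          rw [i2]
          refine mul_le_mul e4 (i3.trans (mul_le_mul_of_nonneg_left i4 W0.le)) ?_ (exp_pos _).le
          exact intervalIntegral.integral_nonneg (by linarith) (fun y _ => by positivity)
      _ = _ := by ring
  -- value bound
  have step3 : ∀ s ∈ Icc (-2 : ℝ) (-1), ‖∫ ζ in (-1 : ℝ)..1, dal u A B ζ s‖ ≤
      K1 + K2 * (fN p w s + fD p v s) := by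
    intro s hs1
    have hs : s ∈ Icc (-2 : ℝ) 0 := ⟨hs1.1, by linarith [hs1.2]⟩
    have eh : exp s ≤ 1 / 2 := by
      have : exp s ≤ exp (-1) := Real.exp_le_exp.2 hs1.2
      have := Real.exp_neg_one_lt_d9
      linarith
    have e2 : exp (-s) ≤ exp 2 := Real.exp_le_exp.2 (by linarith [hs1.1])
    have es1 : 1 ≤ exp (-s) := by rw [← Real.exp_zero]; exact Real.exp_le_exp.2 (by linarith [hs.2])
    have c1 := WSys.slice sys.cv (hJ2 hs)
    have c2 := WSys.slice sys.cz (hJ2 hs)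
    have c5 := WSys.slice sys.cw (hJ2 hs)
    have c7 : ContinuousOn (fun y => ‖w y s‖ + ‖z y s‖ + ‖v y s‖) (Icc (-1) 1) :=
      (c5.norm.fun_add c2.norm).fun_add c1.norm
    have i1 : ‖∫ ζ in (-1 : ℝ)..1, dal u A B ζ s‖ ≤
        ∫ ζ in (-1 : ℝ)..1, c * (‖w ((1 - exp s) * ζ) s‖ + ‖z ((1 - exp s) * ζ) s‖
          + ‖v ((1 - exp s) * ζ) s‖) := by
      refine intervalIntegral.norm_integral_le_of_norm_le (by norm_num) ?_
        ((iv _ (resc s hs (fun y => ‖w y s‖ + ‖z y s‖ + ‖v y s‖) c7)).const_mul c)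
      refine Eventually.of_forall fun ζ hζ => ?_
      have hζ' := Ioc_subset_Icc_self hζ
      have nu := ssn (al p) u s ζ ha.le hs.2
      have nB := ssn (al p + 1) B s ζ (by linarith) hs.2
      have nA := ssn (al p + 1) A s ζ (by linarith) hs.2
      rw [← hw] at nu
      rw [← hz] at nB
      set y := (1 - exp s) * ζ with hy
      have hy1 : |y| ≤ 1 := abs_le.2 (bnd s hs ζ hζ')
      have eA : ss (al p + 1) 0 0 A y s = v y s + al p • w y s + y • z y s := by
        simp only [hv]; module
      have nA2 : ‖ss (al p + 1) 0 0 A y s‖ ≤ ‖v y s‖ + al p * ‖w y s‖ + ‖z y s‖ := by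
        rw [eA]
        refine (norm_add₃_le).trans ?_
        rw [norm_smul, norm_smul, Real.norm_of_nonneg ha.le, Real.norm_eq_abs]
        have := mul_le_of_le_one_left (norm_nonneg (z y s)) hy1
        linarith
      unfold dal
      refine (norm_add_le _ _).trans ?_
      rw [norm_smul, Real.norm_of_nonneg (by linarith)]
      have q1 : ‖ζ • B ((exp (-s) - 1) * ζ) (-exp (-s)) + A ((exp (-s) - 1) * ζ) (-exp (-s))‖ ≤
          2 * ‖z y s‖ + ‖v y s‖ + al p * ‖w y s‖ := by
        refine (norm_add_le _ _).trans ?_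
        rw [norm_smul, Real.norm_eq_abs]
        have := mul_le_of_le_one_left (norm_nonneg (B ((exp (-s) - 1) * ζ) (-exp (-s))))
          (abs_le.2 hζ')
        linarith
      have q2 : (exp (-s) - 1) * ‖ζ • B ((exp (-s) - 1) * ζ) (-exp (-s))
          + A ((exp (-s) - 1) * ζ) (-exp (-s))‖ ≤
          exp 2 * (2 * ‖z y s‖ + ‖v y s‖ + al p * ‖w y s‖) :=
        mul_le_mul (by linarith) q1 (norm_nonneg _) (exp_pos _).le
      refine (add_le_add nu q2).trans ?_
      have p1 := mul_nonneg (exp_pos 2).le (norm_nonneg (w y s))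
      have p2 := mul_nonneg (exp_pos 2).le (norm_nonneg (z y s))
      have p3 := mul_nonneg (exp_pos 2).le (norm_nonneg (v y s))
      have p4 := mul_nonneg p1 ha.le
      have p5 := mul_nonneg p2 ha.le
      have p6 := mul_nonneg p3 ha.le
      rw [hc]
      linarith [norm_nonneg (w y s), norm_nonneg (z y s), norm_nonneg (v y s)]
    have i2 : (1 - exp s) * ∫ ζ in (-1 : ℝ)..1, (‖w ((1 - exp s) * ζ) s‖ + ‖z ((1 - exp s) * ζ) s‖
          + ‖v ((1 - exp s) * ζ) s‖) =
        ∫ y in (-(1 - exp s))..(1 - exp s), (‖w y s‖ + ‖z y s‖ + ‖v y s‖) := by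
      have := intervalIntegral.mul_integral_comp_mul_left (a := -1) (b := 1)
        (f := fun y => ‖w y s‖ + ‖z y s‖ + ‖v y s‖) (c := 1 - exp s)
      simpa using this
    have i3 := weight_le hp c7 (fun y _ => by positivity) hs
    have i4 : II p (fun y => (1 - y ^ 2) ^ 2 * (‖w y s‖ + ‖z y s‖ + ‖v y s‖)) ≤
        3 * I1 + (fM p w s + (fZ p z s + fD p v s)) := by
      rw [hI1, ← II_mul]; unfold fM fZ fD
      have k1 := c_q (c_n2 c5)
      have k2 := c_q2 (c_n2 c2)
      have k3 := c_n2 c1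
      rw [← II_add hp k2 k3, ← II_add hp k1 (k2.fun_add k3),
        ← II_add hp continuousOn_const (k1.fun_add (k2.fun_add k3))]
      refine II_mono hp (c_q2 c7) (continuousOn_const.fun_add (k1.fun_add (k2.fun_add k3))) ?_
      intro y hy
      have h0 : 0 ≤ 1 - y ^ 2 := by nlinarith [hy.1, hy.2]
      have h1 : 1 - y ^ 2 ≤ 1 := by nlinarith [sq_nonneg y]
      have h3 : (1 - y ^ 2) ^ 2 ≤ 1 - y ^ 2 := by nlinarith
      have h4 : (1 - y ^ 2) ^ 2 ≤ 1 := h3.trans h1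
      have sqb : ∀ x : ℝ, x ≤ 1 + x ^ 2 := fun x => by nlinarith [sq_nonneg (x - 1), sq_nonneg (x+1)]
      set q := (1 - y ^ 2) ^ 2 with hq
      have q0 : 0 ≤ q := sq_nonneg _
      have b1 := mul_le_mul_of_nonneg_left (sqb ‖w y s‖) q0
      have b2 := mul_le_mul_of_nonneg_left (sqb ‖z y s‖) q0
      have b3 := mul_le_mul_of_nonneg_left (sqb ‖v y s‖) q0
      have b4 : q * ‖w y s‖ ^ 2 ≤ (1 - y ^ 2) * ‖w y s‖ ^ 2 :=
        mul_le_mul_of_nonneg_right h3 (sq_nonneg _)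
      have b5 : q * ‖v y s‖ ^ 2 ≤ ‖v y s‖ ^ 2 := mul_le_of_le_one_left (sq_nonneg _) h4
      linarith
    have i5 := hMZ s hs
    have hNs : 0 ≤ fN p w s := fN_nonneg
    have hDs : 0 ≤ fD p v s := fD_nonneg
    set IG := ∫ ζ in (-1 : ℝ)..1, (‖w ((1 - exp s) * ζ) s‖ + ‖z ((1 - exp s) * ζ) s‖
          + ‖v ((1 - exp s) * ζ) s‖) with hIG
    have IG0 : 0 ≤ IG := intervalIntegral.integral_nonneg (by norm_num) (fun y _ => by positivity)
    rw [intervalIntegral.integral_const_mul] at i1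
    have i6 : IG ≤ 2 * (W * (3 * I1 + K0 + (K0 + 1) * (fN p w s + fD p v s))) := by
      have : 1 / 2 * IG ≤ (1 - exp s) * IG := mul_le_mul_of_nonneg_right (by linarith) IG0
      rw [i2] at this
      have t2 := mul_le_mul_of_nonneg_left i4 W0.le
      have t3 : 3 * I1 + (fM p w s + (fZ p z s + fD p v s)) ≤
        3 * I1 + K0 + (K0 + 1) * (fN p w s + fD p v s) := by nlinarith
      have t4 := mul_le_mul_of_nonneg_left t3 W0.le
      linarith
    have i7 := mul_le_mul_of_nonneg_left i6 c0.le
    rw [hK1, hK2]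
    linarith
  -- combine
  have iN : IntervalIntegrable (fN p w) volume (-2) 0 := by
    apply ContinuousOn.intervalIntegrable; rwa [uIcc_of_le (by norm_num)]
  have iD : IntervalIntegrable (fD p v) volume (-2) 0 := by
    apply ContinuousOn.intervalIntegrable; rwa [uIcc_of_le (by norm_num)]
  have iφ : IntervalIntegrable (fun s => exp 4 * W * (I1 + fN p w s)) volume (-2) 0 :=
    (IntervalIntegrable.add (by simp) iN).const_mul _
  have hK3' : ∫ s in (-2 : ℝ)..0, exp 4 * W * (I1 + fN p w s) ≤ K3 := by
    rw [intervalIntegral.integral_const_mul, intervalIntegral.integral_add (by simp) iN,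
      intervalIntegral.integral_const, hK3]
    refine mul_le_mul_of_nonneg_left ?_ (by positivity)
    simp only [smul_eq_mul]; linarith
  have d0 : ∀ s ∈ Icc (-2 : ℝ) 0, HasDerivAt (fun s => ∫ ζ in (-1 : ℝ)..1, dal u A B ζ s)
      ((exp (-s) * (exp (-s) - 1)) • ∫ ζ in (-1 : ℝ)..1, nl p (u ((exp (-s) - 1) * ζ) (-exp (-s)))) s :=
    fun s hs => dal_deriv hp h hO ⟨by linarith [hs.1], by linarith [hs.2]⟩
  have v0 : (∫ ζ in (-1 : ℝ)..1, dal u A B ζ 0) = (2 : ℝ) • u 0 (-1) := by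
    simp [dal]; norm_num
  have fin : ∀ s ∈ Icc (-2 : ℝ) (-1), 2 * ‖u 0 (-1)‖ - K1 - K3 ≤ K2 * (fN p w s + fD p v s) := by
    intro s hs
    have hsub : Icc s 0 ⊆ Icc (-2 : ℝ) 0 := Icc_subset_Icc hs.1 le_rfl
    have hs0 : s ≤ 0 := by linarith [hs.2]
    have q := norm_sub_le_integral_of_norm_deriv_le_of_le
      (f := fun s => ∫ ζ in (-1 : ℝ)..1, dal u A B ζ s)
      (B := fun s => exp 4 * W * (I1 + fN p w s)) hs0
      (fun r hr => (d0 r (hsub hr)).continuousAt.continuousWithinAt)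
      (fun r hr => (d0 r (hsub (Ioo_subset_Icc_self hr))).differentiableAt.differentiableWithinAt)
      (Eventually.of_forall fun r hr => by
        rw [(d0 r (hsub (Ioo_subset_Icc_self hr))).deriv]
        exact step2 r (hsub (Ioo_subset_Icc_self hr)))
      (iφ.mono_set (by
        rw [uIcc_of_le hs0, uIcc_of_le (by norm_num)]; exact hsub))
    have q2 : ∫ s in s..0, exp 4 * W * (I1 + fN p w s) ≤
        ∫ s in (-2 : ℝ)..0, exp 4 * W * (I1 + fN p w s) := by
      refine intervalIntegral.integral_mono_interval hs.1 hs0 le_rfl ?_ iφ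
      refine Eventually.of_forall fun r => ?_
      have : 0 ≤ fN p w r := fN_nonneg
      simp only [Pi.zero_apply]
      positivity
    have q3 := step3 s hs
    rw [v0] at q
    have q4 := norm_sub_norm_le ((2 : ℝ) • u 0 (-1)) (∫ ζ in (-1 : ℝ)..1, dal u A B ζ s)
    rw [norm_smul] at q4
    norm_num at q4
    linarith
  have tot : 2 * ‖u 0 (-1)‖ - K1 - K3 ≤ K2 * (2 * K0) := by
    have hsub : Icc (-2 : ℝ) (-1) ⊆ Icc (-2) 0 := Icc_subset_Icc le_rfl (by norm_num)
    have hsub' : uIcc (-2 : ℝ) (-1) ⊆ uIcc (-2) 0 := by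
      rw [uIcc_of_le (by norm_num), uIcc_of_le (by norm_num)]; exact hsub
    have iND : IntervalIntegrable (fun s => K2 * (fN p w s + fD p v s)) volume (-2) 0 :=
      (iN.add iD).const_mul K2
    have t1 : ∫ s in (-2 : ℝ)..(-1), (2 * ‖u 0 (-1)‖ - K1 - K3) ≤
        ∫ s in (-2 : ℝ)..(-1), K2 * (fN p w s + fD p v s) :=
      intervalIntegral.integral_mono_on (by norm_num) (by simp) (iND.mono_set hsub') fin
    have t2 : ∫ s in (-2 : ℝ)..(-1), K2 * (fN p w s + fD p v s) ≤
        ∫ s in (-2 : ℝ)..0, K2 * (fN p w s + fD p v s) := by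
      refine intervalIntegral.integral_mono_interval le_rfl (by norm_num) (by norm_num) ?_ iND
      refine Eventually.of_forall fun r => ?_
      have : 0 ≤ fN p w r := fN_nonneg
      have : 0 ≤ fD p v r := fD_nonneg
      simp only [Pi.zero_apply]
      positivity
    rw [intervalIntegral.integral_const] at t1
    have t4 : ∫ s in (-2 : ℝ)..0, K2 * (fN p w s + fD p v s) =
        K2 * ((∫ s in (-2 : ℝ)..0, fN p w s) + ∫ s in (-2 : ℝ)..0, fD p v s) := by
      rw [intervalIntegral.integral_const_mul, intervalIntegral.integral_add iN iD]
    rw [t4] at t2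
    have t3 : K2 * ((∫ s in (-2 : ℝ)..0, fN p w s) + ∫ s in (-2 : ℝ)..0, fD p v s) ≤ K2 * (2 * K0) :=
      mul_le_mul_of_nonneg_left (by linarith) (by positivity)
    rw [show (-1 - -2 : ℝ) = 1 by norm_num, one_smul] at t1
    exact t1.trans (t2.trans t3)
  have : 0 ≤ K1 := by positivity
  have : 0 ≤ K3 := by positivity
  have : 0 ≤ K2 * (2 * K0) := by positivity
  linarith [norm_nonneg (u 0 (-1))]

end PartSeven

section PartEight
variable {V : Type*} [NormedAddCommGroup V] [InnerProductSpace ℝ V] {p : ℝ}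
  {O : Set (ℝ × ℝ)} {u A B C G : ℝ → ℝ → V}

theorem ss_scale (a X S : ℝ) {k : ℝ} (hk : 0 < k) (g : ℝ → ℝ → V) (y s : ℝ) :
    ss a 0 0 (fun x t => k ^ a • g (X + k * x) (S + k * t)) y s = ss a X S g y (s - log k) := by
  unfold ss
  have e : exp (-(s - log k)) = k * exp (-s) := by
    rw [neg_sub, sub_eq_add_neg, Real.exp_add, Real.exp_log hk]
  rw [e, smul_smul, Real.rpow_def_of_pos hk, ← Real.exp_add]
  congr 2 <;> ring_nf

theorem fE_le (hp : 1 < p) {w v z vy zy : ℝ → ℝ → V} {J : Set ℝ}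
    (h : WSys p (Icc (-1) 1 ×ˢ J) w v z vy zy) {s : ℝ} (hs : s ∈ J) {M : ℝ}
    (hw : ∀ y ∈ Icc (-1 : ℝ) 1, ‖w y s‖ ≤ M) (hv : ∀ y ∈ Icc (-1 : ℝ) 1, ‖v y s‖ ≤ M)
    (hz : ∀ y ∈ Icc (-1 : ℝ) 1, ‖z y s‖ ≤ M) :
    fE p w v z s ≤ (1 + al p * (al p + 1) / 2) * M ^ 2 * II p (fun _ => 1) := by
  have ha := al_pos hp
  have c1 := WSys.slice h.cw hs
  have c2 := WSys.slice h.cv hs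
  have c3 := WSys.slice h.cz hs
  have c4 := cont_pow hp c1
  have c5 := c1.norm.pow 2
  have c6 := c2.norm.pow 2
  have c7 := c3.norm.pow 2
  rw [← II_mul]; unfold fE
  refine II_mono hp (by fun_prop) (by fun_prop) ?_
  intro y hy
  have h0 : 0 ≤ 1 - y ^ 2 := by nlinarith [hy.1, hy.2]
  have h1 : 1 - y ^ 2 ≤ 1 := by nlinarith [sq_nonneg y]
  have b1 : ‖w y s‖ ^ 2 ≤ M ^ 2 := pow_le_pow_left₀ (norm_nonneg _) (hw y hy) 2
  have b2 : ‖v y s‖ ^ 2 ≤ M ^ 2 := pow_le_pow_left₀ (norm_nonneg _) (hv y hy) 2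
  have b3 : ‖z y s‖ ^ 2 ≤ M ^ 2 := pow_le_pow_left₀ (norm_nonneg _) (hz y hy) 2
  have b4 : ‖z y s‖ ^ 2 * (1 - y ^ 2) ≤ M ^ 2 := (mul_le_of_le_one_right (sq_nonneg _) h1).trans b3
  have b5 : 0 ≤ ‖w y s‖ ^ (p + 1) / (p + 1) := by positivity
  have b6 : al p * (al p + 1) / 2 * ‖w y s‖ ^ 2 ≤ al p * (al p + 1) / 2 * M ^ 2 :=
    mul_le_mul_of_nonneg_left b1 (by positivity)
  have b7 : 0 ≤ (1 + al p * (al p + 1) / 2) * M ^ 2 := by positivity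
  calc _ ≤ (1 - y ^ 2) * ((1 + al p * (al p + 1) / 2) * M ^ 2) :=
        mul_le_mul_of_nonneg_left (by linarith) h0
    _ ≤ _ := by rw [mul_one]; exact mul_le_of_le_one_left b7 h1

variable [CompleteSpace V]

set_option maxHeartbeats 1600000 in
theorem linf (hp : 1 < p) (h : Sol p O u A B C G) {δ L : ℝ} (hδ : 0 < δ) (hδ1 : δ < 1)
    (hL : 1 < L) (hδL : δ * L < 1)
    (hO : ∀ x t, -(exp 4 + 2) ≤ t → t ≤ -δ * |x| → t < 0 → (x, t) ∈ O) :
    ∃ K : ℝ, 0 < K ∧ ∀ x t, -1 ≤ t → t < 0 → |x| ≤ L * (-t) → ‖u x t‖ ≤ K * (-t) ^ (-al p) := by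
  have ha := al_pos hp
  set c := (1 - δ * L) / 2 with hc
  have c0 : 0 < c := by rw [hc]; linarith
  have c1 : c < 1 / 2 := by
    have : 0 < δ * L := by positivity
    rw [hc]; linarith
  set R := exp 4 + 1 with hR
  have R1 : 1 ≤ R := by have := exp_pos 4; linarith
  set Q : Set (ℝ × ℝ) := Icc (-(R / δ)) (R / δ) ×ˢ {-R} with hQ
  have cQ : IsCompact Q := isCompact_Icc.prod isCompact_singleton
  have sQ : Q ⊆ O := by
    rintro ⟨x, t⟩ ⟨hx, ht⟩
    have ht : t = -R := ht
    have : |x| ≤ R / δ := abs_le.2 hx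
    rw [le_div_iff₀ hδ] at this
    exact hO x t (by rw [ht]; linarith) (by rw [ht]; linarith) (by linarith)
  obtain ⟨M1, hM1⟩ := cQ.exists_bound_of_continuousOn (h.cu.mono sQ)
  obtain ⟨M2, hM2⟩ := cQ.exists_bound_of_continuousOn (h.cA.mono sQ)
  obtain ⟨M3, hM3⟩ := cQ.exists_bound_of_continuousOn (h.cB.mono sQ)
  set M := max (max M1 M2) (max M3 0) with hM
  have M0 : 0 ≤ M := (le_max_right _ _).trans (le_max_right _ _)
  set N := R ^ (al p + 1) * M with hN
  have N0 : 0 ≤ N := by positivity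
  obtain ⟨K, hK, hb⟩ := pt_bound (V := V) hp
    ((1 + al p * (al p + 1) / 2) * ((al p + 2) * N) ^ 2 * II p (fun _ => 1))
  refine ⟨K * c ^ (-al p), by positivity, ?_⟩
  intro x t ht1 ht0 hx
  set k := c * (-t) with hk
  have k0 : 0 < k := mul_pos c0 (by linarith)
  have k1 : k < 1 / 2 := by nlinarith
  have tk : t + k ≤ -δ * |x| := by
    have : δ * |x| ≤ δ * (L * (-t)) := mul_le_mul_of_nonneg_left hx hδ.le
    have h2 : k = (1 - δ * L) / 2 * (-t) := by rw [hk, hc]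
    nlinarith
  have tk0 : t + k < 0 := by rw [hk]; nlinarith
  have mem : ∀ x' r, |x'| ≤ r → -(exp 4 + 2) ≤ t + k - r → (x + x', t + k - r) ∈ O := by
    intro x' r h1 h2
    have := abs_nonneg x'
    refine hO _ _ h2 ?_ (by linarith)
    have h3 := mul_le_mul_of_nonneg_left (abs_add_le x x') hδ.le
    have h4 := mul_le_of_le_one_left (abs_nonneg x') hδ1.le
    rw [mul_add] at h3
    linarith
  have hS := h.scale hp x (t + k) k0
  set u' : ℝ → ℝ → V := fun x' t' => k ^ al p • u (x + k * x') (t + k + k * t') with hu'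
  set A' : ℝ → ℝ → V := fun x' t' => k ^ (al p + 1) • A (x + k * x') (t + k + k * t') with hA'
  set B' : ℝ → ℝ → V := fun x' t' => k ^ (al p + 1) • B (x + k * x') (t + k + k * t') with hB'
  have mem' : ∀ x' t', |x'| ≤ -t' → -(exp 4 + 2) ≤ t + k + k * t' →
      (x', t') ∈ {q : ℝ × ℝ | (x + k * q.1, t + k + k * q.2) ∈ O} := by
    intro x' t' h1 h2
    have := mem (k * x') (k * (-t')) (by
      rw [abs_mul, abs_of_pos k0]; exact mul_le_mul_of_nonneg_left h1 k0.le) (by linarith)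
    show (x + k * x', t + k + k * t') ∈ O
    rwa [mul_neg, sub_neg_eq_add] at this
  have e4 := exp_pos 4
  have key := hb _ u' A' B' _ _ hS (fun x' t' h1 h2 h3 => mem' x' t' h1 (by nlinarith)) ?_
  · have e : u' 0 (-1) = k ^ al p • u x t := by
      simp only [hu']; congr 2 <;> ring
    rw [e, norm_smul, Real.norm_of_nonneg (by positivity)] at key
    rw [mul_assoc, ← Real.mul_rpow c0.le (by linarith), ← hk, Real.rpow_neg k0.le,
      ← div_eq_mul_inv, le_div_iff₀ (by positivity)]
    linarith
  -- energy bound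
  set r := R + t + k with hr
  have r0 : exp 4 < r := by linarith
  have rp : 0 < r := e4.trans r0
  have rR : r ≤ R := by linarith
  set J : Set ℝ := {s | -(exp 4 + 2) < t + k + k * (0 - exp (-s))} with hJ
  have oJ : IsOpen J := isOpen_lt (by fun_prop) (by fun_prop)
  have sys := hS.wsys hp 0 0 (S := Icc (-1) 1 ×ˢ J) (fun y s hys => by
    refine mem' _ _ ?_ (le_of_lt hys.2)
    rw [zero_add, abs_mul, abs_of_pos (exp_pos _), zero_sub, neg_neg]
    exact mul_le_of_le_one_left (exp_pos _).le (abs_le.2 hys.1))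
  set s1 := log k - log r with hs1
  have es1 : exp (-s1) = r / k := by
    rw [hs1, neg_sub, Real.exp_sub, Real.exp_log rp, Real.exp_log k0]
  have hs13 : s1 ≤ -3 := by
    have : exp 3 ≤ exp (-s1) := by
      rw [es1, le_div_iff₀ k0]
      have : exp 3 ≤ exp 4 := Real.exp_le_exp.2 (by norm_num)
      exact (mul_le_of_le_one_right (exp_pos 3).le (by linarith)).trans (this.trans r0.le)
    have := Real.exp_le_exp.1 this
    linarith
  have sub : Icc s1 (-3) ⊆ J := by
    intro s hs
    have : exp (-s) ≤ r / k := by rw [← es1]; exact Real.exp_le_exp.2 (by linarith [hs.1])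
    rw [le_div_iff₀ k0] at this
    show -(exp 4 + 2) < t + k + k * (0 - exp (-s))
    rw [zero_sub, mul_neg, mul_comm k]; linarith
  refine (fE_anti hp oJ sys sub (left_mem_Icc.2 hs13) (right_mem_Icc.2 hs13) hs13).trans ?_
  have gb : ∀ (a : ℝ) (g : ℝ → ℝ → V), (∀ q ∈ Q, ‖g q.1 q.2‖ ≤ M) → 0 < a → a ≤ al p + 1 →
      ∀ y ∈ Icc (-1 : ℝ) 1,
      ‖ss a 0 0 (fun x' t' => k ^ a • g (x + k * x') (t + k + k * t')) y s1‖ ≤ N := by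
    intro a g hg a0 a1 y hy
    rw [ss_scale a x (t + k) k0]
    have e1 : exp (-(s1 - log k)) = r := by
      rw [hs1, sub_sub_cancel_left, neg_neg, Real.exp_log rp]
    unfold ss
    have e2 : exp (-a * (s1 - log k)) = r ^ a := by
      rw [← e1, ← Real.exp_mul]; ring_nf
    rw [e1, e2, norm_smul, Real.norm_of_nonneg (by positivity)]
    refine mul_le_mul ?_ (hg (x + y * r, t + k - r) ⟨?_, ?_⟩) (norm_nonneg _) (by positivity)
    · exact (Real.rpow_le_rpow rp.le rR a0.le).trans (Real.rpow_le_rpow_of_exponent_le R1 a1)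
    · refine abs_le.1 ?_
      have h1 : |y * r| ≤ r := by
        rw [abs_mul, abs_of_pos rp]; exact mul_le_of_le_one_left rp.le (abs_le.2 hy)
      have h2 := abs_add_le x (y * r)
      rw [le_div_iff₀ hδ]
      have h3 := mul_le_mul_of_nonneg_right h2 hδ.le
      have h4 := mul_le_mul_of_nonneg_right h1 hδ.le
      have h5 := mul_le_of_le_one_right rp.le hδ1.le
      rw [add_mul] at h3
      linarith
    · show _ = _
      rw [hr]; ring
  have q1 : M1 ≤ M := (le_max_left _ _).trans (le_max_left _ _)
  have q2 : M2 ≤ M := (le_max_right _ _).trans (le_max_left _ _)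
  have q3 : M3 ≤ M := (le_max_left _ _).trans (le_max_right _ _)
  have bu := gb (al p) u (fun q hq => (hM1 q hq).trans q1) ha (by linarith)
  have bA := gb (al p + 1) A (fun q hq => (hM2 q hq).trans q2) (by linarith) le_rfl
  have bB := gb (al p + 1) B (fun q hq => (hM3 q hq).trans q3) (by linarith) le_rfl
  have NN : N ≤ (al p + 2) * N := le_mul_of_one_le_left N0 (by linarith)
  refine fE_le hp sys (sub (left_mem_Icc.2 hs13)) (fun y hy => (bu y hy).trans NN) ?_
    (fun y hy => (bB y hy).trans NN)
  intro y hy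
  refine (norm_add_le _ _).trans ?_
  have h1 := norm_sub_le (-al p • ss (al p) 0 0 u' y s1) (y • ss (al p + 1) 0 0 B' y s1)
  rw [norm_smul, norm_smul, norm_neg, Real.norm_of_nonneg ha.le, Real.norm_eq_abs] at h1
  have h2 : |y| * ‖ss (al p + 1) 0 0 B' y s1‖ ≤ N :=
    (mul_le_of_le_one_left (norm_nonneg _) (abs_le.2 hy)).trans (bB y hy)
  have h3 := mul_le_mul_of_nonneg_left (bu y hy) ha.le
  have h4 := bA y hy
  linarith

end PartEight

section PartNine
variable {V : Type*} [NormedAddCommGroup V] [InnerProductSpace ℝ V] {p : ℝ}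
  {O : Set (ℝ × ℝ)} {u A B C G : ℝ → ℝ → V}

theorem grow {f f' : ℝ → V} {t a D M0 : ℝ} (ht1 : -1 ≤ t) (ht0 : t < 0) (ha : 1 ≤ a)
    (hf : ∀ τ ∈ Icc (-1) t, HasDerivAt f (f' τ) τ)
    (hD : ∀ τ ∈ Icc (-1) t, ‖f' τ‖ ≤ D * (-τ) ^ (-(a + 1))) (h0 : ‖f (-1)‖ ≤ M0) (D0 : 0 ≤ D) :
    ‖f t‖ ≤ (M0 + D) * (-t) ^ (-a) := by
  have M00 : 0 ≤ M0 := (norm_nonneg _).trans h0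
  have dB : ∀ τ ∈ Icc (-1) t, HasDerivAt (fun τ => (M0 + D) * (-τ) ^ (-a))
      ((M0 + D) * (a * (-τ) ^ (-(a + 1)))) τ := by
    intro τ hτ
    have := ((hasDerivAt_id τ).neg.rpow_const (p := -a) (Or.inl (by
      simp only [Pi.neg_apply, id]; linarith [hτ.2]))).const_mul (M0 + D)
    refine this.congr_deriv ?_
    simp only [Pi.neg_apply, id]
    rw [show -a - 1 = -(a + 1) by ring]; ring
  refine image_norm_le_of_norm_deriv_right_le_deriv_boundary'
    (fun τ hτ => (hf τ hτ).continuousAt.continuousWithinAt)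
    (fun τ hτ => (hf τ (Ico_subset_Icc_self hτ)).hasDerivWithinAt) ?_
    (B := fun τ => (M0 + D) * (-τ) ^ (-a))
    (fun τ hτ => (dB τ hτ).continuousAt.continuousWithinAt)
    (fun τ hτ => (dB τ (Ico_subset_Icc_self hτ)).hasDerivWithinAt) ?_ (right_mem_Icc.2 ht1)
  · simp; linarith
  · intro τ hτ
    refine (hD τ (Ico_subset_Icc_self hτ)).trans ?_
    have : 0 ≤ (-τ) ^ (-(a + 1)) := Real.rpow_nonneg (by linarith [hτ.2]) _
    rw [← mul_assoc]
    refine mul_le_mul_of_nonneg_right ?_ this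
    nlinarith

theorem ch_deriv (h : Sol p O u A B C G) {e x t τ : ℝ} (he : e * e = 1)
    (hm : (x + e * (t - τ), τ) ∈ O) :
    HasDerivAt (fun τ => A (x + e * (t - τ)) τ + e • B (x + e * (t - τ)) τ)
      (nl p (u (x + e * (t - τ)) τ)) τ := by
  have hX : HasDerivAt (fun τ => x + e * (t - τ)) (-e) τ := by
    have := (((hasDerivAt_id τ).const_sub t).const_mul e).const_add x
    refine this.congr_deriv (by simp)
  have h1 := lin_comp (h.dA _ _ hm) hX (hasDerivAt_id τ)
  have h2 := (lin_comp (h.dB _ _ hm) hX (hasDerivAt_id τ)).const_smul e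
  refine (h1.add h2).congr_deriv ?_
  have : e • (-e) • G (x + e * (t - τ)) τ = - G (x + e * (t - τ)) τ := by
    rw [smul_smul, mul_neg, he, neg_one_smul]
  simp only [id, smul_add, this]
  module

theorem cone_back {L e x t τ : ℝ} (hL : 1 < L) (he : e * e = 1) (hx : |x| ≤ L * (-t)) (hτ : τ ≤ t) :
    |x + e * (t - τ)| ≤ L * (-τ) := by
  have e1 : |e| = 1 := by
    rw [← abs_mul_abs_self] at he
    nlinarith [abs_nonneg e]
  have := abs_add_le x (e * (t - τ))
  rw [abs_mul, e1, abs_of_nonneg (by linarith : 0 ≤ t - τ)] at this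
  nlinarith

variable (h : Sol p O u A B C G) {L K : ℝ} (hL : 1 < L)
  (hO : ∀ x t, -1 ≤ t → t < 0 → |x| ≤ L * (-t) → (x, t) ∈ O)

include h hL hO in
theorem slice_bdd {g : ℝ → ℝ → V} (hg : ContinuousOn (fun q : ℝ × ℝ => g q.1 q.2) O) :
    ∃ M, 0 ≤ M ∧ ∀ x, |x| ≤ L → ‖g x (-1)‖ ≤ M := by
  have cQ : IsCompact (Icc (-L) L ×ˢ ({-1} : Set ℝ)) := isCompact_Icc.prod isCompact_singleton
  have sQ : Icc (-L) L ×ˢ ({-1} : Set ℝ) ⊆ O := by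
    rintro ⟨x, t⟩ ⟨hx, ht⟩
    have ht : t = -1 := ht
    exact hO x t (by rw [ht]) (by rw [ht]; norm_num) (by rw [ht]; simpa using abs_le.2 hx)
  obtain ⟨M, hM⟩ := cQ.exists_bound_of_continuousOn (hg.mono sQ)
  exact ⟨max M 0, le_max_right _ _, fun x hx =>
    (hM (x, -1) ⟨abs_le.1 hx, rfl⟩).trans (le_max_left _ _)⟩

variable (hK : 0 < K) (hu : ∀ x t, -1 ≤ t → t < 0 → |x| ≤ L * (-t) → ‖u x t‖ ≤ K * (-t) ^ (-al p))

include h hL hO hK hu in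
theorem first_der (hp : 1 < p) {e : ℝ} (he : e * e = 1) : ∃ K1 : ℝ, 0 ≤ K1 ∧
    ∀ x t, -1 ≤ t → t < 0 → |x| ≤ L * (-t) → ‖A x t + e • B x t‖ ≤ K1 * (-t) ^ (-(al p + 1)) := by
  have ha := al_pos hp
  obtain ⟨M, M0, hM⟩ := slice_bdd h hL hO (g := fun x t => A x t + e • B x t)
    (h.cA.add (h.cB.const_smul e))
  refine ⟨M + K ^ p, by positivity, ?_⟩
  intro x t ht1 ht0 hx
  have key := grow (f := fun τ => A (x + e * (t - τ)) τ + e • B (x + e * (t - τ)) τ)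
    (f' := fun τ => nl p (u (x + e * (t - τ)) τ)) (a := al p + 1) (D := K ^ p) (M0 := M)
    ht1 ht0 (by linarith)
    (fun τ hτ => ch_deriv h he (hO _ _ hτ.1 (by linarith [hτ.2]) (cone_back hL he hx hτ.2)))
    ?_ ?_ (by positivity)
  · simpa using key
  · intro τ hτ
    have hτ0 : 0 ≤ -τ := by linarith [hτ.2]
    rw [norm_nl hp]
    refine (Real.rpow_le_rpow (norm_nonneg _) (hu _ _ hτ.1 (by linarith [hτ.2])
      (cone_back hL he hx hτ.2)) (by linarith)).trans (le_of_eq ?_)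
    rw [Real.mul_rpow hK.le (Real.rpow_nonneg hτ0 _), ← Real.rpow_mul hτ0]
    congr 2
    rw [neg_mul, al_mul_p hp]; ring
  · refine hM _ ?_
    have := cone_back hL he hx ht1
    simpa using this

include h hL hO hK hu in
theorem second_der (hp : 1 < p) {K1 : ℝ} (hK1 : 0 ≤ K1)
    (hB : ∀ x t, -1 ≤ t → t < 0 → |x| ≤ L * (-t) → ‖B x t‖ ≤ K1 * (-t) ^ (-(al p + 1)))
    {e : ℝ} (he : e * e = 1) : ∃ K2 : ℝ, 0 ≤ K2 ∧
    ∀ x t, -1 ≤ t → t < 0 → |x| < L * (-t) → ‖C x t + e • G x t‖ ≤ K2 * (-t) ^ (-(al p + 2)) := by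
  have ha := al_pos hp
  obtain ⟨M, M0, hM⟩ := slice_bdd h hL hO (g := fun x t => C x t + e • G x t)
    (h.cC.add (h.cG.const_smul e))
  set D := p * K ^ (p - 1) * K1 with hD
  have D0 : 0 ≤ D := by positivity
  refine ⟨M + D, by positivity, ?_⟩
  intro x t ht1 ht0 hx
  have dW : ∀ x t, (x, t) ∈ O → HasDerivAt (fun x => A x t + e • B x t) (C x t + e • G x t) x := by
    intro x t hm
    have h1 := lin_comp (X := fun x => x) (S := fun _ => t) (h.dA _ _ hm) (hasDerivAt_id x) (hasDerivAt_const x t)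
    have h2 := (lin_comp (X := fun x => x) (S := fun _ => t) (h.dB _ _ hm) (hasDerivAt_id x) (hasDerivAt_const x t)).const_smul e
    refine (h1.add h2).congr_deriv (by simp)
  have lip : ∀ x', |x'| ≤ L * (-t) → ‖(A x' t + e • B x' t) - (A x t + e • B x t)‖ ≤
      (M + D) * (-t) ^ (-(al p + 2)) * ‖x' - x‖ := by
    intro x' hx'
    have key := grow (f := fun τ => (A (x' + e * (t - τ)) τ + e • B (x' + e * (t - τ)) τ) -
        (A (x + e * (t - τ)) τ + e • B (x + e * (t - τ)) τ))
      (f' := fun τ => nl p (u (x' + e * (t - τ)) τ) - nl p (u (x + e * (t - τ)) τ))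
      (a := al p + 2) (D := D * ‖x' - x‖) (M0 := M * ‖x' - x‖)
      ht1 ht0 (by linarith)
      (fun τ hτ => (ch_deriv h he (hO _ _ hτ.1 (by linarith [hτ.2]) (cone_back hL he hx' hτ.2))).sub
        (ch_deriv h he (hO _ _ hτ.1 (by linarith [hτ.2]) (cone_back hL he hx.le hτ.2))))
      ?_ ?_ (by positivity)
    · simp only [sub_self, mul_zero, add_zero] at key
      refine key.trans (le_of_eq (by ring))
    · intro τ hτ
      have hτ0 : 0 < -τ := by linarith [hτ.2]
      have hτn : τ < 0 := by linarith
      have m1 := cone_back hL he hx' hτ.2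
      have m2 := cone_back hL he hx.le hτ.2
      refine (nl_lip hp (hu _ _ hτ.1 hτn m1) (hu _ _ hτ.1 hτn m2)).trans ?_
      have l2 : ‖u (x' + e * (t - τ)) τ - u (x + e * (t - τ)) τ‖ ≤
          K1 * (-τ) ^ (-(al p + 1)) * ‖(x' + e * (t - τ)) - (x + e * (t - τ))‖ := by
        refine (convex_Icc (-(L * (-τ))) (L * (-τ))).norm_image_sub_le_of_norm_hasDerivWithin_le
          (f := fun x => u x τ) (f' := fun x => B x τ) (fun y hy => ?_) (fun y hy => ?_)
          (abs_le.1 m2) (abs_le.1 m1)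
        · have := lin_comp (X := fun x => x) (S := fun _ => τ) (h.du _ _ (hO y τ hτ.1 hτn (abs_le.2 hy)))
            (hasDerivAt_id y) (hasDerivAt_const y τ)
          exact (this.congr_deriv (by simp)).hasDerivWithinAt
        · exact hB y τ hτ.1 hτn (abs_le.2 hy)
      rw [add_sub_add_right_eq_sub] at l2
      refine (mul_le_mul_of_nonneg_left l2 (by positivity)).trans (le_of_eq ?_)
      rw [Real.mul_rpow hK.le (by positivity), ← Real.rpow_mul hτ0.le, neg_mul, al_mul hp,
        show -(al p + 2 + 1) = -2 + -(al p + 1) by ring, Real.rpow_add hτ0, hD]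
      ring
    · have m1 := cone_back hL he hx' ht1
      have m2 := cone_back hL he hx.le ht1
      have := (convex_Icc (-L) L).norm_image_sub_le_of_norm_hasDerivWithin_le
          (f := fun x => A x (-1) + e • B x (-1)) (f' := fun x => C x (-1) + e • G x (-1)) (C := M)
          (x := x + e * (t - -1)) (y := x' + e * (t - -1))
          (fun y hy => (dW y (-1) (hO y (-1) le_rfl (by norm_num)
            (by simpa using abs_le.2 hy))).hasDerivWithinAt) (fun y hy => hM y (abs_le.2 hy))
          (abs_le.1 (by simpa using m2)) (abs_le.1 (by simpa using m1))
      rwa [add_sub_add_right_eq_sub] at this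
  refine (dW x t (hO x t ht1 ht0 hx.le)).le_of_lip' (mul_nonneg (by positivity)
    (Real.rpow_nonneg (by linarith) _)) ?_
  have : ∀ᶠ x' in nhds x, |x'| < L * (-t) := continuous_abs.continuousAt.eventually_lt_const hx
  filter_upwards [this] with x' hx'
  exact lip x' hx'.le

include h hL hO hK hu in
theorem all_der (hp : 1 < p) : ∃ K : ℝ, 0 < K ∧
    ∀ x t, -1 ≤ t → t < 0 → |x| < L * (-t) → ‖u x t‖ ≤ K * (-t) ^ (-al p) ∧
      ‖A x t‖ ≤ K * (-t) ^ (-(al p + 1)) ∧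
      ‖B x t‖ ≤ K * (-t) ^ (-(al p + 1)) ∧ ‖C x t‖ ≤ K * (-t) ^ (-(al p + 2)) ∧
      ‖G x t‖ ≤ K * (-t) ^ (-(al p + 2)) := by
  have half : ∀ (a b : V) (c d : ℝ), ‖a + (1 : ℝ) • b‖ ≤ c → ‖a + (-1 : ℝ) • b‖ ≤ d →
      ‖a‖ ≤ c + d ∧ ‖b‖ ≤ c + d := by
    intro a b c d h1 h2
    have n1 := (norm_nonneg _).trans h1
    have n2 := (norm_nonneg _).trans h2
    have e1 : a = (1 / 2 : ℝ) • ((a + (1 : ℝ) • b) + (a + (-1 : ℝ) • b)) := by module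
    have e2 : b = (1 / 2 : ℝ) • ((a + (1 : ℝ) • b) - (a + (-1 : ℝ) • b)) := by module
    have k1 := norm_add_le (a + (1 : ℝ) • b) (a + (-1 : ℝ) • b)
    have k2 := norm_sub_le (a + (1 : ℝ) • b) (a + (-1 : ℝ) • b)
    constructor
    · rw [e1, norm_smul]; norm_num at k1 ⊢; norm_num at h1 h2; linarith
    · rw [e2, norm_smul]; norm_num at k2 ⊢; norm_num at h1 h2; linarith
  obtain ⟨k1, k10, hk1⟩ := first_der h hL hO hK hu hp (e := 1) (by norm_num)
  obtain ⟨k2, k20, hk2⟩ := first_der h hL hO hK hu hp (e := -1) (by norm_num)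
  have hAB := fun x t h1 h2 h3 => half _ _ _ _ (hk1 x t h1 h2 h3) (hk2 x t h1 h2 h3)
  simp only [← add_mul] at hAB
  have hB := fun x t h1 h2 h3 => (hAB x t h1 h2 h3).2
  obtain ⟨k3, k30, hk3⟩ := second_der h hL hO hK hu hp (by positivity) hB (e := 1) (by norm_num)
  obtain ⟨k4, k40, hk4⟩ := second_der h hL hO hK hu hp (by positivity) hB (e := -1) (by norm_num)
  have hCG := fun x t h1 h2 h3 => half _ _ _ _ (hk3 x t h1 h2 h3) (hk4 x t h1 h2 h3)
  simp only [← add_mul] at hCG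
  refine ⟨K + (k1 + k2) + (k3 + k4), by positivity, ?_⟩
  intro x t h1 h2 h3
  have nn : ∀ a : ℝ, 0 ≤ (-t) ^ a := fun a => Real.rpow_nonneg (by linarith) _
  obtain ⟨b1, b2⟩ := hAB x t h1 h2 h3.le
  obtain ⟨b3, b4⟩ := hCG x t h1 h2 h3
  have b0 := hu x t h1 h2 h3.le
  exact ⟨b0.trans (mul_le_mul_of_nonneg_right (by linarith) (nn _)),
    b1.trans (mul_le_mul_of_nonneg_right (by linarith) (nn _)),
    b2.trans (mul_le_mul_of_nonneg_right (by linarith) (nn _)),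
    b3.trans (mul_le_mul_of_nonneg_right (by linarith) (nn _)),
    b4.trans (mul_le_mul_of_nonneg_right (by linarith) (nn _))⟩

end PartNine

section PartTen
variable {V : Type*} [NormedAddCommGroup V] [InnerProductSpace ℝ V] {p : ℝ}

theorem barbalat {F : Type*} [NormedAddCommGroup F] [NormedSpace ℝ F] {f g : ℝ → F} {c : F} {Λ : ℝ}
    (hf : ∀ s, 0 ≤ s → HasDerivAt f (g s) s) (hΛ : 0 ≤ Λ)
    (hg : ∀ s s', 0 ≤ s → s ≤ s' → ‖g s' - g s‖ ≤ Λ * (s' - s))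
    (hlim : Tendsto f atTop (nhds c)) : Tendsto g atTop (nhds 0) := by
  rw [Metric.tendsto_atTop]
  intro ε hε
  set η := ε / (2 * (Λ + 1)) with hη
  have η0 : 0 < η := by positivity
  have h1 := (hlim.comp (tendsto_atTop_add_const_right _ η tendsto_id)).sub hlim
  rw [sub_self, Metric.tendsto_atTop] at h1
  obtain ⟨N, hN⟩ := h1 (η * (ε / 2)) (by positivity)
  refine ⟨max N 0, fun s hs => ?_⟩
  have hs0 : 0 ≤ s := (le_max_right _ _).trans hs
  have h2 := hN s ((le_max_left _ _).trans hs)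
  simp only [dist_zero_right, Function.comp, id] at h2 ⊢
  have h3 := (convex_Icc s (s + η)).norm_image_sub_le_of_norm_hasDerivWithin_le
    (f := fun r => f r - r • g s) (f' := fun r => g r - g s) (C := Λ * η) (x := s) (y := s + η)
    (fun r hr => by
      have := (hf r (hs0.trans hr.1)).sub ((hasDerivAt_id r).smul_const (g s))
      exact (this.congr_deriv (by simp)).hasDerivWithinAt)
    (fun r hr => (hg s r hs0 hr.1).trans (mul_le_mul_of_nonneg_left (by linarith [hr.2]) hΛ))
    (left_mem_Icc.2 (by linarith)) (right_mem_Icc.2 (by linarith))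
  rw [add_sub_cancel_left, Real.norm_of_nonneg η0.le] at h3
  have e : η • g s = (f (s + η) - f s) - ((f (s + η) - (s + η) • g s) - (f s - s • g s)) := by module
  have h4 : η * ‖g s‖ ≤ ‖f (s + η) - f s‖ + Λ * η * η := by
    rw [← Real.norm_of_nonneg η0.le, ← norm_smul, e, Real.norm_of_nonneg η0.le]
    exact (norm_sub_le _ _).trans (by gcongr)
  have h5 : η * ‖g s‖ < η * (ε / 2 + Λ * η) := by nlinarith
  have h6 := lt_of_mul_lt_mul_left h5 η0.le
  have h7 : (Λ + 1) * η = ε / 2 := by rw [hη]; field_simp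
  linarith

theorem arz {F : Type*} [NormedAddCommGroup F] [ProperSpace F] (f : ℕ → ℝ → F)
    {K : ℝ} (hb : ∀ n, ∀ y ∈ Icc (-1 : ℝ) 1, ‖f n y‖ ≤ K)
    (hl : ∀ n, ∀ y ∈ Icc (-1 : ℝ) 1, ∀ y' ∈ Icc (-1 : ℝ) 1, ‖f n y - f n y'‖ ≤ K * |y - y'|) :
    ∃ φ : ℕ → ℕ, StrictMono φ ∧ ∃ g : ℝ → F, ContinuousOn g (Icc (-1) 1) ∧
      TendstoUniformlyOn (fun n => f (φ n)) g atTop (Icc (-1) 1) := by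
  have K0 : 0 ≤ K := (norm_nonneg _).trans (hb 0 0 (by norm_num))
  have hL : ∀ n, LipschitzWith K.toNNReal (fun y : Icc (-1 : ℝ) 1 => f n y) := by
    intro n
    refine LipschitzWith.of_dist_le_mul fun y y' => ?_
    rw [dist_eq_norm, Real.coe_toNNReal _ K0]
    exact hl n y y.2 y' y'.2
  let F' : ℕ → BoundedContinuousFunction (Icc (-1 : ℝ) 1) F := fun n =>
    BoundedContinuousFunction.mkOfCompact ⟨fun y => f n y, (hL n).continuous⟩
  have hcomp := BoundedContinuousFunction.arzela_ascoli (Metric.closedBall (0 : F) K)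
    (isCompact_closedBall _ _) (Set.range F') (by
      rintro g y ⟨n, rfl⟩
      simpa [F'] using hb n y y.2) (by
      refine UniformEquicontinuous.equicontinuous ?_
      refine (LipschitzWith.uniformEquicontinuous _ K.toNNReal ?_)
      rintro ⟨g, n, rfl⟩
      exact hL n)
  obtain ⟨g, -, φ, hφ, hlim⟩ := hcomp.tendsto_subseq (x := F') (fun n => subset_closure ⟨n, rfl⟩)
  refine ⟨φ, hφ, fun y => g (projIcc (-1) 1 (by norm_num) y), ?_, ?_⟩
  · exact (g.continuous.comp continuous_projIcc).continuousOn
  · rw [BoundedContinuousFunction.tendsto_iff_tendstoUniformly] at hlim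
    rw [Metric.tendstoUniformlyOn_iff]
    rw [Metric.tendstoUniformly_iff] at hlim
    intro ε hε
    filter_upwards [hlim ε hε] with n hn y hy
    have := hn ⟨y, hy⟩
    rw [projIcc_of_mem _ hy]
    exact this

theorem int_lim {F : Type*} [NormedAddCommGroup F] [NormedSpace ℝ F] {k : ℝ → ℝ} {a b K : ℝ}
    (hab : a ≤ b) (hk : IntervalIntegrable k volume a b) {g : ℕ → ℝ → F} {gl : ℝ → F}
    (cg : ∀ n, ContinuousOn (g n) (Icc a b)) (hb : ∀ n, ∀ y ∈ Icc a b, ‖g n y‖ ≤ K)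
    (hl : ∀ y ∈ Icc a b, Tendsto (fun n => g n y) atTop (nhds (gl y))) :
    Tendsto (fun n => ∫ y in a..b, k y • g n y) atTop (nhds (∫ y in a..b, k y • gl y)) := by
  have sub : uIoc a b ⊆ Icc a b := by rw [uIoc_of_le hab]; exact Ioc_subset_Icc_self
  refine intervalIntegral.tendsto_integral_filter_of_dominated_convergence (fun y => ‖k y‖ * K)
    (Eventually.of_forall fun n => ?_) (Eventually.of_forall fun n => ?_) (hk.norm.mul_const K) ?_
  · refine AEStronglyMeasurable.smul hk.def'.aestronglyMeasurable ?_
    exact ((cg n).mono sub).aestronglyMeasurable measurableSet_uIoc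
  · refine Eventually.of_forall fun y hy => ?_
    rw [norm_smul]
    exact mul_le_mul_of_nonneg_left (hb n y (sub hy)) (norm_nonneg _)
  · refine Eventually.of_forall fun y hy => ?_
    exact (hl y (sub hy)).const_smul _

structure WB (p : ℝ) (w v z vy zy : ℝ → ℝ → V) (K : ℝ) : Prop where
  sys : WSys p (Icc (-1) 1 ×ˢ Ioi (-1)) w v z vy zy
  bw : ∀ y ∈ Icc (-1 : ℝ) 1, ∀ s, 0 ≤ s → ‖w y s‖ ≤ K
  bv : ∀ y ∈ Icc (-1 : ℝ) 1, ∀ s, 0 ≤ s → ‖v y s‖ ≤ K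
  bz : ∀ y ∈ Icc (-1 : ℝ) 1, ∀ s, 0 ≤ s → ‖z y s‖ ≤ K
  bvy : ∀ y ∈ Icc (-1 : ℝ) 1, ∀ s, 0 ≤ s → ‖vy y s‖ ≤ K
  bzy : ∀ y ∈ Icc (-1 : ℝ) 1, ∀ s, 0 ≤ s → ‖zy y s‖ ≤ K

variable {w v z vy zy : ℝ → ℝ → V} {K : ℝ}

theorem lipS {F : Type*} [NormedAddCommGroup F] [NormedSpace ℝ F] {g g' : ℝ → F} {K a b : ℝ}
    (hd : ∀ s ∈ Icc a b, HasDerivAt g (g' s) s) (hb : ∀ s ∈ Icc a b, ‖g' s‖ ≤ K)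
    {r r' : ℝ} (h1 : r ∈ Icc a b) (h2 : r' ∈ Icc a b) : ‖g r' - g r‖ ≤ K * |r' - r| :=
  (convex_Icc a b).norm_image_sub_le_of_norm_hasDerivWithin_le
    (fun s hs => (hd s hs).hasDerivWithinAt) hb h1 h2

theorem WB.vsb (hp : 1 < p) (h : WB p w v z vy zy K) : ∃ K2, 0 ≤ K2 ∧ K ≤ K2 ∧ ∀ y ∈ Icc (-1 : ℝ) 1,
    ∀ s, 0 ≤ s → ‖(1 - y ^ 2) • zy y s - (2 * (al p + 1) * y) • z y s - (al p * (al p + 1)) • w y s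
      + nl p (w y s) - (2 * al p + 1) • v y s - (2 * y) • vy y s‖ ≤ K2 := by
  have ha := al_pos hp
  have K0 : 0 ≤ K := (norm_nonneg _).trans (h.bw 0 (by norm_num) 0 le_rfl)
  refine ⟨K + 2 * (al p + 1) * K + al p * (al p + 1) * K + K ^ p + (2 * al p + 1) * K + 2 * K,
    by positivity, ?_, ?_⟩
  · have : 0 ≤ 2 * (al p + 1) * K + al p * (al p + 1) * K + K ^ p + (2 * al p + 1) * K + 2 * K := by
      positivity
    linarith
  intro y hy s hs
  have y1 : |y| ≤ 1 := abs_le.2 hy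
  have y2 : |1 - y ^ 2| ≤ 1 := by rw [abs_le]; constructor <;> nlinarith [hy.1, hy.2]
  have e1 : ‖(1 - y ^ 2) • zy y s‖ ≤ K := by
    rw [norm_smul, Real.norm_eq_abs]
    exact (mul_le_of_le_one_left (norm_nonneg _) y2).trans (h.bzy y hy s hs)
  have e2 : ‖(2 * (al p + 1) * y) • z y s‖ ≤ 2 * (al p + 1) * K := by
    rw [norm_smul, Real.norm_eq_abs, abs_mul, abs_of_pos (by positivity)]
    exact mul_le_mul (mul_le_of_le_one_right (by positivity) y1) (h.bz y hy s hs) (norm_nonneg _)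
      (by positivity)
  have e3 : ‖(al p * (al p + 1)) • w y s‖ ≤ al p * (al p + 1) * K := by
    rw [norm_smul, Real.norm_eq_abs, abs_of_pos (by positivity)]
    exact mul_le_mul_of_nonneg_left (h.bw y hy s hs) (by positivity)
  have e4 : ‖nl p (w y s)‖ ≤ K ^ p := by
    rw [norm_nl hp]; exact Real.rpow_le_rpow (norm_nonneg _) (h.bw y hy s hs) (by linarith)
  have e5 : ‖(2 * al p + 1) • v y s‖ ≤ (2 * al p + 1) * K := by
    rw [norm_smul, Real.norm_eq_abs, abs_of_pos (by positivity)]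
    exact mul_le_mul_of_nonneg_left (h.bv y hy s hs) (by positivity)
  have e6 : ‖(2 * y) • vy y s‖ ≤ 2 * K := by
    rw [norm_smul, Real.norm_eq_abs, abs_mul, abs_two]
    exact mul_le_mul (by linarith) (h.bvy y hy s hs) (norm_nonneg _) (by positivity)
  refine (norm_sub_le _ _).trans (add_le_add ?_ e6)
  refine (norm_sub_le _ _).trans (add_le_add ?_ e5)
  refine (norm_add_le _ _).trans (add_le_add ?_ e4)
  refine (norm_sub_le _ _).trans (add_le_add ?_ e3)
  exact (norm_sub_le _ _).trans (add_le_add e1 e2)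

theorem WB.lip_v (hp : 1 < p) (h : WB p w v z vy zy K) : ∃ K2, 0 ≤ K2 ∧ K ≤ K2 ∧ ∀ y ∈ Icc (-1 : ℝ) 1,
    ∀ s s', 0 ≤ s → s ≤ s' → ‖v y s' - v y s‖ ≤ K2 * (s' - s) := by
  obtain ⟨K2, k0, k1, hb⟩ := h.vsb hp
  refine ⟨K2, k0, k1, fun y hy s s' hs hss => ?_⟩
  have := lipS (fun r hr => h.sys.vs y r ⟨hy, lt_of_lt_of_le (by norm_num) (hs.trans hr.1)⟩)
    (fun r hr => hb y hy r (hs.trans hr.1)) (left_mem_Icc.2 hss) (right_mem_Icc.2 hss)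
  rwa [abs_of_nonneg (by linarith)] at this

end PartTen

section PartEleven
variable {V : Type*} [NormedAddCommGroup V] [InnerProductSpace ℝ V] {p : ℝ}
variable {w v z vy zy : ℝ → ℝ → V} {K : ℝ}

theorem memJ {s : ℝ} (hs : 0 ≤ s) : s ∈ Ioi (-1 : ℝ) := lt_of_lt_of_le (by norm_num) hs

theorem WB.fE_lim (hp : 1 < p) (h : WB p w v z vy zy K) :
    ∃ e, Tendsto (fE p w v z) atTop (nhds e) := by
  have ha := al_pos hp
  have K0 : 0 ≤ K := (norm_nonneg _).trans (h.bw 0 (by norm_num) 0 le_rfl)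
  have lb : ∀ s, 0 ≤ s → -(1 / (p + 1) * (K ^ (p + 1) * II p (fun _ => 1))) ≤ fE p w v z s := by
    intro s hs
    rw [fE_split hp h.sys (memJ hs)]
    have n1 : fN p w s ≤ K ^ (p + 1) * II p (fun _ => 1) := by
      rw [← II_mul]; unfold fN
      have c1 := WSys.slice h.sys.cw (memJ hs)
      have c2 := cont_pow hp c1
      refine II_mono hp (ContinuousOn.mul (by fun_prop) c2) (by fun_prop) fun y hy => ?_
      have h1 : 1 - y ^ 2 ≤ 1 := by nlinarith [sq_nonneg y]
      rw [mul_one]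
      refine (mul_le_of_le_one_left (by positivity) h1).trans ?_
      exact Real.rpow_le_rpow (norm_nonneg _) (h.bw y hy s hs) (by linarith)
    have n2 := mul_le_mul_of_nonneg_left n1 (by positivity : 0 ≤ 1 / (p + 1))
    have n3 : 0 ≤ fM p v s := fM_nonneg
    have n4 : 0 ≤ fZ p z s := fZ_nonneg
    have n5 : 0 ≤ al p * (al p + 1) / 2 * fM p w s := mul_nonneg (by positivity) fM_nonneg
    linarith
  have anti : Antitone (fun s => fE p w v z (max s 0)) := by
    intro a b hab
    have h1 : max a 0 ≤ max b 0 := max_le_max_right 0 hab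
    exact fE_anti hp isOpen_Ioi h.sys (fun s hs => memJ ((le_max_right a 0).trans hs.1))
      (left_mem_Icc.2 h1) (right_mem_Icc.2 h1) h1
  have := tendsto_atTop_ciInf anti ⟨_, by
    rintro _ ⟨s, rfl⟩; exact lb _ (le_max_right _ _)⟩
  refine ⟨_, this.congr' ?_⟩
  filter_upwards [eventually_ge_atTop 0] with s hs
  simp [max_eq_left hs]

theorem WB.fD_lim (hp : 1 < p) (h : WB p w v z vy zy K) :
    Tendsto (fD p v) atTop (nhds 0) := by
  have ha := al_pos hp
  have K0 : 0 ≤ K := (norm_nonneg _).trans (h.bw 0 (by norm_num) 0 le_rfl)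
  obtain ⟨e, he⟩ := h.fE_lim hp
  obtain ⟨K2, K20, -, hl⟩ := h.lip_v hp
  have I0 : 0 ≤ II p (fun _ => 1) := II_one_nonneg
  have ptw : ∀ y ∈ Icc (-1 : ℝ) 1, ∀ s s', 0 ≤ s → 0 ≤ s' → ‖v y s' - v y s‖ ≤ K2 * |s' - s| →
      ‖v y s'‖ ^ 2 ≤ ‖v y s‖ ^ 2 + 2 * K * K2 * |s' - s| := by
    intro y hy s s' hs hs' hd
    have h1 := norm_sub_norm_le (v y s') (v y s)
    have h2 := h.bv y hy s hs
    have h3 := h.bv y hy s' hs'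
    have h4 : (‖v y s'‖ - ‖v y s‖) * (‖v y s'‖ + ‖v y s‖) ≤ K2 * |s' - s| * (2 * K) :=
      mul_le_mul (h1.trans hd) (by linarith) (by positivity) (by positivity)
    linarith
  have one : ∀ s s', 0 ≤ s → 0 ≤ s' → (∀ y ∈ Icc (-1 : ℝ) 1, ‖v y s' - v y s‖ ≤ K2 * |s' - s|) →
      fD p v s' ≤ fD p v s + 2 * K * K2 * |s' - s| * II p (fun _ => 1) := by
    intro s s' hs hs' hd
    have c1 : ContinuousOn (fun y => ‖v y s‖ ^ 2) (Icc (-1) 1) :=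
      (WSys.slice h.sys.cv (memJ hs)).norm.pow 2
    have c2 : ContinuousOn (fun y => ‖v y s'‖ ^ 2) (Icc (-1) 1) :=
      (WSys.slice h.sys.cv (memJ hs')).norm.pow 2
    rw [← II_mul]; unfold fD
    rw [← II_add hp c1 (by fun_prop)]
    refine II_mono hp c2 (c1.add (by fun_prop)) fun y hy => ?_
    rw [mul_one]; exact ptw y hy s s' hs hs' (hd y hy)
  have := barbalat (f := fE p w v z) (g := fun s => -2 * al p * fD p v s) (c := e)
    (Λ := 2 * al p * (2 * K * K2 * II p (fun _ => 1)))
    (fun s hs => fE_deriv hp isOpen_Ioi h.sys (memJ hs)) (by positivity) ?_ he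
  · have h2 := this.const_mul (-1 / (2 * al p))
    rw [mul_zero] at h2
    refine h2.congr fun s => ?_
    field_simp
  · intro s s' hs hss
    have hs' := hs.trans hss
    have a1 := one s s' hs hs' (fun y hy => by
      rw [abs_of_nonneg (by linarith)]; exact hl y hy s s' hs hss)
    have a2 := one s' s hs' hs (fun y hy => by
      rw [abs_sub_comm, abs_of_nonneg (by linarith), norm_sub_rev]; exact hl y hy s s' hs hss)
    rw [abs_sub_comm] at a2
    rw [abs_of_nonneg (by linarith)] at a1 a2
    rw [Real.norm_eq_abs, ← mul_sub, abs_mul]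
    have : |(-2 * al p)| = 2 * al p := by rw [neg_mul, abs_neg, abs_of_pos (by positivity)]
    rw [this, mul_assoc (2 * al p)]
    refine mul_le_mul_of_nonneg_left ?_ (by positivity)
    rw [abs_le]; constructor <;> linarith

variable [FiniteDimensional ℝ V]

theorem WB.sub (hp : 1 < p) (h : WB p w v z vy zy K) {σ : ℕ → ℝ} (hσ : Tendsto σ atTop atTop) :
    ∃ φ : ℕ → ℕ, StrictMono φ ∧ ∃ W Z : ℝ → V, ContinuousOn W (Icc (-1) 1) ∧
      ContinuousOn Z (Icc (-1) 1) ∧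
      TendstoUniformlyOn (fun n y => w y (σ (φ n))) W atTop (Icc (-1) 1) ∧
      TendstoUniformlyOn (fun n y => z y (σ (φ n))) Z atTop (Icc (-1) 1) ∧
      TendstoUniformlyOn (fun n y => v y (σ (φ n))) (fun _ => 0) atTop (Icc (-1) 1) := by
  haveI : ProperSpace V := FiniteDimensional.proper_real V
  set τ : ℕ → ℝ := fun n => max (σ n) 0 with hτ
  have τ0 : ∀ n, 0 ≤ τ n := fun n => le_max_right _ _
  have eqv : ∀ᶠ n in atTop, τ n = σ n := by
    filter_upwards [hσ.eventually_ge_atTop 0] with n hn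
    exact max_eq_left hn
  have hτ' : Tendsto τ atTop atTop := hσ.congr' (eqv.mono fun n hn => hn.symm)
  obtain ⟨φ, hφ, g, cg, hg⟩ := arz (F := V × V × V)
    (fun n y => (w y (τ n), z y (τ n), v y (τ n))) (K := K)
    (fun n y hy => by
      simp only [Prod.norm_mk, sup_le_iff]
      exact ⟨h.bw y hy _ (τ0 n), h.bz y hy _ (τ0 n), h.bv y hy _ (τ0 n)⟩)
    (fun n y hy y' hy' => by
      have m := memJ (τ0 n)
      simp only [Prod.mk_sub_mk, Prod.norm_mk, sup_le_iff]
      exact ⟨lipS (fun r hr => h.sys.wy r _ ⟨hr, m⟩) (fun r hr => h.bz r hr _ (τ0 n)) hy' hy,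
        lipS (fun r hr => h.sys.dzy r _ ⟨hr, m⟩) (fun r hr => h.bzy r hr _ (τ0 n)) hy' hy,
        lipS (fun r hr => h.sys.dvy r _ ⟨hr, m⟩) (fun r hr => h.bvy r hr _ (τ0 n)) hy' hy⟩)
  have eqv' : ∀ᶠ n in atTop, τ (φ n) = σ (φ n) := hφ.tendsto_atTop.eventually eqv
  have pr : ∀ (f : V × V × V → V), (∀ a b, dist (f a) (f b) ≤ dist a b) →
      TendstoUniformlyOn (fun n y => f (w y (σ (φ n)), z y (σ (φ n)), v y (σ (φ n))))
        (fun y => f (g y)) atTop (Icc (-1) 1) := by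
    intro f hf
    rw [Metric.tendstoUniformlyOn_iff] at hg ⊢
    intro ε hε
    filter_upwards [hg ε hε, eqv'] with n hn e y hy
    have := hn y hy
    rw [e] at this
    exact (hf _ _).trans_lt this
  have p1 := pr (fun q => q.1) (fun a b => le_max_left _ _)
  have p2 := pr (fun q => q.2.1) (fun a b => (le_max_left _ _).trans (le_max_right _ _))
  have p3 := pr (fun q => q.2.2) (fun a b => (le_max_right _ _).trans (le_max_right _ _))
  refine ⟨φ, hφ, fun y => (g y).1, fun y => (g y).2.1, cg.fst, cg.snd.fst, p1, p2, ?_⟩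
  have c3 : ContinuousOn (fun y => (g y).2.2) (Icc (-1) 1) := cg.snd.snd
  have l1 : Tendsto (fun n => fD p v (τ (φ n))) atTop
      (nhds (II p (fun y => ‖(g y).2.2‖ ^ 2))) := by
    refine int_lim (K := K ^ 2) (by norm_num) (sig_int hp)
      (fun n => (WSys.slice h.sys.cv (memJ (τ0 _))).norm.pow 2) (fun n y hy => ?_) (fun y hy => ?_)
    · rw [Real.norm_of_nonneg (by positivity)]
      exact pow_le_pow_left₀ (norm_nonneg _) (h.bv y hy _ (τ0 _)) 2
    · refine ((p3.tendsto_at hy).congr' ?_).norm.pow 2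
      filter_upwards [eqv'] with n hn
      rw [hn]
  have l2 := tendsto_nhds_unique l1 (((h.fD_lim hp).comp hτ').comp hφ.tendsto_atTop)
  have l3 : ∀ y ∈ Icc (-1 : ℝ) 1, (g y).2.2 = 0 := by
    have c4 : ContinuousOn (fun y => ‖(g y).2.2‖ ^ 2) (Icc (-1) 1) := c3.norm.pow 2
    unfold II at l2
    rw [intervalIntegral.integral_eq_zero_iff_of_nonneg_ae ?_ (II_int hp c4)] at l2
    · rw [Ioc_eq_empty (by norm_num : ¬ (1 : ℝ) < -1), union_empty] at l2
      have l4 : (fun y => (g y).2.2) =ᵐ[volume.restrict (Icc (-1 : ℝ) 1)] (fun _ => 0) := by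
        rw [← restrict_Ioo_eq_restrict_Icc]
        rw [← restrict_Ioo_eq_restrict_Ioc] at l2
        filter_upwards [l2, ae_restrict_mem measurableSet_Ioo] with y hy hm
        have : 0 < sig p y := Real.rpow_pos_of_pos (by nlinarith [hm.1, hm.2]) _
        have h5 : ‖(g y).2.2‖ ^ 2 = 0 := (mul_eq_zero.1 hy).resolve_left this.ne'
        simpa using h5
      exact Measure.eqOn_Icc_of_ae_eq volume (by norm_num) l4 c3 continuousOn_const
    · rw [Ioc_eq_empty (by norm_num : ¬ (1 : ℝ) < -1), union_empty]
      filter_upwards [ae_restrict_mem measurableSet_Ioc] with y hy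
      exact mul_nonneg (sig_nonneg (Ioc_subset_Icc_self hy)) (by positivity)
  exact p3.congr_right (fun y hy => l3 y hy)

end PartEleven

section PartTwelve
variable {V : Type*} [NormedAddCommGroup V] [InnerProductSpace ℝ V] {p : ℝ}
variable {w v z vy zy : ℝ → ℝ → V} {K : ℝ}

/-- right-hand side density -/
noncomputable def fR (p : ℝ) (w v z : ℝ → ℝ → V) (y s : ℝ) : V :=
  (2 * al p * y) • z y s + (al p * (al p + 1)) • w y s - nl p (w y s) + (2 * al p - 1) • v y s

theorem fR_cont (hp : 1 < p) {S : Set (ℝ × ℝ)} (h : WSys p S w v z vy zy) :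
    ContinuousOn (fun q : ℝ × ℝ => fR p w v z q.1 q.2) S := by
  have c1 := h.cw; have c2 := h.cv; have c3 := h.cz
  have c4 := (continuous_nl (V := V) hp).comp_continuousOn c1
  unfold fR
  refine ((ContinuousOn.add ?_ ?_).sub c4).add ?_
  · exact ContinuousOn.smul (by fun_prop) c3
  · exact c1.const_smul _
  · exact c2.const_smul _

theorem WB.ode_deriv [CompleteSpace V] (hp : 1 < p) (h : WB p w v z vy zy K) {Y : ℝ} (hY : Y ∈ Icc (-1 : ℝ) 1)
    {s : ℝ} (hs : 0 ≤ s) : HasDerivAt (fun s => ∫ y in (-1)..Y, (1 : ℝ) • v y s)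
      ((1 - Y ^ 2) • z Y s - (2 * Y) • v Y s - (2 : ℝ) • v (-1) s - ∫ y in (-1)..Y, (1:ℝ) • fR p w v z y s) s := by
  have sub : Icc (-1) Y ⊆ Icc (-1 : ℝ) 1 := Icc_subset_Icc_right hY.2
  have sub2 : Icc (-1) Y ×ˢ Ioi (-1 : ℝ) ⊆ Icc (-1 : ℝ) 1 ×ˢ Ioi (-1 : ℝ) := prod_mono_left sub
  have cnl := (continuous_nl (V := V) hp).comp_continuousOn h.sys.cw
  have cvs : ContinuousOn (fun q : ℝ × ℝ => (1 - q.1 ^ 2) • zy q.1 q.2 - (2 * (al p + 1) * q.1) • z q.1 q.2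
      - (al p * (al p + 1)) • w q.1 q.2
      + nl p (w q.1 q.2) - (2 * al p + 1) • v q.1 q.2 - (2 * q.1) • vy q.1 q.2)
      (Icc (-1 : ℝ) 1 ×ˢ Ioi (-1 : ℝ)) := by
    refine (((((ContinuousOn.smul (by fun_prop) h.sys.czy).sub
      (ContinuousOn.smul (by fun_prop) h.sys.cz)).sub (h.sys.cw.const_smul _)).add cnl).sub
      (h.sys.cv.const_smul _)).sub (ContinuousOn.smul (by fun_prop) h.sys.cvy)
  have key := hasDerivAt_int (k := fun _ => 1) (g := v) hY.1 (isOpen_Ioi (a := (-1 : ℝ)))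
    (by simp) (fun y hy s hs => h.sys.vs y s ⟨sub hy, hs⟩) (h.sys.cv.mono sub2) (cvs.mono sub2) (memJ hs)
  refine key.congr_deriv ?_
  have m := memJ hs
  have d : ∀ y ∈ uIcc (-1) Y, HasDerivAt (fun y => (1 - y ^ 2) • z y s - (2 * y) • v y s)
      (((1 - y ^ 2) • zy y s - (2 * (al p + 1) * y) • z y s
      - (al p * (al p + 1)) • w y s
      + nl p (w y s) - (2 * al p + 1) • v y s - (2 * y) • vy y s) + fR p w v z y s) y := by
    intro y hy
    rw [uIcc_of_le hY.1] at hy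
    have hy := sub hy
    have d1 : HasDerivAt (fun y : ℝ => 1 - y ^ 2) (-(2 * y)) y := by
      simpa using ((hasDerivAt_id y).pow 2).const_sub 1
    have d2 : HasDerivAt (fun y : ℝ => 2 * y) 2 y := by simpa using (hasDerivAt_id y).const_mul 2
    refine ((d1.smul (h.sys.dzy y s ⟨hy, m⟩)).sub (d2.smul (h.sys.dvy y s ⟨hy, m⟩))).congr_deriv ?_
    unfold fR; module
  have cs := (WSys.slice (g := fun y s => (1 - y ^ 2) • zy y s - (2 * (al p + 1) * y) • z y s
      - (al p * (al p + 1)) • w y s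
      + nl p (w y s) - (2 * al p + 1) • v y s - (2 * y) • vy y s) cvs m).mono sub
  have cR := (WSys.slice (fR_cont hp h.sys) m).mono sub
  rw [← uIcc_of_le hY.1] at cs cR
  have e := intervalIntegral.integral_eq_sub_of_hasDerivAt d (cs.add cR).intervalIntegrable
  rw [intervalIntegral.integral_add cs.intervalIntegrable cR.intervalIntegrable] at e
  simp only [one_smul]
  rw [eq_sub_iff_add_eq, e]
  module

theorem WB.fR_lip (hp : 1 < p) (h : WB p w v z vy zy K) {K2 : ℝ} (K20 : 0 ≤ K2)
    (hl : ∀ y ∈ Icc (-1 : ℝ) 1, ∀ s s', 0 ≤ s → s ≤ s' → ‖v y s' - v y s‖ ≤ K2 * (s' - s)) :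
    ∃ Λ, 0 ≤ Λ ∧ ∀ y ∈ Icc (-1 : ℝ) 1, ∀ s s', 0 ≤ s → s ≤ s' →
      ‖fR p w v z y s' - fR p w v z y s‖ ≤ Λ * (s' - s) ∧ ‖z y s' - z y s‖ ≤ Λ * (s' - s) := by
  have ha := al_pos hp
  have K0 : 0 ≤ K := (norm_nonneg _).trans (h.bw 0 (by norm_num) 0 le_rfl)
  set Λ := 2 * al p * K + al p * (al p + 1) * K + p * K ^ (p - 1) * K + (2 * al p + 1) * K2 + K with hΛ
  have : 0 ≤ p * K ^ (p - 1) * K := by positivity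
  refine ⟨Λ, by positivity, fun y hy s s' hs hss => ?_⟩
  have hs' := hs.trans hss
  have d0 : 0 ≤ s' - s := by linarith
  have lz : ‖z y s' - z y s‖ ≤ K * (s' - s) := by
    have := lipS (a := s) (b := s') (fun r hr => h.sys.zs y r ⟨hy, memJ (hs.trans hr.1)⟩)
      (fun r hr => h.bvy y hy r (hs.trans hr.1)) (left_mem_Icc.2 hss) (right_mem_Icc.2 hss)
    rwa [abs_of_nonneg d0] at this
  have lw : ‖w y s' - w y s‖ ≤ K * (s' - s) := by
    have := lipS (a := s) (b := s') (fun r hr => h.sys.ws y r ⟨hy, memJ (hs.trans hr.1)⟩)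
      (fun r hr => h.bv y hy r (hs.trans hr.1)) (left_mem_Icc.2 hss) (right_mem_Icc.2 hss)
    rwa [abs_of_nonneg d0] at this
  have lv := hl y hy s s' hs hss
  have ln := (nl_lip hp (h.bw y hy s' hs') (h.bw y hy s hs)).trans
    (mul_le_mul_of_nonneg_left lw (by positivity))
  constructor
  · have e : fR p w v z y s' - fR p w v z y s = (2 * al p * y) • (z y s' - z y s)
        + (al p * (al p + 1)) • (w y s' - w y s) - (nl p (w y s') - nl p (w y s))
        + (2 * al p - 1) • (v y s' - v y s) := by unfold fR; module
    rw [e]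
    have n1 : ‖(2 * al p * y) • (z y s' - z y s)‖ ≤ 2 * al p * (K * (s' - s)) := by
      rw [norm_smul, Real.norm_eq_abs, abs_mul, abs_of_pos (by positivity)]
      refine mul_le_mul ?_ lz (norm_nonneg _) (by positivity)
      exact mul_le_of_le_one_right (by positivity) (abs_le.2 hy)
    have n2 : ‖(al p * (al p + 1)) • (w y s' - w y s)‖ ≤ al p * (al p + 1) * (K * (s' - s)) := by
      rw [norm_smul, Real.norm_eq_abs, abs_of_pos (by positivity)]
      exact mul_le_mul_of_nonneg_left lw (by positivity)
    have n3 : ‖(2 * al p - 1) • (v y s' - v y s)‖ ≤ (2 * al p + 1) * (K2 * (s' - s)) := by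
      rw [norm_smul, Real.norm_eq_abs]
      exact mul_le_mul (abs_le.2 ⟨by linarith, by linarith⟩) lv (norm_nonneg _) (by positivity)
    have t1 := norm_add_le ((2 * al p * y) • (z y s' - z y s)
        + (al p * (al p + 1)) • (w y s' - w y s) - (nl p (w y s') - nl p (w y s)))
        ((2 * al p - 1) • (v y s' - v y s))
    have t2 := norm_sub_le ((2 * al p * y) • (z y s' - z y s)
        + (al p * (al p + 1)) • (w y s' - w y s)) (nl p (w y s') - nl p (w y s))
    have t3 := norm_add_le ((2 * al p * y) • (z y s' - z y s))
        ((al p * (al p + 1)) • (w y s' - w y s))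
    have : Λ * (s' - s) = 2 * al p * (K * (s' - s)) + al p * (al p + 1) * (K * (s' - s))
      + p * K ^ (p - 1) * (K * (s' - s)) + (2 * al p + 1) * (K2 * (s' - s)) + K * (s' - s) := by
      rw [hΛ]; ring
    have := mul_nonneg K0 d0
    linarith
  · refine lz.trans (mul_le_mul_of_nonneg_right ?_ d0)
    rw [hΛ]
    have : 0 ≤ 2 * al p * K + al p * (al p + 1) * K + p * K ^ (p - 1) * K + (2 * al p + 1) * K2 := by positivity
    linarith

variable [FiniteDimensional ℝ V]

theorem WB.v_lim (hp : 1 < p) (h : WB p w v z vy zy K) {Y : ℝ} (hY : Y ∈ Icc (-1 : ℝ) 1) :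
    Tendsto (fun s => ∫ y in (-1)..Y, (1 : ℝ) • v y s) atTop (nhds 0) := by
  refine tendsto_of_subseq_tendsto fun σ hσ => ?_
  have hm : Tendsto (fun n => max (σ n) 0) atTop atTop :=
    tendsto_atTop_mono (fun n => le_max_left _ _) hσ
  obtain ⟨φ, hφ, W, Z, -, -, -, -, hv⟩ := h.sub hp hm
  refine ⟨φ, ?_⟩
  have sub : Icc (-1) Y ⊆ Icc (-1 : ℝ) 1 := Icc_subset_Icc_right hY.2
  have := int_lim (k := fun _ => 1) (K := K) (g := fun n y => v y (max (σ (φ n)) 0)) (gl := fun _ => 0) hY.1 (by simp)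
    (fun n => (WSys.slice h.sys.cv (memJ (le_max_right _ _))).mono sub)
    (fun n y hy => h.bv y (sub hy) _ (le_max_right _ _)) (fun y hy => hv.tendsto_at (sub hy))
  simp only [smul_zero, intervalIntegral.integral_zero] at this
  refine this.congr' ?_
  filter_upwards [(hσ.comp hφ.tendsto_atTop).eventually_ge_atTop 0] with n hn
  simp only [Function.comp] at hn
  rw [max_eq_left hn]

theorem WB.ode_lim (hp : 1 < p) (h : WB p w v z vy zy K) {Y : ℝ} (hY : Y ∈ Icc (-1 : ℝ) 1) :
    Tendsto (fun s => (1 - Y ^ 2) • z Y s - (2 * Y) • v Y s - (2 : ℝ) • v (-1) s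
      - ∫ y in (-1)..Y, (1:ℝ) • fR p w v z y s) atTop (nhds 0) := by
  obtain ⟨K2, K20, -, hl⟩ := h.lip_v hp
  obtain ⟨Λ, Λ0, hΛ⟩ := h.fR_lip hp K20 hl
  have sub : Icc (-1) Y ⊆ Icc (-1 : ℝ) 1 := Icc_subset_Icc_right hY.2
  refine barbalat (Λ := Λ + 2 * K2 + 2 * K2 + 2 * Λ) (fun s hs => h.ode_deriv hp hY hs) (by positivity) ?_ (h.v_lim hp hY)
  intro s s' hs hss
  have d0 : 0 ≤ s' - s := by linarith
  have hs' := hs.trans hss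
  have cR : ∀ r, 0 ≤ r → IntervalIntegrable (fun y => (1:ℝ) • fR p w v z y r) volume (-1) Y := by
    intro r hr
    have := (WSys.slice (fR_cont hp h.sys) (memJ hr)).mono sub
    rw [← uIcc_of_le hY.1] at this
    exact (this.const_smul (1:ℝ)).intervalIntegrable
  have i1 : ‖(∫ y in (-1)..Y, (1:ℝ) • fR p w v z y s') - ∫ y in (-1)..Y, (1:ℝ) • fR p w v z y s‖
      ≤ 2 * Λ * (s' - s) := by
    rw [← intervalIntegral.integral_sub (cR _ hs') (cR _ hs)]
    refine (intervalIntegral.norm_integral_le_of_norm_le_const (C := Λ * (s' - s)) ?_).trans ?_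
    · intro y hy
      rw [uIoc_of_le hY.1] at hy
      rw [one_smul, one_smul]
      exact (hΛ y (sub (Ioc_subset_Icc_self hy)) s s' hs hss).1
    · rw [abs_of_nonneg (by linarith [hY.1])]
      have : Λ * (s' - s) * (Y - -1) ≤ Λ * (s' - s) * 2 :=
        mul_le_mul_of_nonneg_left (by linarith [hY.2]) (by positivity)
      linarith
  have n1 : ‖(1 - Y ^ 2) • (z Y s' - z Y s)‖ ≤ Λ * (s' - s) := by
    rw [norm_smul, Real.norm_eq_abs]
    refine (mul_le_of_le_one_left (norm_nonneg _) ?_).trans (hΛ Y hY s s' hs hss).2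
    rw [abs_le]; constructor <;> nlinarith [hY.1, hY.2]
  have n2 : ‖(2 * Y) • (v Y s' - v Y s)‖ ≤ 2 * (K2 * (s' - s)) := by
    rw [norm_smul, Real.norm_eq_abs]
    refine mul_le_mul ?_ (hl Y hY s s' hs hss) (norm_nonneg _) (by norm_num)
    rw [abs_le]; constructor <;> linarith [hY.1, hY.2]
  have n3 : ‖(2 : ℝ) • (v (-1) s' - v (-1) s)‖ ≤ 2 * (K2 * (s' - s)) := by
    rw [norm_smul, Real.norm_eq_abs]
    exact mul_le_mul (by norm_num) (hl _ (by norm_num) s s' hs hss) (norm_nonneg _) (by norm_num)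
  have e : ∀ a b c a' b' c' d d' : V, a' - b' - c' - d' - (a - b - c - d) =
    (a' - a) - (b' - b) - (c' - c) - (d' - d) := by intros; abel
  rw [e, ← smul_sub, ← smul_sub, ← smul_sub]
  have t1 := norm_sub_le ((1 - Y ^ 2) • (z Y s' - z Y s) - (2 * Y) • (v Y s' - v Y s) - (2 : ℝ) • (v (-1) s' - v (-1) s))
    ((∫ y in (-1)..Y, (1:ℝ) • fR p w v z y s') - ∫ y in (-1)..Y, (1:ℝ) • fR p w v z y s)
  have t2 := norm_sub_le ((1 - Y ^ 2) • (z Y s' - z Y s) - (2 * Y) • (v Y s' - v Y s)) ((2 : ℝ) • (v (-1) s' - v (-1) s))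
  have t3 := norm_sub_le ((1 - Y ^ 2) • (z Y s' - z Y s)) ((2 * Y) • (v Y s' - v Y s))
  linarith

/-- stationary solution, regular up to the boundary -/
structure Stat (p : ℝ) (W Z : ℝ → V) : Prop where
  cW : ContinuousOn W (Icc (-1) 1)
  cZ : ContinuousOn Z (Icc (-1) 1)
  dW : ∀ y ∈ Ioo (-1 : ℝ) 1, HasDerivAt W (Z y) y
  dZ : ∀ y ∈ Ioo (-1 : ℝ) 1, HasDerivAt (fun y => (1 - y ^ 2) • Z y)
    ((2 * al p * y) • Z y + (al p * (al p + 1)) • W y - nl p (W y)) y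

theorem ftc_aux {g R : ℝ → V} (cR : ContinuousOn R (Icc (-1) 1)) {c : V}
    (hg : ∀ y ∈ Icc (-1 : ℝ) 1, g y = c + ∫ r in (-1)..y, R r) {y : ℝ} (hy : y ∈ Ioo (-1 : ℝ) 1) :
    HasDerivAt g (R y) y := by
  have nb : Icc (-1 : ℝ) 1 ∈ nhds y := Icc_mem_nhds hy.1 hy.2
  have h1 : IntervalIntegrable R volume (-1) y := by
    refine ContinuousOn.intervalIntegrable ?_
    rw [uIcc_of_le hy.1.le]
    exact cR.mono (Icc_subset_Icc_right hy.2.le)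
  have := (intervalIntegral.integral_hasDerivAt_right h1
    (cR.stronglyMeasurableAtFilter_nhdsWithin measurableSet_Icc y |>.filter_mono (by
      rw [nhdsWithin_eq_nhds.2 nb])) (cR.continuousAt nb)).const_add c
  refine this.congr_of_eventuallyEq ?_
  filter_upwards [nb] with r hr using hg r hr

theorem WB.stat (hp : 1 < p) (h : WB p w v z vy zy K) {σ : ℕ → ℝ} (hσ : Tendsto σ atTop atTop)
    {W Z : ℝ → V} (cW : ContinuousOn W (Icc (-1) 1)) (cZ : ContinuousOn Z (Icc (-1) 1))
    (hw : TendstoUniformlyOn (fun n y => w y (σ n)) W atTop (Icc (-1) 1))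
    (hz : TendstoUniformlyOn (fun n y => z y (σ n)) Z atTop (Icc (-1) 1))
    (hv : TendstoUniformlyOn (fun n y => v y (σ n)) (fun _ => 0) atTop (Icc (-1) 1)) :
    Stat p W Z := by
  have ha := al_pos hp
  have K0 : 0 ≤ K := (norm_nonneg _).trans (h.bw 0 (by norm_num) 0 le_rfl)
  wlog hσ0 : ∀ n, 0 ≤ σ n generalizing σ
  · obtain ⟨N, hN⟩ := (hσ.eventually_ge_atTop 0).exists_forall_of_atTop
    have ht : Tendsto (fun n => n + N) atTop atTop := tendsto_add_atTop_nat N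
    refine this (σ := fun n => σ (n + N)) (hσ.comp ht) ?_ ?_ ?_ (fun n => hN _ (by omega))
    · exact fun U hU => ht.eventually (hw U hU)
    · exact fun U hU => ht.eventually (hz U hU)
    · exact fun U hU => ht.eventually (hv U hU)
  have cnl := (continuous_nl (V := V) hp)
  have e1 : ∀ Y ∈ Icc (-1 : ℝ) 1, W Y = W (-1) + ∫ y in (-1)..Y, Z y := by
    intro Y hY
    have sub : Icc (-1) Y ⊆ Icc (-1 : ℝ) 1 := Icc_subset_Icc_right hY.2
    have l1 := int_lim (k := fun _ => 1) (K := K) (g := fun n y => z y (σ n)) (gl := Z) hY.1 (by simp)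
      (fun n => (WSys.slice h.sys.cz (memJ (hσ0 n))).mono sub)
      (fun n y hy => h.bz y (sub hy) _ (hσ0 n)) (fun y hy => hz.tendsto_at (sub hy))
    simp only [one_smul] at l1
    have l2 := ((hw.tendsto_at (x := (-1 : ℝ)) (by norm_num))).add l1
    refine tendsto_nhds_unique (hw.tendsto_at hY) (l2.congr fun n => ?_)
    have m := memJ (hσ0 n)
    have c := (WSys.slice h.sys.cz m).mono sub
    rw [← uIcc_of_le hY.1] at c
    have := intervalIntegral.integral_eq_sub_of_hasDerivAt (f := fun y => w y (σ n)) (a := -1) (b := Y)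
      (fun y hy => h.sys.wy y (σ n) ⟨sub (by rwa [uIcc_of_le hY.1] at hy), m⟩) c.intervalIntegrable
    rw [this]; abel
  set R : ℝ → V := fun y => (2 * al p * y) • Z y + (al p * (al p + 1)) • W y - nl p (W y) with hR
  have cR : ContinuousOn R (Icc (-1) 1) := by
    refine ((ContinuousOn.smul (by fun_prop) cZ).add (cW.const_smul _)).sub (cnl.comp_continuousOn cW)
  have e2 : ∀ Y ∈ Icc (-1 : ℝ) 1, (1 - Y ^ 2) • Z Y = 0 + ∫ y in (-1)..Y, R y := by
    intro Y hY
    have sub : Icc (-1) Y ⊆ Icc (-1 : ℝ) 1 := Icc_subset_Icc_right hY.2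
    have l1 := int_lim (k := fun _ => 1) (K := 2 * al p * K + al p * (al p + 1) * K + K ^ p + (2 * al p + 1) * K)
      (g := fun n y => fR p w v z y (σ n)) (gl := R) hY.1 (by simp)
      (fun n => (WSys.slice (fR_cont hp h.sys) (memJ (hσ0 n))).mono sub)
      (fun n y hy => by
        have n1 : ‖(2 * al p * y) • z y (σ n)‖ ≤ 2 * al p * K := by
          rw [norm_smul, Real.norm_eq_abs, abs_mul, abs_of_pos (by positivity)]
          refine mul_le_mul ?_ (h.bz y (sub hy) _ (hσ0 n)) (norm_nonneg _) (by positivity)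
          exact mul_le_of_le_one_right (by positivity) (abs_le.2 (sub hy))
        have n2 : ‖(al p * (al p + 1)) • w y (σ n)‖ ≤ al p * (al p + 1) * K := by
          rw [norm_smul, Real.norm_eq_abs, abs_of_pos (by positivity)]
          exact mul_le_mul_of_nonneg_left (h.bw y (sub hy) _ (hσ0 n)) (by positivity)
        have n3 : ‖(2 * al p - 1) • v y (σ n)‖ ≤ (2 * al p + 1) * K := by
          rw [norm_smul, Real.norm_eq_abs]
          exact mul_le_mul (abs_le.2 ⟨by linarith, by linarith⟩) (h.bv y (sub hy) _ (hσ0 n))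
            (norm_nonneg _) (by positivity)
        have n4 : ‖nl p (w y (σ n))‖ ≤ K ^ p := by
          rw [norm_nl hp]
          exact Real.rpow_le_rpow (norm_nonneg _) (h.bw y (sub hy) _ (hσ0 n)) (by linarith)
        unfold fR
        refine (norm_add_le _ _).trans (add_le_add ((norm_sub_le _ _).trans (add_le_add
          ((norm_add_le _ _).trans (add_le_add n1 n2)) n4)) n3))
      (fun y hy => by
        have q1 := hw.tendsto_at (sub hy)
        have q2 := hz.tendsto_at (sub hy)
        have q3 := hv.tendsto_at (sub hy)
        have := (((q2.const_smul (2 * al p * y)).add (q1.const_smul (al p * (al p + 1)))).sub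
          ((cnl.tendsto (W y)).comp q1)).add (q3.const_smul (2 * al p - 1))
        rw [smul_zero, add_zero] at this
        exact this)
    have l2 := (((hz.tendsto_at hY).const_smul (1 - Y ^ 2)).sub
      ((hv.tendsto_at hY).const_smul (2 * Y))).sub
      ((hv.tendsto_at (x := (-1 : ℝ)) (by norm_num)).const_smul (2 : ℝ))
    have l3 := tendsto_nhds_unique (l2.sub l1) ((h.ode_lim hp hY).comp hσ)
    simp only [smul_zero, sub_zero, one_smul] at l3
    rw [zero_add]; exact sub_eq_zero.1 l3
  exact ⟨cW, cZ, fun y hy => ftc_aux cZ e1 hy, fun y hy => ftc_aux cR e2 hy⟩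

end PartTwelve

section PartThirteen
variable {V : Type*} [NormedAddCommGroup V] [InnerProductSpace ℝ V] {p : ℝ}

omit [InnerProductSpace ℝ V] in
theorem bdd_Icc {g : ℝ → V} (hg : ContinuousOn g (Icc (-1) 1)) :
    ∃ M, 0 ≤ M ∧ ∀ y ∈ Icc (-1 : ℝ) 1, ‖g y‖ ≤ M := by
  obtain ⟨M, hM⟩ := isCompact_Icc.exists_bound_of_continuousOn hg
  exact ⟨M, (norm_nonneg _).trans (hM 0 (by norm_num)), hM⟩

theorem Stat.unique (hp : 1 < p) {W Z W' Z' : ℝ → V} (h : Stat p W Z) (h' : Stat p W' Z')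
    (e1 : W 0 = W' 0) (e2 : Z 0 = Z' 0) : EqOn W W' (Icc (-1) 1) ∧ EqOn Z Z' (Icc (-1) 1) := by
  have ha := al_pos hp
  obtain ⟨M1, hM1, b1⟩ := bdd_Icc h.cW
  obtain ⟨M2, hM2, b2⟩ := bdd_Icc h'.cW
  set M := max M1 M2
  have M0 : 0 ≤ M := hM1.trans (le_max_left _ _)
  have main : ∀ r, 0 < r → r < 1 → EqOn (fun y => (W y, (1 - y ^ 2) • Z y))
      (fun y => (W' y, (1 - y ^ 2) • Z' y)) (Ioo (-r) r) := by
    intro r hr0 hr1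
    have hq : 0 < 1 - r ^ 2 := by nlinarith
    set q := (1 - r ^ 2)⁻¹ with hq'
    have q0 : 0 < q := inv_pos.2 hq
    have tq : ∀ t ∈ Ioo (-r) r, 0 < 1 - t ^ 2 ∧ (1 - t ^ 2)⁻¹ ≤ q := by
      intro t ht
      have : t ^ 2 ≤ r ^ 2 := sq_le_sq' ht.1.le ht.2.le
      exact ⟨by linarith, inv_anti₀ hq (by linarith)⟩
    have sol : ∀ {W Z : ℝ → V}, Stat p W Z → (∀ y ∈ Icc (-1 : ℝ) 1, ‖W y‖ ≤ M) → ∀ t ∈ Ioo (-r) r,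
        HasDerivAt (fun y => (W y, (1 - y ^ 2) • Z y)) ((1 - t ^ 2)⁻¹ • ((1 - t ^ 2) • Z t),
          ((2 * al p * t) * (1 - t ^ 2)⁻¹) • ((1 - t ^ 2) • Z t)
            + (al p * (al p + 1)) • W t - nl p (W t)) t ∧
        (W t, (1 - t ^ 2) • Z t) ∈ {x : V × V | ‖x.1‖ ≤ M} := by
      intro W Z hs hb t ht
      have ht' : t ∈ Ioo (-1 : ℝ) 1 := ⟨by linarith [ht.1], by linarith [ht.2]⟩
      have n0 := (tq t ht).1.ne'
      refine ⟨?_, hb t (Ioo_subset_Icc_self ht')⟩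
      rw [smul_smul, smul_smul, inv_mul_cancel₀ n0, mul_assoc, inv_mul_cancel₀ n0, one_smul, mul_one]
      exact (hs.dW t ht').prodMk (hs.dZ t ht')
    refine ODE_solution_unique_of_mem_Ioo (t₀ := 0)
      (v := fun t x => ((1 - t ^ 2)⁻¹ • x.2, ((2 * al p * t) * (1 - t ^ 2)⁻¹) • x.2
            + (al p * (al p + 1)) • x.1 - nl p x.1)) (s := fun _ => {x : V × V | ‖x.1‖ ≤ M})
      (K := Real.toNNReal (q + 2 * al p * q + al p * (al p + 1) + p * M ^ (p - 1))) ?_ ⟨by linarith, hr0⟩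
      (sol h fun y hy => (b1 y hy).trans (le_max_left _ _))
      (sol h' fun y hy => (b2 y hy).trans (le_max_right _ _)) ?_
    · intro t ht
      have k0 : 0 ≤ q + 2 * al p * q + al p * (al p + 1) + p * M ^ (p - 1) := by positivity
      have c0 : 0 ≤ p * M ^ (p - 1) := by positivity
      refine LipschitzOnWith.of_dist_le_mul fun x hx y hy => ?_
      rw [Real.coe_toNNReal _ k0]
      obtain ⟨tp, tq⟩ := tq t ht
      have ti := inv_pos.2 tp
      rw [dist_eq_norm, dist_eq_norm]
      have f1 : ‖x.1 - y.1‖ ≤ ‖x - y‖ := norm_fst_le (x - y)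
      have f2 : ‖x.2 - y.2‖ ≤ ‖x - y‖ := norm_snd_le (x - y)
      have N0 := norm_nonneg (x - y)
      have n1 : ‖(1 - t ^ 2)⁻¹ • (x.2 - y.2)‖ ≤ q * ‖x - y‖ := by
        rw [norm_smul, Real.norm_of_nonneg ti.le]
        exact mul_le_mul tq f2 (norm_nonneg _) q0.le
      have n2 : ‖((2 * al p * t) * (1 - t ^ 2)⁻¹) • (x.2 - y.2)‖ ≤ 2 * al p * q * ‖x - y‖ := by
        rw [norm_smul, Real.norm_eq_abs, abs_mul, abs_mul, abs_of_pos ti, abs_of_pos (by positivity : 0 < 2 * al p)]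
        refine mul_le_mul (mul_le_mul ?_ tq ti.le (by positivity)) f2 (norm_nonneg _) (by positivity)
        exact mul_le_of_le_one_right (by positivity) (abs_le.2 ⟨by linarith [ht.1], by linarith [ht.2]⟩)
      have n3 : ‖(al p * (al p + 1)) • (x.1 - y.1)‖ ≤ al p * (al p + 1) * ‖x - y‖ := by
        rw [norm_smul, Real.norm_of_nonneg (by positivity)]
        exact mul_le_mul_of_nonneg_left f1 (by positivity)
      have n4 := (nl_lip hp hx hy).trans (mul_le_mul_of_nonneg_left f1 c0)
      rw [Prod.mk_sub_mk, Prod.norm_mk]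
      refine max_le ?_ ?_
      · rw [← smul_sub]
        refine n1.trans (mul_le_mul_of_nonneg_right ?_ N0)
        have : 0 ≤ 2 * al p * q + al p * (al p + 1) := by positivity
        linarith
      · have e : ∀ a b c a' b' c' : V, a + b - c - (a' + b' - c') = (a - a') + (b - b') - (c - c') := by
          intros; abel
        rw [e, ← smul_sub, ← smul_sub]
        refine ((norm_sub_le _ _).trans (add_le_add ((norm_add_le _ _).trans (add_le_add n2 n3)) n4)).trans ?_
        have : 0 ≤ q * ‖x - y‖ := by positivity
        linarith
    · simp [e1, e2]
  have inn : ∀ y ∈ Ioo (-1 : ℝ) 1, W y = W' y ∧ Z y = Z' y := by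
    intro y hy
    have h1 : |y| < 1 := abs_lt.2 hy
    have := main ((1 + |y|) / 2) (by positivity) (by linarith)
      (x := y) ⟨by linarith [neg_abs_le y], by linarith [le_abs_self y]⟩
    simp only [Prod.mk.injEq] at this
    have q0 : (1 - y ^ 2) ≠ 0 := by nlinarith [hy.1, hy.2]
    exact ⟨this.1, smul_right_injective V q0 this.2⟩
  have cl : closure (Ioo (-1 : ℝ) 1) = Icc (-1) 1 := closure_Ioo (by norm_num)
  constructor
  · exact Set.EqOn.of_subset_closure (fun y hy => (inn y hy).1) h.cW h'.cW Ioo_subset_Icc_self cl.ge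
  · exact Set.EqOn.of_subset_closure (fun y hy => (inn y hy).2) h.cZ h'.cZ Ioo_subset_Icc_self cl.ge

theorem rho_deriv (hp : 1 < p) {y : ℝ} (hy : y ∈ Ioo (-1 : ℝ) 1) :
    HasDerivAt (rho p) (-(2 * al p * y) * (rho p y / (1 - y ^ 2))) y := by
  have q0 : 0 < 1 - y ^ 2 := by nlinarith [hy.1, hy.2]
  have d1 : HasDerivAt (fun y : ℝ => 1 - y ^ 2) (-(2 * y)) y := by
    simpa using ((hasDerivAt_id y).pow 2).const_sub 1
  refine (d1.rpow_const (p := 2 / (p - 1)) (Or.inl q0.ne')).congr_deriv ?_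
  rw [Real.rpow_sub_one q0.ne']
  unfold rho al; ring

theorem rho_one (hp : 1 < p) : rho p 1 = 0 := by
  have := al_pos hp; unfold al at this
  simp [rho, Real.zero_rpow this.ne']

/-- a first integral weighted by `rho` vanishes at `0` -/
theorem first_int (hp : 1 < p) {g : ℝ → ℝ} (cg : ContinuousOn g (Icc (-1) 1))
    (dg : ∀ y ∈ Ioo (-1 : ℝ) 1, HasDerivAt g (2 * al p * y / (1 - y ^ 2) * g y) y) : g 0 = 0 := by
  have c : ContinuousOn (fun y => rho p y * g y) (Icc 0 1) :=
    ((continuous_rho hp).continuousOn.mul cg).mono (Icc_subset_Icc_left (by norm_num))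
  have := constant_of_has_deriv_right_zero c (fun y hy => by
    have hy' : y ∈ Ioo (-1 : ℝ) 1 := ⟨by linarith [hy.1], hy.2⟩
    refine (((rho_deriv hp hy').mul (dg y hy')).congr_deriv ?_).hasDerivWithinAt
    ring) 1 (by norm_num)
  simp only [rho_one hp, zero_mul] at this
  have r0 : rho p 0 = 1 := by simp [rho]
  rw [r0, one_mul] at this
  exact this.symm

theorem Stat.dU {W Z : ℝ → V} (h : Stat p W Z) {y : ℝ} (hy : y ∈ Ioo (-1 : ℝ) 1) :
    HasDerivAt (fun y => (1 - y ^ 2) • Z y - (al p * y) • W y)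
      ((al p * y / (1 - y ^ 2)) • ((1 - y ^ 2) • Z y - (al p * y) • W y)
        + (al p ^ 2 / (1 - y ^ 2)) • W y - nl p (W y)) y := by
  have q0 : (1 - y ^ 2) ≠ 0 := by nlinarith [hy.1, hy.2]
  have d2 : HasDerivAt (fun y : ℝ => al p * y) (al p) y := by
    simpa using (hasDerivAt_id y).const_mul (al p)
  refine ((h.dZ y hy).sub (d2.smul (h.dW y hy))).congr_deriv ?_
  have e : al p ^ 2 / (1 - y ^ 2) = al p ^ 2 + (al p * y / (1 - y ^ 2)) * (al p * y) := by
    field_simp; ring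
  rw [e, smul_sub, smul_smul, smul_smul, div_mul_cancel₀ _ q0]
  module

theorem Stat.energy (hp : 1 < p) {W Z : ℝ → V} (h : Stat p W Z) :
    1 / 2 * ‖Z 0‖ ^ 2 - al p ^ 2 / 2 * ‖W 0‖ ^ 2 + ‖W 0‖ ^ (p + 1) / (p + 1) = 0 := by
  have cU : ContinuousOn (fun y => (1 - y ^ 2) • Z y - (al p * y) • W y) (Icc (-1) 1) :=
    (ContinuousOn.smul (by fun_prop) h.cZ).sub (ContinuousOn.smul (by fun_prop) h.cW)
  have c1 : ContinuousOn (fun y => ‖(1 - y ^ 2) • Z y - (al p * y) • W y‖ ^ 2) (Icc (-1) 1) := cU.norm.pow 2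
  have c2 : ContinuousOn (fun y => ‖W y‖ ^ 2) (Icc (-1) 1) := h.cW.norm.pow 2
  have c3 := cont_pow hp h.cW
  have := first_int hp (g := fun y => 1 / 2 * ‖(1 - y ^ 2) • Z y - (al p * y) • W y‖ ^ 2
    - al p ^ 2 / 2 * ‖W y‖ ^ 2 + (1 - y ^ 2) * (‖W y‖ ^ (p + 1) / (p + 1))) (by fun_prop) ?_
  · simpa using this
  · intro y hy
    have q0 : (1 - y ^ 2) ≠ 0 := by nlinarith [hy.1, hy.2]
    have d1 : HasDerivAt (fun y : ℝ => 1 - y ^ 2) (-(2 * y)) y := by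
      simpa using ((hasDerivAt_id y).pow 2).const_sub 1
    have dW : HasDerivAt W ((1 / (1 - y ^ 2)) • ((1 - y ^ 2) • Z y - (al p * y) • W y)
        + (al p * y / (1 - y ^ 2)) • W y) y := by
      refine (h.dW y hy).congr_deriv ?_
      rw [smul_sub, smul_smul, smul_smul, one_div, inv_mul_cancel₀ q0]
      module
    refine ((((h.dU hy).norm_sq.const_mul (1 / 2)).sub (dW.norm_sq.const_mul (al p ^ 2 / 2))).add
      (d1.mul (hasDerivAt_norm_pow hp dW))).congr_deriv ?_
    generalize (1 - y ^ 2) • Z y - (al p * y) • W y = U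
    have i1 : inner ℝ (nl p (W y)) (W y) = ‖W y‖ ^ (p + 1) := by rw [real_inner_comm, inner_nl hp]
    simp only [inner_add_right, inner_sub_right, inner_smul_right, real_inner_self_eq_norm_sq,
      inner_add_left, inner_smul_left, i1, real_inner_comm U (W y), real_inner_comm (nl p (W y)) U]
    have := al_mul hp
    have p1 : p + 1 ≠ 0 := by linarith
    field_simp
    have h2 : p = 1 + 2 / al p := by have := al_pos hp; field_simp; linarith
    have := al_pos hp
    generalize ‖W y‖ ^ (p + 1) = N
    linear_combination (N * y * (1 - y ^ 2)) * al_mul hp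

theorem Stat.wedge (hp : 1 < p) {W Z : ℝ → V} (h : Stat p W Z) (a b : V) :
    inner ℝ (W 0) a * inner ℝ (Z 0) b = inner ℝ (W 0) b * inner ℝ (Z 0) a := by
  have cP : ContinuousOn (fun y => (1 - y ^ 2) • Z y) (Icc (-1) 1) :=
    (ContinuousOn.smul (by fun_prop) h.cZ)
  have c1 : ∀ e : V, ContinuousOn (fun y => inner ℝ (W y) e) (Icc (-1) 1) :=
    fun e => h.cW.inner continuousOn_const
  have c2 : ∀ e : V, ContinuousOn (fun y => inner ℝ ((1 - y ^ 2) • Z y) e) (Icc (-1) 1) :=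
    fun e => cP.inner continuousOn_const
  have := first_int hp (g := fun y => inner ℝ (W y) a * inner ℝ ((1 - y ^ 2) • Z y) b
    - inner ℝ (W y) b * inner ℝ ((1 - y ^ 2) • Z y) a)
    (((c1 a).mul (c2 b)).sub ((c1 b).mul (c2 a))) ?_
  · simp at this; linarith
  · intro y hy
    have q0 : (1 - y ^ 2) ≠ 0 := by nlinarith [hy.1, hy.2]
    have i1 : ∀ e : V, HasDerivAt (fun y => inner ℝ (W y) e) (inner ℝ (Z y) e) y := fun e => by
      simpa using (h.dW y hy).inner ℝ (hasDerivAt_const y e)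
    have i2 : ∀ e : V, HasDerivAt (fun y => inner ℝ ((1 - y ^ 2) • Z y) e)
        (inner ℝ ((2 * al p * y) • Z y + (al p * (al p + 1)) • W y - nl p (W y)) e) y := fun e => by
      simpa using (h.dZ y hy).inner ℝ (hasDerivAt_const y e)
    refine (((i1 a).mul (i2 b)).sub ((i1 b).mul (i2 a))).congr_deriv ?_
    unfold nl
    simp only [inner_add_left, inner_sub_left, inner_smul_left]
    simp
    field_simp
    ring

theorem kappa0_pow (hp : 1 < p) : 0 < kappa0 p ∧ kappa0 p ^ (p - 1) = al p * (al p + 1) := by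
  have h1 : 0 < p - 1 := by linarith
  have h2 : 0 < 2 * (p + 1) / (p - 1) ^ 2 := by positivity
  refine ⟨Real.rpow_pos_of_pos h2 _, ?_⟩
  rw [kappa0, ← Real.rpow_mul h2.le, one_div, inv_mul_cancel₀ h1.ne', Real.rpow_one]
  unfold al; field_simp; ring

theorem kappa_eq (hp : 1 < p) {d : ℝ} : kappa p d = fun y => (kappa0 p * (1 - d ^ 2) ^ (1 / (p - 1))) * (1 + d * y) ^ (-al p) := by
  funext y; rfl

theorem kap_pos {d y : ℝ} (hd : d ∈ Ioo (-1 : ℝ) 1) (hy : y ∈ Icc (-1 : ℝ) 1) : 0 < 1 + d * y := by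
  have h1 : |d| < 1 := abs_lt.2 hd
  have h2 : |y| ≤ 1 := abs_le.2 hy
  have h3 : |d * y| < 1 := by
    rw [abs_mul]
    calc |d| * |y| ≤ |d| * 1 := mul_le_mul_of_nonneg_left h2 (abs_nonneg _)
      _ < 1 := by linarith
  linarith [(abs_lt.1 h3).1]

theorem kappa_deriv (p : ℝ) {d y : ℝ} (hX : 0 < 1 + d * y) :
    HasDerivAt (kappa p d) (-(al p * d) / (1 + d * y) * kappa p d y) y := by
  have d1 : HasDerivAt (fun y => 1 + d * y) d y := by
    simpa using ((hasDerivAt_id y).const_mul d).const_add 1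
  refine ((d1.rpow_const (p := -(2 / (p - 1))) (Or.inl hX.ne')).const_mul
    (kappa0 p * (1 - d ^ 2) ^ (1 / (p - 1)))).congr_deriv ?_
  rw [Real.rpow_sub_one hX.ne']
  unfold kappa al; ring

theorem kappa_posi (hp : 1 < p) {d y : ℝ} (hd : d ∈ Ioo (-1 : ℝ) 1) (hX : 0 < 1 + d * y) : 0 < kappa p d y := by
  have h0 : 0 < 1 - d ^ 2 := by nlinarith [hd.1, hd.2]
  have := (kappa0_pow hp).1
  unfold kappa; positivity

theorem kappa_pow (hp : 1 < p) {d y : ℝ} (hd : d ∈ Ioo (-1 : ℝ) 1) (hX : 0 < 1 + d * y) :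
    kappa p d y ^ (p - 1) = al p * (al p + 1) * (1 - d ^ 2) / (1 + d * y) ^ 2 := by
  have h0 : 0 < 1 - d ^ 2 := by nlinarith [hd.1, hd.2]
  have h1 : 0 < p - 1 := by linarith
  have k := kappa0_pow hp
  unfold kappa
  rw [Real.mul_rpow (by have := k.1; positivity) (by positivity), Real.mul_rpow k.1.le (by positivity), k.2,
    ← Real.rpow_mul h0.le, ← Real.rpow_mul hX.le, one_div, inv_mul_cancel₀ h1.ne', Real.rpow_one]
  have : -(2 / (p - 1)) * (p - 1) = -(2 : ℕ) := by push_cast; field_simp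
  rw [this, Real.rpow_neg hX.le, Real.rpow_natCast]
  rfl

theorem kappa_stat (hp : 1 < p) {d : ℝ} (hd : d ∈ Ioo (-1 : ℝ) 1) {Ω : V} (hΩ : ‖Ω‖ = 1) :
    Stat p (fun y => kappa p d y • Ω) (fun y => (-(al p * d) / (1 + d * y) * kappa p d y) • Ω) := by
  have ck : ContinuousOn (kappa p d) (Icc (-1) 1) := fun y hy =>
    (kappa_deriv p (kap_pos hd hy)).continuousAt.continuousWithinAt
  have ci : ContinuousOn (fun y => -(al p * d) / (1 + d * y)) (Icc (-1) 1) :=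
    ContinuousOn.div (by fun_prop) (by fun_prop) fun y hy => (kap_pos hd hy).ne'
  refine ⟨ck.smul continuousOn_const, (ci.mul ck).smul continuousOn_const, fun y hy => ?_, fun y hy => ?_⟩
  · exact (kappa_deriv p (kap_pos hd (Ioo_subset_Icc_self hy))).smul_const Ω
  · have hX := kap_pos hd (Ioo_subset_Icc_self hy)
    have d1 : HasDerivAt (fun y : ℝ => 1 - y ^ 2) (-(2 * y)) y := by
      simpa using ((hasDerivAt_id y).pow 2).const_sub 1
    have d2 : HasDerivAt (fun y => 1 + d * y) d y := by
      simpa using ((hasDerivAt_id y).const_mul d).const_add 1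
    have d3 := d1.smul ((((hasDerivAt_const y (-(al p * d))).div d2 hX.ne').mul (kappa_deriv p hX)).smul_const Ω)
    refine d3.congr_deriv ?_
    have n : nl p (kappa p d y • Ω) = (al p * (al p + 1) * (1 - d ^ 2) / (1 + d * y) ^ 2 * kappa p d y) • Ω := by
      unfold nl
      rw [norm_smul, hΩ, mul_one, Real.norm_of_nonneg (kappa_posi hp hd hX).le, kappa_pow hp hd hX, smul_smul]
    rw [n]
    simp only [smul_smul, ← add_smul, ← sub_smul, Pi.mul_apply, Pi.div_apply]
    congr 1
    have hX' : 1 + y * d ≠ 0 := by rw [mul_comm]; exact hX.ne'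
    generalize kappa p d y = k
    field_simp
    ring

theorem Stat.classify (hp : 1 < p) {W Z : ℝ → V} (h : Stat p W Z) :
    (∀ y ∈ Icc (-1 : ℝ) 1, W y = 0 ∧ Z y = 0) ∨ ∃ d ∈ Ioo (-1 : ℝ) 1, ∃ Ω : V, ‖Ω‖ = 1 ∧
      ∀ y ∈ Icc (-1 : ℝ) 1, W y = kappa p d y • Ω ∧ Z y = (-(al p * d) / (1 + d * y) * kappa p d y) • Ω := by
  have ha := al_pos hp
  have en := h.energy hp
  have h1 : 0 < p - 1 := by linarith
  by_cases hW : W 0 = 0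
  · left
    have hZ : Z 0 = 0 := by
      rw [hW, norm_zero, Real.zero_rpow (by linarith)] at en
      have : ‖Z 0‖ ^ 2 = 0 := by norm_num at en; simp [en]
      simpa using this
    have h0 : Stat p (fun _ => (0 : V)) (fun _ => 0) := by
      refine ⟨continuousOn_const, continuousOn_const, fun y _ => hasDerivAt_const y _, fun y _ => ?_⟩
      simpa [nl] using hasDerivAt_const y (0 : V)
    have := h.unique hp h0 hW hZ
    exact fun y hy => ⟨this.1 hy, this.2 hy⟩
  · right
    set r := ‖W 0‖ with hr
    have r0 : 0 < r := norm_pos_iff.2 hW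
    set c := inner ℝ (Z 0) (W 0) / r ^ 2 with hc
    have hZ : Z 0 = c • W 0 := by
      refine ext_inner_right ℝ fun b => ?_
      have := h.wedge hp (W 0) b
      rw [real_inner_self_eq_norm_sq, ← hr] at this
      rw [inner_smul_left, hc]
      simp only [conj_trivial]
      field_simp
      linarith
    have e1 : r ^ (p + 1) = r ^ (p - 1) * r ^ 2 := by
      rw [← Real.rpow_natCast r 2, ← Real.rpow_add r0]; congr 1; push_cast; ring
    have e2 : r ^ (p - 1) = (p + 1) / 2 * (al p ^ 2 - c ^ 2) := by
      rw [hZ, norm_smul, ← hr, mul_pow, Real.norm_eq_abs, sq_abs, e1] at en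
      have p1 : p + 1 ≠ 0 := by linarith
      field_simp at en ⊢
      have r2 : r ^ 2 ≠ 0 := by positivity
      have := mul_left_cancel₀ r2 (show r ^ 2 * (r ^ (p - 1) * 2) = r ^ 2 * ((p + 1) * (al p ^ 2 - c ^ 2)) by
        linear_combination en)
      linarith
    have pos : 0 < r ^ (p - 1) := by positivity
    have c2 : c ^ 2 < al p ^ 2 := by
      by_contra hcon
      have : (p + 1) / 2 * (al p ^ 2 - c ^ 2) ≤ 0 := mul_nonpos_of_nonneg_of_nonpos (by linarith) (by linarith)
      linarith
    have c3 := abs_lt_of_sq_lt_sq c2 ha.le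
    set d := -c / al p with hd
    have dm : d ∈ Ioo (-1 : ℝ) 1 := by
      have := abs_lt.1 c3
      rw [hd]; constructor
      · rw [lt_div_iff₀ ha]; linarith
      · rw [div_lt_iff₀ ha]; linarith
    have cd : c = -(al p * d) := by rw [hd]; field_simp
    have pa : p + 1 = 2 * (al p + 1) / al p := by
      have := al_mul hp; field_simp; linarith
    have rk : r = kappa p d 0 := by
      have k0 := kappa_posi hp dm (y := 0) (by norm_num)
      have := kappa_pow hp dm (y := 0) (by norm_num)
      have e3 : r ^ (p - 1) = kappa p d 0 ^ (p - 1) := by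
        rw [this, e2, pa, cd]; field_simp; ring
      exact (Real.rpow_left_inj r0.le k0.le h1.ne').1 e3
    have nΩ : ‖r⁻¹ • W 0‖ = 1 := by
      rw [norm_smul, ← hr, Real.norm_of_nonneg (by positivity), inv_mul_cancel₀ r0.ne']
    have := h.unique hp (kappa_stat hp dm nΩ) (by
      rw [← rk, smul_smul, mul_inv_cancel₀ r0.ne', one_smul]) (by
      rw [← rk, hZ, mul_zero, add_zero, div_one, ← cd, smul_smul, mul_assoc, mul_inv_cancel₀ r0.ne', mul_one])
    exact ⟨d, dm, _, nΩ, fun y hy => ⟨this.1 hy, this.2 hy⟩⟩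

end PartThirteen

section PartFourteen
variable {V : Type*} [NormedAddCommGroup V] [InnerProductSpace ℝ V] {p : ℝ}

noncomputable def eS (p : ℝ) (W Z : ℝ → V) : ℝ :=
  II p (fun y => (1 - y ^ 2) * (1 / 2 * ‖Z y‖ ^ 2 * (1 - y ^ 2)
    + al p * (al p + 1) / 2 * ‖W y‖ ^ 2 - ‖W y‖ ^ (p + 1) / (p + 1)))

theorem rho_mob (hp : 1 < p) {d y : ℝ} (hd : d ∈ Ioo (-1 : ℝ) 1) (hy : y ∈ Icc (-1 : ℝ) 1) :
    rho p ((y + d) / (1 + d * y)) * kappa0 p ^ 2 = rho p y * kappa p d y ^ 2 := by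
  have hX := kap_pos hd hy
  have h0 : 0 < 1 - d ^ 2 := by nlinarith [hd.1, hd.2]
  have hq : 0 ≤ 1 - y ^ 2 := by nlinarith [hy.1, hy.2]
  have e : 1 - ((y + d) / (1 + d * y)) ^ 2 = (1 - y ^ 2) * ((1 - d ^ 2) * ((1 + d * y) ^ 2)⁻¹) := by
    have := hX.ne'
    generalize hX' : 1 + d * y = X at *
    field_simp
    rw [← hX']; ring
  unfold rho kappa
  rw [e, Real.mul_rpow hq (by positivity), Real.mul_rpow h0.le (by positivity), mul_pow, mul_pow,
    Real.inv_rpow (by positivity), ← Real.rpow_natCast (1 + d * y) 2, ← Real.rpow_mul hX.le,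
    ← Real.rpow_neg hX.le, ← Real.rpow_natCast ((1 - d ^ 2) ^ (1 / (p - 1))) 2, ← Real.rpow_mul h0.le,
    ← Real.rpow_natCast ((1 + d * y) ^ (-(2 / (p - 1)))) 2, ← Real.rpow_mul hX.le]
  have a1 : (1 / (p - 1) * ((2 : ℕ) : ℝ)) = 2 / (p - 1) := by push_cast; ring
  have a2 : -(((2 : ℕ) : ℝ) * (2 / (p - 1))) = -(2 / (p - 1)) * ((2 : ℕ) : ℝ) := by ring
  rw [a1, a2]; ring

theorem mob_int (hp : 1 < p) {d : ℝ} (hd : d ∈ Ioo (-1 : ℝ) 1) :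
    (∫ y in (-1 : ℝ)..1, rho p y * ((1 - d ^ 2) / (1 + d * y) ^ 2 * kappa p d y ^ 2))
      = kappa0 p ^ 2 * ∫ y in (-1 : ℝ)..1, rho p y := by
  have key := intervalIntegral.integral_comp_mul_deriv' (a := -1) (b := 1)
    (f := fun y => (y + d) / (1 + d * y)) (f' := fun y => (1 - d ^ 2) / (1 + d * y) ^ 2) (g := rho p)
    (fun y hy => by
      rw [uIcc_of_le (by norm_num)] at hy
      have hX := kap_pos hd hy
      have d2 : HasDerivAt (fun y => 1 + d * y) d y := by
        simpa using ((hasDerivAt_id y).const_mul d).const_add 1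
      refine (((hasDerivAt_id y).add_const d).div d2 hX.ne').congr_deriv ?_
      simp only [id]; congr 1; ring)
    (by
      rw [uIcc_of_le (by norm_num)]
      exact ContinuousOn.div (by fun_prop) (by fun_prop) fun y hy => (pow_pos (kap_pos hd hy) 2).ne')
    (continuous_rho hp).continuousOn
  have e1 : (-1 + d) / (1 + d * -1) = -1 := by
    have : 1 + d * -1 ≠ 0 := by linarith [hd.2]
    rw [div_eq_iff this]; ring
  have e2 : (1 + d) / (1 + d * 1) = 1 := by
    have : 1 + d * 1 ≠ 0 := by linarith [hd.1]
    rw [div_eq_iff this]; ring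
  rw [e1, e2] at key
  rw [← key, ← intervalIntegral.integral_const_mul]
  refine intervalIntegral.integral_congr fun y hy => ?_
  rw [uIcc_of_le (by norm_num)] at hy
  have := rho_mob hp hd hy
  simp only [Function.comp]
  linear_combination (-((1 - d ^ 2) / (1 + d * y) ^ 2)) * this

theorem eS_kappa (hp : 1 < p) {d : ℝ} (hd : d ∈ Ioo (-1 : ℝ) 1) {Ω : V} (hΩ : ‖Ω‖ = 1) :
    eS p (fun y => kappa p d y • Ω) (fun y => (-(al p * d) / (1 + d * y) * kappa p d y) • Ω)
      = (1 / 2 - 1 / (p + 1)) * (al p * (al p + 1)) * (kappa0 p ^ 2 * ∫ y in (-1 : ℝ)..1, rho p y) := by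
  have ck : ContinuousOn (kappa p d) (Icc (-1) 1) := fun y hy =>
    (kappa_deriv p (kap_pos hd hy)).continuousAt.continuousWithinAt
  have ci : ContinuousOn (fun y => (1 + d * y)⁻¹) (Icc (-1) 1) :=
    ContinuousOn.inv₀ (by fun_prop) fun y hy => (kap_pos hd hy).ne'
  have parts := II_parts hp (h := fun y => -(al p * d) * ((1 - y ^ 2) * (kappa p d y ^ 2 * (1 + d * y)⁻¹)))
    (h' := fun y => -(al p * d) * (-(2 * y) * (kappa p d y ^ 2 * (1 + d * y)⁻¹)
      + (1 - y ^ 2) * (2 * kappa p d y * (-(al p * d) * (1 + d * y)⁻¹ * kappa p d y) * (1 + d * y)⁻¹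
        + kappa p d y ^ 2 * (-d * (1 + d * y)⁻¹ ^ 2))))
    (fun y hy => by
      have hX := kap_pos hd hy
      have d1 : HasDerivAt (fun y : ℝ => 1 - y ^ 2) (-(2 * y)) y := by
        simpa using ((hasDerivAt_id y).pow 2).const_sub 1
      have d2 : HasDerivAt (fun y => 1 + d * y) d y := by
        simpa using ((hasDerivAt_id y).const_mul d).const_add 1
      refine ((d1.mul (((kappa_deriv p hX).pow 2).mul (d2.inv hX.ne'))).const_mul (-(al p * d))).congr_deriv ?_
      simp
      left; left
      ring) (by fun_prop)
  have c1 : ContinuousOn (fun y => (1 - y ^ 2) * ((1 - d ^ 2) / (1 + d * y) ^ 2 * kappa p d y ^ 2)) (Icc (-1) 1) :=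
    ContinuousOn.mul (by fun_prop) (ContinuousOn.mul (ContinuousOn.div (by fun_prop) (by fun_prop)
      fun y hy => (pow_pos (kap_pos hd hy) 2).ne') (ck.pow 2))
  rw [← mob_int hp hd]
  have e1 : (∫ y in (-1 : ℝ)..1, rho p y * ((1 - d ^ 2) / (1 + d * y) ^ 2 * kappa p d y ^ 2))
      = II p (fun y => (1 - y ^ 2) * ((1 - d ^ 2) / (1 + d * y) ^ 2 * kappa p d y ^ 2)) := by
    refine intervalIntegral.integral_congr fun y hy => ?_
    rw [uIcc_of_le (by norm_num)] at hy
    simp only [rho_eq hp hy]; ring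
  rw [e1, ← II_mul, ← add_zero (II p _), ← mul_zero (1 / 2 : ℝ), ← parts, ← II_mul, ← II_add hp (by fun_prop) (by fun_prop)]
  refine II_congr fun y hy => ?_
  have hX := kap_pos hd hy
  have k0 := kappa_posi hp hd hX
  have kp : kappa p d y ^ (p + 1) = al p * (al p + 1) * (1 - d ^ 2) / (1 + d * y) ^ 2 * kappa p d y ^ 2 := by
    rw [← kappa_pow hp hd hX, ← Real.rpow_natCast (kappa p d y) 2, ← Real.rpow_add k0]
    congr 1; push_cast; ring
  rw [norm_smul, norm_smul, hΩ, mul_one, mul_one, Real.norm_eq_abs, Real.norm_eq_abs, sq_abs, sq_abs,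
    abs_of_pos k0, kp]
  have p1 : p + 1 ≠ 0 := by linarith
  have hX' : 1 + y * d ≠ 0 := by rw [mul_comm]; exact hX.ne'
  generalize kappa p d y = k
  generalize al p = a
  field_simp
  ring

end PartFourteen

section PartFifteen
variable {V : Type*} [NormedAddCommGroup V] [InnerProductSpace ℝ V]

theorem fd_partials {O : Set (ℝ × ℝ)} (hO : IsOpen O) {f b a : ℝ → ℝ → V}
    (h1 : ∀ x y, (x, y) ∈ O → HasDerivAt (fun x => f x y) (b x y) x)
    (h2 : ∀ x y, (x, y) ∈ O → HasDerivAt (fun y => f x y) (a x y) y)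
    (cb : ContinuousOn (fun q : ℝ × ℝ => b q.1 q.2) O)
    (ca : ContinuousOn (fun q : ℝ × ℝ => a q.1 q.2) O) {x y : ℝ} (hq : (x, y) ∈ O) :
    HasFDerivAt (fun q : ℝ × ℝ => f q.1 q.2) (lin (b x y) (a x y)) (x, y) := by
  have c1 : Continuous (fun v : V => (1 : ℝ →L[ℝ] ℝ).smulRight v) :=
    (ContinuousLinearMap.smulRightL ℝ ℝ V 1).continuous
  have := (hasStrictFDerivAt_uncurry_coprod (𝕜 := ℝ) (u := (x, y)) (f := f)
    (f₁ := fun x y => (1 : ℝ →L[ℝ] ℝ).smulRight (b x y))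
    (f₂ := fun x y => (1 : ℝ →L[ℝ] ℝ).smulRight (a x y))
    (by filter_upwards [hO.mem_nhds hq] with v hv using (h1 v.1 v.2 hv).hasFDerivAt)
    (by filter_upwards [hO.mem_nhds hq] with v hv using (h2 v.1 v.2 hv).hasFDerivAt)
    (c1.continuousAt.comp (f := fun q : ℝ × ℝ => b q.1 q.2) (cb.continuousAt (hO.mem_nhds hq)))
    (c1.continuousAt.comp (f := fun q : ℝ × ℝ => a q.1 q.2)
      (ca.continuousAt (hO.mem_nhds hq)))).hasFDerivAt
  refine this.congr_fderiv ?_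
  ext <;> simp [Function.HasUncurry.uncurry, lin]

theorem lin_lin {g : ℝ → ℝ → V} {b a : V} {x t k1 k2 k3 k4 : ℝ}
    (hg : HasFDerivAt (fun q : ℝ × ℝ => g q.1 q.2) (lin b a) (k1 * x + k2 * t, k3 * x + k4 * t)) :
    HasFDerivAt (fun q : ℝ × ℝ => g (k1 * q.1 + k2 * q.2) (k3 * q.1 + k4 * q.2))
      (lin (k1 • b + k3 • a) (k2 • b + k4 • a)) (x, t) := by
  set Λ : ℝ × ℝ →L[ℝ] ℝ × ℝ :=
    (k1 • ContinuousLinearMap.fst ℝ ℝ ℝ + k2 • ContinuousLinearMap.snd ℝ ℝ ℝ).prod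
    (k3 • ContinuousLinearMap.fst ℝ ℝ ℝ + k4 • ContinuousLinearMap.snd ℝ ℝ ℝ) with hΛ
  have h2 : HasFDerivAt (fun q => Λ q) Λ (x, t) := Λ.hasFDerivAt
  have h3 : HasFDerivAt (fun q : ℝ × ℝ => g q.1 q.2) (lin b a) (Λ (x, t)) := by
    simpa [hΛ] using hg
  have := h3.comp (x, t) h2
  refine this.congr_fderiv ?_
  ext <;> simp [lin, hΛ]

structure NSol (p : ℝ) (O : Set (ℝ × ℝ)) (f P Q R S : ℝ → ℝ → V) : Prop where
  op : IsOpen O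
  df : ∀ x t, (x, t) ∈ O → HasFDerivAt (fun q : ℝ × ℝ => f q.1 q.2) (lin (P x t) (Q x t)) (x, t)
  dP : ∀ x t, (x, t) ∈ O →
    HasFDerivAt (fun q : ℝ × ℝ => P q.1 q.2) (lin (R x t) ((1 / 4 : ℝ) • nl p (f x t))) (x, t)
  dQ : ∀ x t, (x, t) ∈ O →
    HasFDerivAt (fun q : ℝ × ℝ => Q q.1 q.2) (lin ((1 / 4 : ℝ) • nl p (f x t)) (S x t)) (x, t)
  cR : ContinuousOn (fun q : ℝ × ℝ => R q.1 q.2) O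
  cS : ContinuousOn (fun q : ℝ × ℝ => S q.1 q.2) O

theorem NSol.cf {p : ℝ} {O : Set (ℝ × ℝ)} {f P Q R S : ℝ → ℝ → V} (h : NSol p O f P Q R S) :
    ContinuousOn (fun q : ℝ × ℝ => f q.1 q.2) O :=
  fun q hq => (h.df q.1 q.2 hq).continuousAt.continuousWithinAt

theorem NSol.toSol {p : ℝ} (hp : 1 < p) {O O' : Set (ℝ × ℝ)} {f P Q R S : ℝ → ℝ → V}
    (h : NSol p O f P Q R S)
    (hO' : O' = {q : ℝ × ℝ | (1 * q.1 + 1 * q.2, (-1) * q.1 + 1 * q.2) ∈ O}) :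
    ∃ A B C G : ℝ → ℝ → V, Sol p O' (fun x t => f (1 * x + 1 * t) ((-1) * x + 1 * t)) A B C G := by
  subst hO'
  have cm : Continuous (fun q : ℝ × ℝ => (1 * q.1 + 1 * q.2, (-1) * q.1 + 1 * q.2)) := by fun_prop
  have hm : MapsTo (fun q : ℝ × ℝ => (1 * q.1 + 1 * q.2, (-1) * q.1 + 1 * q.2))
    {q : ℝ × ℝ | (1 * q.1 + 1 * q.2, (-1) * q.1 + 1 * q.2) ∈ O} O := fun q hq => hq
  have cR := h.cR.comp cm.continuousOn hm
  have cS := h.cS.comp cm.continuousOn hm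
  have cN := (((continuous_nl hp).comp_continuousOn h.cf).comp cm.continuousOn hm)
  refine ⟨fun x t => P (1 * x + 1 * t) ((-1) * x + 1 * t) + Q (1 * x + 1 * t) ((-1) * x + 1 * t),
    fun x t => P (1 * x + 1 * t) ((-1) * x + 1 * t) - Q (1 * x + 1 * t) ((-1) * x + 1 * t),
    fun x t => R (1 * x + 1 * t) ((-1) * x + 1 * t) - S (1 * x + 1 * t) ((-1) * x + 1 * t),
    fun x t => R (1 * x + 1 * t) ((-1) * x + 1 * t) + S (1 * x + 1 * t) ((-1) * x + 1 * t)
      - (1 / 2 : ℝ) • nl p (f (1 * x + 1 * t) ((-1) * x + 1 * t)), h.op.preimage cm, ?_, ?_, ?_,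
    cR.sub cS, (cR.add cS).sub (cN.const_smul (1 / 2 : ℝ))⟩
  · intro x t hq
    refine (lin_lin (h.df _ _ hq)).congr_fderiv ?_
    congr 1 <;> module
  · intro x t hq
    refine ((lin_lin (h.dP _ _ hq)).add (lin_lin (h.dQ _ _ hq))).congr_fderiv ?_
    ext <;> simp [lin] <;> module
  · intro x t hq
    refine ((lin_lin (h.dP _ _ hq)).sub (lin_lin (h.dQ _ _ hq))).congr_fderiv ?_
    ext <;> simp [lin] <;> module

theorem Sol.toNSol {p : ℝ} (hp : 1 < p) {O O' : Set (ℝ × ℝ)} {u A B C G : ℝ → ℝ → V}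
    (h : Sol p O u A B C G)
    (hO' : O' = {q : ℝ × ℝ | ((1/2) * q.1 + (-1/2) * q.2, (1/2) * q.1 + (1/2) * q.2) ∈ O}) :
    ∃ P Q R S : ℝ → ℝ → V,
      NSol p O' (fun x t => u ((1/2) * x + (-1/2) * t) ((1/2) * x + (1/2) * t)) P Q R S := by
  subst hO'
  have cm : Continuous (fun q : ℝ × ℝ => (((1/2) * q.1 + (-1/2) * q.2 : ℝ),
    ((1/2) * q.1 + (1/2) * q.2 : ℝ))) := by fun_prop
  have hm : MapsTo (fun q : ℝ × ℝ => (((1/2) * q.1 + (-1/2) * q.2 : ℝ),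
    ((1/2) * q.1 + (1/2) * q.2 : ℝ)))
    {q : ℝ × ℝ | ((1/2) * q.1 + (-1/2) * q.2, (1/2) * q.1 + (1/2) * q.2) ∈ O} O := fun q hq => hq
  have cC := h.cC.comp cm.continuousOn hm
  have cG := h.cG.comp cm.continuousOn hm
  have cN := (((continuous_nl hp).comp_continuousOn h.cu).comp cm.continuousOn hm)
  set X : ℝ → ℝ → ℝ := fun x t => (1/2) * x + (-1/2) * t
  set Y : ℝ → ℝ → ℝ := fun x t => (1/2) * x + (1/2) * t
  refine ⟨fun x t => (1 / 2 : ℝ) • (A (X x t) (Y x t) + B (X x t) (Y x t)),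
    fun x t => (1 / 2 : ℝ) • (A (X x t) (Y x t) - B (X x t) (Y x t)),
    fun x t => (1 / 2 : ℝ) • (G (X x t) (Y x t) + C (X x t) (Y x t))
      + (1 / 4 : ℝ) • nl p (u (X x t) (Y x t)),
    fun x t => (1 / 2 : ℝ) • (G (X x t) (Y x t) - C (X x t) (Y x t))
      + (1 / 4 : ℝ) • nl p (u (X x t) (Y x t)), h.op.preimage cm, ?_, ?_, ?_,
    ((cG.add cC).const_smul (1 / 2 : ℝ)).add (cN.const_smul (1 / 4 : ℝ)),
    ((cG.sub cC).const_smul (1 / 2 : ℝ)).add (cN.const_smul (1 / 4 : ℝ))⟩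
  · intro x t hq
    refine (lin_lin (h.du _ _ hq)).congr_fderiv ?_
    congr 1 <;> module
  · intro x t hq
    refine (((lin_lin (h.dA _ _ hq)).add (lin_lin (h.dB _ _ hq))).const_smul
      (1 / 2 : ℝ)).congr_fderiv ?_
    ext <;> simp [lin, X, Y] <;> module
  · intro x t hq
    refine (((lin_lin (h.dA _ _ hq)).sub (lin_lin (h.dB _ _ hq))).const_smul
      (1 / 2 : ℝ)).congr_fderiv ?_
    ext <;> simp [lin, X, Y] <;> module

theorem dint_cont {g : ℝ → ℝ → V} (hg : Continuous (fun q : ℝ × ℝ => g q.1 q.2)) :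
    Continuous (fun q : ℝ × ℝ => ∫ x in (-1)..q.1, ∫ y in (-1)..q.2, g x y) := by
  have h1 : Continuous (fun r : (ℝ × ℝ) × ℝ => ∫ y in (-1)..r.1.2, g r.2 y) :=
    intervalIntegral.continuous_parametric_intervalIntegral_of_continuous
      (f := fun r : (ℝ × ℝ) × ℝ => fun y => g r.2 y)
      (hg.comp (g := fun q : ℝ × ℝ => g q.1 q.2)
        (f := fun z : ((ℝ × ℝ) × ℝ) × ℝ => (z.1.2, z.2)) (by fun_prop)) (by fun_prop)
  exact intervalIntegral.continuous_parametric_intervalIntegral_of_continuous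
      (f := fun q : ℝ × ℝ => fun x => ∫ y in (-1)..q.2, g x y) h1 continuous_fst

theorem dint_bound {g : ℝ → ℝ → V} {M e x y : ℝ} (hM : ∀ x y, ‖g x y‖ ≤ M)
    (hx : x ∈ Icc (-1) e) (hy : y ∈ Icc (-1) e) :
    ‖∫ x in (-1)..x, ∫ y in (-1)..y, g x y‖ ≤ M * (e + 1) * (e + 1) := by
  have M0 : 0 ≤ M := (norm_nonneg _).trans (hM 0 0)
  have e0 : 0 ≤ e + 1 := by linarith [hx.1, hx.2]
  have h1 : ∀ x : ℝ, ‖∫ y in (-1)..y, g x y‖ ≤ M * (e + 1) := fun x =>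
    (intervalIntegral.norm_integral_le_of_norm_le_const (C := M) (fun z _ => hM x z)).trans
      (mul_le_mul_of_nonneg_left (by rw [abs_of_nonneg] <;> linarith [hy.1, hy.2]) M0)
  exact (intervalIntegral.norm_integral_le_of_norm_le_const (C := M * (e + 1))
    (fun z _ => h1 z)).trans (mul_le_mul_of_nonneg_left
      (by rw [abs_of_nonneg] <;> linarith [hx.1, hx.2]) (mul_nonneg M0 e0))

end PartFifteen

section PartSixteen
variable {V : Type*} [NormedAddCommGroup V] [InnerProductSpace ℝ V] [CompleteSpace V]

theorem goursat {p : ℝ} (hp : 1 < p) {a b : ℝ → V} {e ε : ℝ} (he : -1 < e) (he1 : e ≤ 1 / 4)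
    (ca : ContinuousOn a (Icc (-1) e)) (cb : ContinuousOn b (Icc (-1) e))
    (ha : ∀ x ∈ Icc (-1) e, ‖a x‖ ≤ ε) (hb : ∀ x ∈ Icc (-1) e, ‖b x‖ ≤ ε) (hε : 0 < ε)
    (hsm : p * (4 * ε) ^ (p - 1) ≤ 1 / 4) :
    ∃ F : ℝ → ℝ → V, Continuous (fun q : ℝ × ℝ => F q.1 q.2) ∧
      ∀ x ∈ Icc (-1) e, ∀ y ∈ Icc (-1) e, F x y = a x + b y - b (-1)
        + ∫ x in (-1)..x, ∫ y in (-1)..y, (1 / 4 : ℝ) • nl p (F x y) := by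
  set cl : ℝ → ℝ := fun x => max (-1) (min x e) with hcl
  have ccl : Continuous cl := by fun_prop
  have mcl : ∀ x, cl x ∈ Icc (-1) e := fun x =>
    ⟨le_max_left _ _, max_le he.le (min_le_right _ _)⟩
  have ecl : ∀ x ∈ Icc (-1) e, cl x = x := fun x hx => by
    simp [hcl, min_eq_left hx.2, max_eq_right hx.1]
  have m1 : (-1 : ℝ) ∈ Icc (-1) e := ⟨le_rfl, he.le⟩
  have cg : ∀ F : BoundedContinuousFunction (ℝ × ℝ) V,
      Continuous (fun q : ℝ × ℝ => (1 / 4 : ℝ) • nl p (F (q.1, q.2))) := fun F =>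
    ((continuous_nl hp).comp F.continuous).const_smul (1 / 4 : ℝ)
  have e2 : (e + 1) * (e + 1) ≤ 2 := by nlinarith
  have e3 : 0 ≤ (e + 1) * (e + 1) := by nlinarith
  have bd : ∀ (F : BoundedContinuousFunction (ℝ × ℝ) V) (M : ℝ), ‖F‖ ≤ M → ∀ q : ℝ × ℝ,
      ‖a (cl q.1) + b (cl q.2) - b (-1) + ∫ x in (-1)..cl q.1, ∫ y in (-1)..cl q.2,
        (1 / 4 : ℝ) • nl p (F (x, y))‖ ≤ 3 * ε + 1 / 2 * M ^ p := by
    intro F M hM q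
    have h1 := dint_bound (g := fun x y => (1 / 4 : ℝ) • nl p (F (x, y))) (M := 1 / 4 * M ^ p)
      (fun x y => by
        rw [norm_smul, norm_nl hp, Real.norm_of_nonneg (by norm_num)]
        gcongr
        exact (F.norm_coe_le_norm _).trans hM) (mcl q.1) (mcl q.2)
    have h2 := norm_add_le (a (cl q.1) + b (cl q.2) - b (-1))
      (∫ x in (-1)..cl q.1, ∫ y in (-1)..cl q.2, (1 / 4 : ℝ) • nl p (F (x, y)))
    have h3 := norm_sub_le (a (cl q.1) + b (cl q.2)) (b (-1))
    have h4 := norm_add_le (a (cl q.1)) (b (cl q.2))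
    have h5 := ha _ (mcl q.1)
    have h6 := hb _ (mcl q.2)
    have h7 := hb _ m1
    have h8 : 0 ≤ M ^ p := rpow_nonneg ((norm_nonneg _).trans hM) _
    have h9 : 1 / 4 * M ^ p * (e + 1) * (e + 1) ≤ 1 / 2 * M ^ p := by
      have := mul_le_mul_of_nonneg_left e2 h8
      linarith
    linarith
  have cΦ : ∀ F : BoundedContinuousFunction (ℝ × ℝ) V, Continuous (fun q : ℝ × ℝ =>
      a (cl q.1) + b (cl q.2) - b (-1) + ∫ x in (-1)..cl q.1, ∫ y in (-1)..cl q.2,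
        (1 / 4 : ℝ) • nl p (F (x, y))) := by
    intro F
    have c1 : Continuous (fun q : ℝ × ℝ => a (cl q.1)) :=
      ca.comp_continuous (ccl.comp continuous_fst) (fun q => mcl _)
    have c2 : Continuous (fun q : ℝ × ℝ => b (cl q.2)) :=
      cb.comp_continuous (ccl.comp continuous_snd) (fun q => mcl _)
    have c3 := (dint_cont (g := fun x y => (1 / 4 : ℝ) • nl p (F (x, y))) (cg F)).comp
      (f := fun q : ℝ × ℝ => (cl q.1, cl q.2))
      ((ccl.comp continuous_fst).prodMk (ccl.comp continuous_snd))
    exact ((c1.add c2).sub continuous_const).add c3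
  set Φ : BoundedContinuousFunction (ℝ × ℝ) V → BoundedContinuousFunction (ℝ × ℝ) V := fun F =>
    BoundedContinuousFunction.ofNormedAddCommGroup _ (cΦ F) _ (bd F ‖F‖ le_rfl) with hΦ
  have Φap : ∀ F q, Φ F q = a (cl q.1) + b (cl q.2) - b (-1) + ∫ x in (-1)..cl q.1,
      ∫ y in (-1)..cl q.2, (1 / 4 : ℝ) • nl p (F (x, y)) := fun F q => rfl
  have R0 : 0 < 4 * ε := by linarith
  have hR : (4 * ε) ^ p ≤ ε := by
    have : (4 * ε) ^ p = 4 * ε * (4 * ε) ^ (p - 1) := by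
      rw [← rpow_one_add' R0.le (by linarith)]; congr 1; ring
    rw [this]
    have h0 : 0 ≤ (4 * ε) ^ (p - 1) := by positivity
    have h1 : (4 * ε) ^ (p - 1) ≤ 1 / 4 := by nlinarith
    have := mul_le_mul_of_nonneg_left h1 R0.le
    linarith
  set s := Metric.closedBall (0 : BoundedContinuousFunction (ℝ × ℝ) V) (4 * ε) with hs
  have ms : ∀ F, F ∈ s ↔ ‖F‖ ≤ 4 * ε := fun F => by simp [hs]
  have hmaps : MapsTo Φ s s := by
    intro F hF
    rw [ms] at hF ⊢
    refine (BoundedContinuousFunction.norm_le R0.le).2 fun q => ?_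
    rw [Φap]
    refine (bd F _ hF q).trans ?_
    linarith
  have hcon : ContractingWith (1 / 2) (hmaps.restrict Φ s s) := by
    refine ⟨by rw [← NNReal.coe_lt_coe]; norm_num, LipschitzWith.of_dist_le_mul ?_⟩
    rintro ⟨F, hF⟩ ⟨F', hF'⟩
    rw [Subtype.dist_eq, Subtype.dist_eq]
    change dist (Φ F) (Φ F') ≤ _ * dist F F'
    rw [ms] at hF hF'
    have hc : ((1 / 2 : NNReal) : ℝ) = 1 / 2 := by norm_num
    rw [hc]
    refine (BoundedContinuousFunction.dist_le (by positivity)).2 fun q => ?_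
    have h1 := dint_bound (g := fun x y => (1 / 4 : ℝ) • nl p (F (x, y))
        - (1 / 4 : ℝ) • nl p (F' (x, y))) (M := 1 / 4 * (1 / 4 * dist F F'))
      (fun x y => by
        rw [← smul_sub, norm_smul, Real.norm_of_nonneg (by norm_num)]
        gcongr
        refine (nl_lip hp ((F.norm_coe_le_norm _).trans hF)
          ((F'.norm_coe_le_norm _).trans hF')).trans ?_
        have h2 : ‖F (x, y) - F' (x, y)‖ ≤ dist F F' := by
          rw [← dist_eq_norm]; exact BoundedContinuousFunction.dist_coe_le_dist _
        exact mul_le_mul hsm h2 (norm_nonneg _) (by norm_num)) (mcl q.1) (mcl q.2)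
    have h3 : Φ F q - Φ F' q = ∫ x in (-1)..cl q.1, ∫ y in (-1)..cl q.2,
        ((1 / 4 : ℝ) • nl p (F (x, y)) - (1 / 4 : ℝ) • nl p (F' (x, y))) := by
      have i1 : ∀ (F : BoundedContinuousFunction (ℝ × ℝ) V) x, IntervalIntegrable
          (fun y => (1 / 4 : ℝ) • nl p (F (x, y))) volume (-1) (cl q.2) := fun F x =>
        ((cg F).comp (f := fun y : ℝ => (x, y)) (by fun_prop)).intervalIntegrable _ _
      have i2 : ∀ F : BoundedContinuousFunction (ℝ × ℝ) V, IntervalIntegrable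
          (fun x => ∫ y in (-1)..cl q.2, (1 / 4 : ℝ) • nl p (F (x, y))) volume (-1) (cl q.1) :=
        fun F => (intervalIntegral.continuous_parametric_intervalIntegral_of_continuous'
          (f := fun x y => (1 / 4 : ℝ) • nl p (F (x, y))) (cg F) _ _).intervalIntegrable _ _
      rw [Φap, Φap, add_sub_add_left_eq_sub, ← intervalIntegral.integral_sub (i2 F) (i2 F')]
      congr 1
      ext x
      rw [intervalIntegral.integral_sub (i1 F x) (i1 F' x)]
    rw [dist_eq_norm, h3]
    refine h1.trans ?_
    have := mul_le_mul_of_nonneg_left e2 (dist_nonneg (x := F) (y := F'))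
    have d0 := dist_nonneg (x := F) (y := F')
    linarith
  obtain ⟨F, -, hF, -⟩ := ContractingWith.exists_fixedPoint'
    (Metric.isClosed_closedBall.isComplete) hmaps hcon
    (x := 0) ((ms 0).2 (by simpa using R0.le)) (edist_ne_top _ _)
  refine ⟨fun x y => F (x, y), F.continuous, fun x hx y hy => ?_⟩
  have := Φap F (x, y)
  rw [hF.eq] at this
  simp only [ecl x hx, ecl y hy] at this
  exact this

end PartSixteen

section PartSeventeen
variable {V : Type*} [NormedAddCommGroup V] [InnerProductSpace ℝ V] [CompleteSpace V]

theorem par_cont {H : ℝ → ℝ → V} {e : ℝ} (he : -1 < e)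
    (hH : ContinuousOn (fun q : ℝ × ℝ => H q.1 q.2) (Ioo (-1) e ×ˢ Icc (-1) e)) :
    ContinuousOn (fun q : ℝ × ℝ => ∫ y in (-1)..q.2, H q.1 y) (Ioo (-1) e ×ˢ Ioo (-1) e) := by
  rintro ⟨x, y⟩ ⟨⟨hx1, hx2⟩, hy⟩
  simp only at hx1 hx2 hy
  obtain ⟨l, hl1, hl2⟩ := exists_between hx1
  obtain ⟨r, hr1, hr2⟩ := exists_between hx2
  have c1 : Continuous (fun q : ℝ × ℝ => H (max l (min q.1 r)) (max (-1) (min q.2 e))) := by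
    refine hH.comp_continuous (f := fun q : ℝ × ℝ => (max l (min q.1 r), max (-1) (min q.2 e)))
      (by fun_prop) fun q => ⟨⟨?_, ?_⟩, ⟨?_, ?_⟩⟩
    · exact lt_of_lt_of_le hl1 (le_max_left _ _)
    · exact max_lt (by linarith) (lt_of_le_of_lt (min_le_right _ _) hr2)
    · exact le_max_left _ _
    · exact max_le he.le (min_le_right _ _)
  have c2 : Continuous (fun q : ℝ × ℝ => ∫ y in (-1)..q.2,
      H (max l (min q.1 r)) (max (-1) (min y e))) :=
    intervalIntegral.continuous_parametric_intervalIntegral_of_continuous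
      (f := fun q : ℝ × ℝ => fun y => H (max l (min q.1 r)) (max (-1) (min y e)))
      (c1.comp (f := fun z : (ℝ × ℝ) × ℝ => (z.1.1, z.2)) (by fun_prop)) continuous_snd
  refine (c2.continuousAt.congr ?_).continuousWithinAt
  have hn : Ioo l r ×ˢ Ioo (-1) e ∈ nhds (x, y) :=
    (isOpen_Ioo.prod isOpen_Ioo).mem_nhds ⟨⟨hl2, hr1⟩, hy⟩
  filter_upwards [hn] with q hq
  refine intervalIntegral.integral_congr fun z hz => ?_
  rw [uIcc_of_le hq.2.1.le] at hz
  rw [min_eq_left hq.1.2.le, max_eq_right hq.1.1.le, min_eq_left (hz.2.trans hq.2.2.le),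
    max_eq_right hz.1]

theorem half {p : ℝ} (hp : 1 < p) {F P : ℝ → ℝ → V}
    (cF : Continuous (fun q : ℝ × ℝ => F q.1 q.2)) {a' a'' : ℝ → V} {e : ℝ} (he : -1 < e)
    (hd : ∀ x ∈ Ioo (-1) e, HasDerivAt a' (a'' x) x) (ca : ContinuousOn a'' (Ioo (-1) e))
    (hP : ∀ x y, P x y = a' x + ∫ y in (-1)..y, (1 / 4 : ℝ) • nl p (F x y))
    (hF : ∀ x ∈ Ioo (-1) e, ∀ y ∈ Icc (-1) e, HasDerivAt (fun x => F x y) (P x y) x) :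
    ContinuousOn (fun q : ℝ × ℝ => P q.1 q.2) (Ioo (-1) e ×ˢ Icc (-1) e) ∧ ∃ R : ℝ → ℝ → V,
      ContinuousOn (fun q : ℝ × ℝ => R q.1 q.2) (Ioo (-1) e ×ˢ Ioo (-1) e) ∧
      ∀ x ∈ Ioo (-1) e, ∀ y ∈ Ioo (-1) e, HasDerivAt (fun x => P x y) (R x y) x ∧
        HasDerivAt (fun y => P x y) ((1 / 4 : ℝ) • nl p (F x y)) y := by
  have cn : Continuous (fun q : ℝ × ℝ => nl p (F q.1 q.2)) := (continuous_nl hp).comp cF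
  have cg : Continuous (fun q : ℝ × ℝ => (1 / 4 : ℝ) • nl p (F q.1 q.2)) :=
    cn.const_smul (1 / 4 : ℝ)
  have cP : ContinuousOn (fun q : ℝ × ℝ => P q.1 q.2) (Ioo (-1) e ×ˢ Icc (-1) e) := by
    have c1 : ContinuousOn (fun q : ℝ × ℝ => a' q.1) (Ioo (-1) e ×ˢ Icc (-1) e) :=
      ContinuousOn.comp (g := a') (fun x hx => (hd x hx).continuousAt.continuousWithinAt)
        continuous_fst.continuousOn (fun q hq => hq.1)
    have c2 : Continuous (fun q : ℝ × ℝ => ∫ y in (-1)..q.2, (1 / 4 : ℝ) • nl p (F q.1 y)) :=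
      intervalIntegral.continuous_parametric_intervalIntegral_of_continuous
        (f := fun q : ℝ × ℝ => fun y => (1 / 4 : ℝ) • nl p (F q.1 y))
        (cg.comp (f := fun z : (ℝ × ℝ) × ℝ => (z.1.1, z.2)) (by fun_prop)) continuous_snd
    refine (c1.add c2.continuousOn).congr fun q _ => hP _ _
  have cH : ContinuousOn (fun q : ℝ × ℝ => dnl p (F q.1 q.2) (P q.1 q.2))
      (Ioo (-1) e ×ˢ Icc (-1) e) :=
    (((continuous_dnl hp).comp cF).continuousOn).clm_apply cP
  refine ⟨cP, fun x y => a'' x + ∫ y in (-1)..y, (1 / 4 : ℝ) • dnl p (F x y) (P x y),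
    ?_, fun x hx y hy => ⟨?_, ?_⟩⟩
  · refine ContinuousOn.add ?_ ?_
    · exact ContinuousOn.comp (g := a'') ca continuous_fst.continuousOn (fun q hq => hq.1)
    · exact par_cont (H := fun x y => (1 / 4 : ℝ) • dnl p (F x y) (P x y)) he
        (cH.const_smul (1 / 4 : ℝ))
  · have d1 : ∀ y' ∈ Icc (-1) y, ∀ x ∈ Ioo (-1) e,
        HasDerivAt (fun x => nl p (F x y')) (dnl p (F x y') (P x y')) x := fun y' hy' x hx =>
      (hasFDerivAt_nl hp (F x y')).comp_hasDerivAt (f := fun x => F x y') x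
          (hF x hx y' ⟨hy'.1, hy'.2.trans hy.2.le⟩)
    have c1 : ContinuousOn (fun q : ℝ × ℝ => nl p (F q.2 q.1)) (Icc (-1) y ×ˢ Ioo (-1) e) :=
      (cn.comp continuous_swap).continuousOn
    have c2 : ContinuousOn (fun q : ℝ × ℝ => dnl p (F q.2 q.1) (P q.2 q.1))
        (Icc (-1) y ×ˢ Ioo (-1) e) :=
      ContinuousOn.comp (f := fun q : ℝ × ℝ => (q.2, q.1)) cH (by fun_prop)
        (fun q hq => ⟨hq.2, hq.1.1, hq.1.2.trans hy.2.le⟩)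
    have := hasDerivAt_int (g := fun y x => nl p (F x y)) (g' := fun y x => dnl p (F x y) (P x y))
      (k := fun _ => 1 / 4) hy.1.le (isOpen_Ioo (a := -1) (b := e))
      (intervalIntegrable_const) d1 c1 c2 hx
    refine HasDerivAt.congr_of_eventuallyEq ((hd x hx).add this) (.of_forall fun z => hP z y)
  · have c : Continuous (fun y => (1 / 4 : ℝ) • nl p (F x y)) :=
      cg.comp (f := fun y : ℝ => (x, y)) (by fun_prop)
    have := (c.integral_hasStrictDerivAt (-1) y).hasDerivAt.const_add (a' x)
    exact this.congr_of_eventuallyEq (.of_forall fun z => hP x z)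

theorem reg {p : ℝ} (hp : 1 < p) {F : ℝ → ℝ → V}
    (cF : Continuous (fun q : ℝ × ℝ => F q.1 q.2)) {a a' a'' b b' b'' : ℝ → V} {c : V} {e : ℝ}
    (he : -1 < e)
    (ha : ∀ x ∈ Ioo (-1) e, HasDerivAt a (a' x) x)
    (ha' : ∀ x ∈ Ioo (-1) e, HasDerivAt a' (a'' x) x) (ca : ContinuousOn a'' (Ioo (-1) e))
    (hb : ∀ x ∈ Ioo (-1) e, HasDerivAt b (b' x) x)
    (hb' : ∀ x ∈ Ioo (-1) e, HasDerivAt b' (b'' x) x) (cb : ContinuousOn b'' (Ioo (-1) e))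
    (hF : ∀ x ∈ Icc (-1) e, ∀ y ∈ Icc (-1) e, F x y = a x + b y - c
        + ∫ x in (-1)..x, ∫ y in (-1)..y, (1 / 4 : ℝ) • nl p (F x y)) :
    ∃ P Q R S : ℝ → ℝ → V, NSol p (Ioo (-1) e ×ˢ Ioo (-1) e) F P Q R S := by
  have cn : Continuous (fun q : ℝ × ℝ => nl p (F q.1 q.2)) := (continuous_nl hp).comp cF
  have cg : Continuous (fun q : ℝ × ℝ => (1 / 4 : ℝ) • nl p (F q.1 q.2)) :=
    cn.const_smul (1 / 4 : ℝ)
  have cH : Continuous (fun q : ℝ × ℝ => ∫ y in (-1)..q.2, (1 / 4 : ℝ) • nl p (F q.1 y)) :=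
    intervalIntegral.continuous_parametric_intervalIntegral_of_continuous
      (f := fun q : ℝ × ℝ => fun y => (1 / 4 : ℝ) • nl p (F q.1 y))
      (cg.comp (f := fun z : (ℝ × ℝ) × ℝ => (z.1.1, z.2)) (by fun_prop)) continuous_snd
  set P : ℝ → ℝ → V := fun x y => a' x + ∫ y in (-1)..y, (1 / 4 : ℝ) • nl p (F x y) with hP
  set Q : ℝ → ℝ → V := fun x y => b' y + ∫ x in (-1)..x, (1 / 4 : ℝ) • nl p (F x y) with hQ
  have dP : ∀ x ∈ Ioo (-1) e, ∀ y ∈ Icc (-1) e, HasDerivAt (fun x => F x y) (P x y) x := by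
    intro x hx y hy
    have c1 : Continuous (fun x => ∫ y in (-1)..y, (1 / 4 : ℝ) • nl p (F x y)) :=
      cH.comp (f := fun x : ℝ => (x, y)) (by fun_prop)
    have := (((ha x hx).add_const (b y)).sub_const c).add
      (c1.integral_hasStrictDerivAt (-1) x).hasDerivAt
    refine this.congr_of_eventuallyEq ?_
    filter_upwards [Ioo_mem_nhds hx.1 hx.2] with z hz
    exact hF z ⟨hz.1.le, hz.2.le⟩ y hy
  have dQ : ∀ y ∈ Ioo (-1) e, ∀ x ∈ Icc (-1) e, HasDerivAt (fun y => F x y) (Q x y) y := by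
    intro y hy x hx
    have h1 := hasDerivAt_int (g := fun x y => ∫ y in (-1)..y, (1 / 4 : ℝ) • nl p (F x y))
      (g' := fun x y => (1 / 4 : ℝ) • nl p (F x y))
      (k := fun _ => 1) hx.1 (isOpen_univ)
      (intervalIntegrable_const) (fun x' _ y _ =>
        ((cg.comp (f := fun y : ℝ => (x', y)) (by fun_prop)).integral_hasStrictDerivAt
          (-1) y).hasDerivAt) cH.continuousOn cg.continuousOn (mem_univ y)
    simp only [one_smul] at h1
    have := (((hb y hy).const_add (a x)).sub_const c).add h1
    refine this.congr_of_eventuallyEq ?_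
    filter_upwards [Ioo_mem_nhds hy.1 hy.2] with z hz
    exact hF x hx z ⟨hz.1.le, hz.2.le⟩
  obtain ⟨cP, R, cR, hR⟩ := half hp cF he ha' ca (fun x y => rfl) dP
  obtain ⟨cQ, S, cS, hS⟩ := half hp (F := fun y x => F x y) (P := fun y x => Q x y)
    (cF.comp continuous_swap) he hb' cb (fun x y => rfl) dQ
  have ho : IsOpen (Ioo (-1) e ×ˢ Ioo (-1) e) := isOpen_Ioo.prod isOpen_Ioo
  have cS' : ContinuousOn (fun q : ℝ × ℝ => S q.2 q.1) (Ioo (-1) e ×ˢ Ioo (-1) e) :=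
    cS.comp continuous_swap.continuousOn (fun q hq => ⟨hq.2, hq.1⟩)
  have cQ' : ContinuousOn (fun q : ℝ × ℝ => Q q.1 q.2) (Ioo (-1) e ×ˢ Ioo (-1) e) :=
    cQ.comp continuous_swap.continuousOn (fun q hq => ⟨hq.2, Ioo_subset_Icc_self hq.1⟩)
  refine ⟨P, Q, R, fun x y => S y x, ho, fun x y hq => ?_, fun x y hq => ?_, fun x y hq => ?_,
    cR, cS'⟩
  · exact fd_partials ho (fun x y hq => dP x hq.1 y (Ioo_subset_Icc_self hq.2))
      (fun x y hq => dQ y hq.2 x (Ioo_subset_Icc_self hq.1))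
      (cP.mono (prod_mono le_rfl Ioo_subset_Icc_self)) cQ' hq
  · exact fd_partials (f := P) (b := R) (a := fun x y => (1 / 4 : ℝ) • nl p (F x y)) ho
      (fun x y hq => (hR x hq.1 y hq.2).1) (fun x y hq => (hR x hq.1 y hq.2).2) cR cg.continuousOn hq
  · exact fd_partials (f := Q) (b := fun x y => (1 / 4 : ℝ) • nl p (F x y)) (a := fun x y => S y x) ho
      (fun x y hq => (hS y hq.2 x hq.1).2) (fun x y hq => (hS y hq.2 x hq.1).1) cg.continuousOn cS' hq

end PartSeventeen

section PartEighteen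
variable {V : Type*} [NormedAddCommGroup V] [InnerProductSpace ℝ V]

theorem expb {g : ℝ → V} {D k y : ℝ} (hk : 0 < k) (hD : 0 ≤ D) (hy : -1 ≤ y)
    (hg : ∀ t ∈ Icc (-1) y, ‖g t‖ ≤ D * exp (k * t)) :
    ‖∫ t in (-1)..y, g t‖ ≤ D / k * exp (k * y) := by
  have d : ∀ t ∈ uIcc (-1) y, HasDerivAt (fun t => D / k * exp (k * t)) (D * exp (k * t)) t := by
    intro t _
    refine ((((hasDerivAt_id t).const_mul k).exp).const_mul (D / k)).congr_deriv ?_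
    simp; field_simp
  have c : Continuous (fun t => D * exp (k * t)) := by fun_prop
  have h1 := intervalIntegral.norm_integral_le_of_norm_le hy
    (Eventually.of_forall fun t ht => hg t ⟨ht.1.le, ht.2⟩) (c.intervalIntegrable (μ := volume) _ _)
  rw [intervalIntegral.integral_eq_sub_of_hasDerivAt d (c.intervalIntegrable _ _)] at h1
  have : 0 ≤ D / k * exp (k * (-1)) := by positivity
  linarith

theorem uniq0 {p : ℝ} (hp : 1 < p) {f F : ℝ → ℝ → V}
    (cf : Continuous (fun q : ℝ × ℝ => f q.1 q.2)) (cF : Continuous (fun q : ℝ × ℝ => F q.1 q.2))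
    {X Y : ℝ} (hX : -1 ≤ X) (hY : -1 ≤ Y) {d : ℝ → ℝ → V}
    (hf : ∀ x ∈ Icc (-1) X, ∀ y ∈ Icc (-1) Y, f x y = d x y
        + ∫ x in (-1)..x, ∫ y in (-1)..y, (1 / 4 : ℝ) • nl p (f x y))
    (hF : ∀ x ∈ Icc (-1) X, ∀ y ∈ Icc (-1) Y, F x y = d x y
        + ∫ x in (-1)..x, ∫ y in (-1)..y, (1 / 4 : ℝ) • nl p (F x y)) : f X Y = F X Y := by
  have hc : IsCompact (Icc (-1) X ×ˢ Icc (-1) Y) := isCompact_Icc.prod isCompact_Icc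
  have hmem : (X, Y) ∈ Icc (-1) X ×ˢ Icc (-1) Y := ⟨⟨hX, le_rfl⟩, ⟨hY, le_rfl⟩⟩
  obtain ⟨M1, hM1⟩ := hc.exists_bound_of_continuousOn cf.continuousOn
  obtain ⟨M2, hM2⟩ := hc.exists_bound_of_continuousOn cF.continuousOn
  set M := max M1 M2
  have M0 : 0 ≤ M := (norm_nonneg _).trans ((hM1 _ hmem).trans (le_max_left _ _))
  set c := 1 / 4 * (p * M ^ (p - 1)) with hcdef
  have c0 : 0 ≤ c := by positivity
  set k := 1 + c with hk
  have k0 : 0 < k := by linarith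
  obtain ⟨q, hq, hmax⟩ := hc.exists_isMaxOn ⟨_, hmem⟩
    (f := fun q : ℝ × ℝ => ‖f q.1 q.2 - F q.1 q.2‖ * exp (-(k * q.1 + k * q.2)))
    (Continuous.continuousOn (by
      exact (cf.sub cF).norm.mul (by fun_prop)))
  set μ := ‖f q.1 q.2 - F q.1 q.2‖ * exp (-(k * q.1 + k * q.2)) with hμ
  have μ0 : 0 ≤ μ := by positivity
  have hle : ∀ x ∈ Icc (-1) X, ∀ y ∈ Icc (-1) Y,
      ‖f x y - F x y‖ ≤ μ * exp (k * x) * exp (k * y) := by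
    intro x hx y hy
    have h1 : ‖f x y - F x y‖ * exp (-(k * x + k * y)) ≤ μ := hmax (show (x, y) ∈ _ from ⟨hx, hy⟩)
    have h2 := mul_le_mul_of_nonneg_right h1 (exp_pos (k * x + k * y)).le
    rw [mul_assoc, ← Real.exp_add, neg_add_cancel, Real.exp_zero, mul_one, Real.exp_add] at h2
    linarith
  have cn : ∀ {F : ℝ → ℝ → V}, Continuous (fun q : ℝ × ℝ => F q.1 q.2) →
      Continuous (fun q : ℝ × ℝ => (1 / 4 : ℝ) • nl p (F q.1 q.2)) := fun cF =>
    ((continuous_nl hp).comp cF).const_smul (1 / 4 : ℝ)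
  have h3 : f q.1 q.2 - F q.1 q.2 = ∫ x in (-1)..q.1, ∫ y in (-1)..q.2,
      ((1 / 4 : ℝ) • nl p (f x y) - (1 / 4 : ℝ) • nl p (F x y)) := by
    have i1 : ∀ {F : ℝ → ℝ → V}, Continuous (fun q : ℝ × ℝ => F q.1 q.2) → ∀ x,
        IntervalIntegrable (fun y => (1 / 4 : ℝ) • nl p (F x y)) volume (-1) q.2 := fun cF x =>
      ((cn cF).comp (f := fun y : ℝ => (x, y)) (by fun_prop)).intervalIntegrable _ _
    have i2 : ∀ {F : ℝ → ℝ → V}, Continuous (fun q : ℝ × ℝ => F q.1 q.2) → IntervalIntegrable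
        (fun x => ∫ y in (-1)..q.2, (1 / 4 : ℝ) • nl p (F x y)) volume (-1) q.1 :=
      fun {F} cF => (intervalIntegral.continuous_parametric_intervalIntegral_of_continuous'
        (f := fun x y => (1 / 4 : ℝ) • nl p (F x y)) (cn cF) _ _).intervalIntegrable _ _
    rw [hf _ hq.1 _ hq.2, hF _ hq.1 _ hq.2, add_sub_add_left_eq_sub,
      ← intervalIntegral.integral_sub (i2 cf) (i2 cF)]
    congr 1
    ext x
    rw [intervalIntegral.integral_sub (i1 cf x) (i1 cF x)]
  have h4 : ∀ x ∈ Icc (-1) q.1, ∀ y ∈ Icc (-1) q.2,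
      ‖(1 / 4 : ℝ) • nl p (f x y) - (1 / 4 : ℝ) • nl p (F x y)‖
        ≤ (c * μ * exp (k * x)) * exp (k * y) := by
    intro x hx y hy
    have hx' : x ∈ Icc (-1) X := ⟨hx.1, hx.2.trans hq.1.2⟩
    have hy' : y ∈ Icc (-1) Y := ⟨hy.1, hy.2.trans hq.2.2⟩
    rw [← smul_sub, norm_smul, Real.norm_of_nonneg (by norm_num)]
    have h5 := nl_lip hp ((hM1 (x, y) ⟨hx', hy'⟩).trans (le_max_left M1 M2))
      ((hM2 (x, y) ⟨hx', hy'⟩).trans (le_max_right M1 M2))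
    have h6 := mul_le_mul_of_nonneg_left (hle x hx' y hy') c0
    simp only at h5
    rw [hcdef] at h6 ⊢
    linarith
  have h5 : ∀ x ∈ Icc (-1) q.1, ‖∫ y in (-1)..q.2,
      ((1 / 4 : ℝ) • nl p (f x y) - (1 / 4 : ℝ) • nl p (F x y))‖ ≤
        (c * μ / k * exp (k * q.2)) * exp (k * x) := by
    intro x hx
    refine (expb k0 (by positivity) hq.2.1 (h4 x hx)).trans (le_of_eq ?_)
    ring
  have h6 := expb k0 (by positivity) hq.1.1 h5
  rw [← h3] at h6
  have h7 : μ ≤ c * μ / k / k := by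
    have := mul_le_mul_of_nonneg_right h6 (exp_pos (-(k * q.1 + k * q.2))).le
    refine this.trans (le_of_eq ?_)
    have e1 : exp (k * q.2) * exp (k * q.1) * exp (-(k * q.1 + k * q.2)) = 1 := by
      rw [← Real.exp_add, ← Real.exp_add, ← Real.exp_zero]; congr 1; ring
    calc c * μ / k * exp (k * q.2) / k * exp (k * q.1) * exp (-(k * q.1 + k * q.2))
        = c * μ / k / k * (exp (k * q.2) * exp (k * q.1) * exp (-(k * q.1 + k * q.2))) := by ring
      _ = _ := by rw [e1, mul_one]
  have h8 : μ ≤ 0 := by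
    rw [div_div, le_div_iff₀ (by positivity)] at h7
    by_contra hcon
    push Not at hcon
    nlinarith [mul_nonneg μ0 c0, mul_nonneg (mul_nonneg μ0 c0) c0]
  have h9 := hle X hmem.1 Y hmem.2
  have : μ = 0 := le_antisymm h8 μ0
  rw [this, zero_mul, zero_mul] at h9
  exact sub_eq_zero.1 (norm_le_zero_iff.1 h9)

variable [CompleteSpace V] {p : ℝ} {O : Set (ℝ × ℝ)} {f P Q R S F : ℝ → ℝ → V}

theorem NSol.int_eq (hp : 1 < p) (h : NSol p O f P Q R S) {X Y : ℝ} (hX : -1 ≤ X) (hY : -1 ≤ Y)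
    (hR : Icc (-1) X ×ˢ Icc (-1) Y ⊆ O) : f X Y = f X (-1) + f (-1) Y - f (-1) (-1)
        + ∫ x in (-1)..X, ∫ y in (-1)..Y, (1 / 4 : ℝ) • nl p (f x y) := by
  have cP : ContinuousOn (fun q : ℝ × ℝ => P q.1 q.2) O :=
    fun q hq => (h.dP q.1 q.2 hq).continuousAt.continuousWithinAt
  have i1 : ∀ y ∈ Icc (-1) Y, IntervalIntegrable (fun x => P x y) volume (-1) X := fun y hy => by
    refine ContinuousOn.intervalIntegrable ?_
    rw [uIcc_of_le hX]
    exact cP.comp (f := fun x : ℝ => (x, y)) (by fun_prop) (fun x hx => hR ⟨hx, hy⟩)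
  have e1 : ∀ y ∈ Icc (-1) Y, ∫ x in (-1)..X, P x y = f X y - f (-1) y := fun y hy =>
    intervalIntegral.integral_eq_sub_of_hasDerivAt (f := fun x => f x y) (fun x hx => by
      rw [uIcc_of_le hX] at hx
      have := lin_comp (X := fun x => x) (S := fun _ => y) (h.df x y (hR ⟨hx, hy⟩))
        (hasDerivAt_id x) (hasDerivAt_const x y)
      simpa using this) (i1 y hy)
  have e2 : ∀ x ∈ Icc (-1) X, ∫ y in (-1)..Y, (1 / 4 : ℝ) • nl p (f x y) = P x Y - P x (-1) :=
    fun x hx => intervalIntegral.integral_eq_sub_of_hasDerivAt (f := fun y => P x y)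
    (fun y hy => by
      rw [uIcc_of_le hY] at hy
      have := lin_comp (X := fun _ => x) (S := fun y => y) (h.dP x y (hR ⟨hx, hy⟩))
        (hasDerivAt_const y x) (hasDerivAt_id y)
      simpa using this) (by
      refine ContinuousOn.intervalIntegrable ?_
      rw [uIcc_of_le hY]
      exact (((continuous_nl hp).comp_continuousOn h.cf).const_smul (1 / 4 : ℝ)).comp
        (f := fun y : ℝ => (x, y)) (by fun_prop) (fun y hy => hR ⟨hx, hy⟩))
  have e3 : ∫ x in (-1)..X, ∫ y in (-1)..Y, (1 / 4 : ℝ) • nl p (f x y)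
      = ∫ x in (-1)..X, (P x Y - P x (-1)) := by
    refine intervalIntegral.integral_congr fun x hx => ?_
    rw [uIcc_of_le hX] at hx
    exact e2 x hx
  have m1 : Y ∈ Icc (-1) Y := ⟨hY, le_rfl⟩
  have m2 : (-1 : ℝ) ∈ Icc (-1) Y := ⟨le_rfl, hY⟩
  rw [e3, intervalIntegral.integral_sub (i1 _ m1) (i1 _ m2), e1 _ m1, e1 _ m2]
  module

theorem NSol.uniq (hp : 1 < p) (h : NSol p O f P Q R S)
    (cF : Continuous (fun q : ℝ × ℝ => F q.1 q.2)) {X Y : ℝ} (hX : -1 ≤ X) (hY : -1 ≤ Y)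
    (hR : Icc (-1) X ×ˢ Icc (-1) Y ⊆ O)
    (hF : ∀ x ∈ Icc (-1) X, ∀ y ∈ Icc (-1) Y, F x y = f x (-1) + f (-1) y - f (-1) (-1)
        + ∫ x in (-1)..x, ∫ y in (-1)..y, (1 / 4 : ℝ) • nl p (F x y)) : f X Y = F X Y := by
  set g : ℝ → ℝ → V := fun x y => f (max (-1) (min x X)) (max (-1) (min y Y)) with hg
  have cg : Continuous (fun q : ℝ × ℝ => g q.1 q.2) := by
    refine h.cf.comp_continuous (f := fun q : ℝ × ℝ => (max (-1) (min q.1 X), max (-1) (min q.2 Y)))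
      (by fun_prop) fun q => hR ⟨⟨?_, ?_⟩, ⟨?_, ?_⟩⟩
    · exact le_max_left _ _
    · exact max_le hX (min_le_right _ _)
    · exact le_max_left _ _
    · exact max_le hY (min_le_right _ _)
  have eg : ∀ x ∈ Icc (-1) X, ∀ y ∈ Icc (-1) Y, g x y = f x y := fun x hx y hy => by
    simp only [hg, min_eq_left hx.2, max_eq_right hx.1, min_eq_left hy.2, max_eq_right hy.1]
  have key := uniq0 hp cg cF hX hY (fun x hx y hy => ?_) hF
  · rwa [eg X ⟨hX, le_rfl⟩ Y ⟨hY, le_rfl⟩] at key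
  · rw [eg x hx y hy, h.int_eq hp hx.1 hy.1
      (fun q hq => hR ⟨⟨hq.1.1, hq.1.2.trans hx.2⟩, ⟨hq.2.1, hq.2.2.trans hy.2⟩⟩)]
    congr 1
    refine intervalIntegral.integral_congr fun x' hx' => ?_
    rw [uIcc_of_le hx.1] at hx'
    refine intervalIntegral.integral_congr fun y' hy' => ?_
    rw [uIcc_of_le hy.1] at hy'
    rw [eg x' ⟨hx'.1, hx'.2.trans hx.2⟩ y' ⟨hy'.1, hy'.2.trans hy.2⟩]

end PartEighteen

section PartNineteen
variable {V : Type*} [NormedAddCommGroup V] [InnerProductSpace ℝ V]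
variable {p : ℝ} {O : Set (ℝ × ℝ)} {u A B C G : ℝ → ℝ → V}

theorem ext_sq [CompleteSpace V] (hp : 1 < p) (h : Sol p O u A B C G) {e ε : ℝ}
    (he : 0 < e) (he1 : e ≤ 1 / 4)
    (hε : 0 < ε) (hsm : p * (4 * ε) ^ (p - 1) ≤ 1 / 4)
    (hOa : ∀ r ∈ Icc (-1) e, ((r + 1) / 2, (r - 1) / 2) ∈ O)
    (hOb : ∀ r ∈ Icc (-1) e, (-(r + 1) / 2, (r - 1) / 2) ∈ O)
    (ha : ∀ r ∈ Icc (-1) e, ‖u ((r + 1) / 2) ((r - 1) / 2)‖ ≤ ε)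
    (hb : ∀ r ∈ Icc (-1) e, ‖u (-(r + 1) / 2) ((r - 1) / 2)‖ ≤ ε) :
    ∃ U A' B' C' G' : ℝ → ℝ → V,
      Sol p {q : ℝ × ℝ | q.1 + q.2 ∈ Ioo (-1) e ∧ q.2 - q.1 ∈ Ioo (-1) e} U A' B' C' G' ∧
      ∀ x t, x + t ∈ Ioo (-1) e → t - x ∈ Ioo (-1) e →
        (∀ x' t', -1 ≤ t' → |x' - x| ≤ t - t' → (x', t') ∈ O) → U x t = u x t := by
  obtain ⟨P, Q, R, S, hN⟩ := h.toNSol hp rfl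
  set f : ℝ → ℝ → V := fun x t => u ((1/2) * x + (-1/2) * t) ((1/2) * x + (1/2) * t) with hf
  set O' := {q : ℝ × ℝ | ((1/2) * q.1 + (-1/2) * q.2, (1/2) * q.1 + (1/2) * q.2) ∈ O} with hO'
  have mO : ∀ x y, (x, y) ∈ O' ↔ ((1/2) * x + (-1/2) * y, (1/2) * x + (1/2) * y) ∈ O :=
    fun x y => Iff.rfl
  have m1 : ∀ r ∈ Icc (-1) e, (r, (-1 : ℝ)) ∈ O' := fun r hr => by
    rw [mO]; convert hOa r hr using 2 <;> ring
  have m2 : ∀ r ∈ Icc (-1) e, ((-1 : ℝ), r) ∈ O' := fun r hr => by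
    rw [mO]; convert hOb r hr using 2 <;> ring
  have f1 : ∀ r, f r (-1) = u ((r + 1) / 2) ((r - 1) / 2) := fun r => by
    simp only [hf]; congr 1 <;> ring
  have f2 : ∀ r, f (-1) r = u (-(r + 1) / 2) ((r - 1) / 2) := fun r => by
    simp only [hf]; congr 1 <;> ring
  have d1 : ∀ {g b a : ℝ → ℝ → V}, ∀ r ∈ Icc (-1) e, HasFDerivAt (fun q : ℝ × ℝ => g q.1 q.2)
      (lin (b r (-1)) (a r (-1))) (r, (-1 : ℝ)) → HasDerivAt (fun r => g r (-1)) (b r (-1)) r := by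
    intro g b a r _ hg
    have := lin_comp (X := fun x => x) (S := fun _ => -1) hg (hasDerivAt_id r)
      (hasDerivAt_const r (-1))
    simpa using this
  have d2 : ∀ {g b a : ℝ → ℝ → V}, ∀ r ∈ Icc (-1) e, HasFDerivAt (fun q : ℝ × ℝ => g q.1 q.2)
      (lin (b (-1) r) (a (-1) r)) ((-1 : ℝ), r) → HasDerivAt (fun r => g (-1) r) (a (-1) r) r := by
    intro g b a r _ hg
    have := lin_comp (X := fun _ => -1) (S := fun y => y) hg (hasDerivAt_const r (-1))
      (hasDerivAt_id r)
    simpa using this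
  have I := Ioo_subset_Icc_self (a := (-1 : ℝ)) (b := e)
  have a1 : ∀ r ∈ Icc (-1) e, HasDerivAt (fun r => f r (-1)) (P r (-1)) r := fun r hr =>
    d1 r hr (hN.df r (-1) (m1 r hr))
  have a2 : ∀ r ∈ Icc (-1) e, HasDerivAt (fun r => P r (-1)) (R r (-1)) r := fun r hr =>
    d1 (g := P) (b := R) (a := fun x t => (1 / 4 : ℝ) • nl p (f x t)) r hr (hN.dP r (-1) (m1 r hr))
  have b1 : ∀ r ∈ Icc (-1) e, HasDerivAt (fun r => f (-1) r) (Q (-1) r) r := fun r hr =>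
    d2 r hr (hN.df (-1) r (m2 r hr))
  have b2 : ∀ r ∈ Icc (-1) e, HasDerivAt (fun r => Q (-1) r) (S (-1) r) r := fun r hr =>
    d2 (g := Q) (b := fun x t => (1 / 4 : ℝ) • nl p (f x t)) (a := S) r hr (hN.dQ (-1) r (m2 r hr))
  have a3 : ContinuousOn (fun r => R r (-1)) (Ioo (-1) e) :=
    hN.cR.comp (f := fun r : ℝ => (r, (-1 : ℝ))) (by fun_prop) (fun r hr => m1 r (I hr))
  have b3 : ContinuousOn (fun r => S (-1) r) (Ioo (-1) e) :=
    hN.cS.comp (f := fun r : ℝ => ((-1 : ℝ), r)) (by fun_prop) (fun r hr => m2 r (I hr))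
  have e1 : -1 < e := by linarith
  obtain ⟨F, cF, hF⟩ := goursat hp (a := fun r => f r (-1)) (b := fun r => f (-1) r) e1 he1
    (fun r hr => (a1 r hr).continuousAt.continuousWithinAt)
    (fun r hr => (b1 r hr).continuousAt.continuousWithinAt)
    (fun r hr => by simp only [f1]; exact ha r hr)
    (fun r hr => by simp only [f2]; exact hb r hr) hε hsm
  obtain ⟨P', Q', R', S', hN'⟩ := reg hp cF e1 (fun r hr => a1 r (I hr)) (fun r hr => a2 r (I hr))
    a3 (fun r hr => b1 r (I hr)) (fun r hr => b2 r (I hr)) b3 hF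
  obtain ⟨A', B', C', G', hS⟩ := hN'.toSol hp
    (O' := {q : ℝ × ℝ | q.1 + q.2 ∈ Ioo (-1) e ∧ q.2 - q.1 ∈ Ioo (-1) e}) (by
      ext q
      have r1 : 1 * q.1 + 1 * q.2 = q.1 + q.2 := by ring
      have r2 : -1 * q.1 + 1 * q.2 = q.2 - q.1 := by ring
      simp only [mem_setOf_eq, mem_prod, r1, r2])
  refine ⟨_, A', B', C', G', hS, fun x t hx ht hcone => ?_⟩
  have r1 : 1 * x + 1 * t = x + t := by ring
  have r2 : -1 * x + 1 * t = t - x := by ring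
  simp only [r1, r2]
  rw [← hN.uniq hp cF hx.1.le ht.1.le ?_ ?_]
  · simp only [hf]; congr 1 <;> ring
  · rintro ⟨r, l⟩ ⟨hr, hl⟩
    simp only [mem_Icc] at hr hl
    rw [mO]
    refine hcone _ _ (by linarith) (abs_le.2 ⟨by linarith, by linarith⟩)
  · intro r hr l hl
    exact hF r ⟨hr.1, hr.2.trans hx.2.le⟩ l ⟨hl.1, hl.2.trans ht.2.le⟩

theorem Sol.smooth (hp : 1 < p) (h : Sol p O u A B C G) :
    ContDiffOn ℝ 2 (fun q : ℝ × ℝ => u q.1 q.2) O := by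
  have clin : ∀ {b a : ℝ → ℝ → V}, ContDiffOn ℝ 1 (fun q : ℝ × ℝ => b q.1 q.2) O →
      ContDiffOn ℝ 1 (fun q : ℝ × ℝ => a q.1 q.2) O →
      ContDiffOn ℝ 1 (fun q : ℝ × ℝ => lin (b q.1 q.2) (a q.1 q.2)) O := fun hb ha =>
    ((ContinuousLinearMap.smulRightL ℝ (ℝ × ℝ) V (ContinuousLinearMap.fst ℝ ℝ ℝ)).contDiff.comp_contDiffOn
      hb).add ((ContinuousLinearMap.smulRightL ℝ (ℝ × ℝ) V
        (ContinuousLinearMap.snd ℝ ℝ ℝ)).contDiff.comp_contDiffOn ha)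
  have clin0 : ∀ {b a : ℝ → ℝ → V}, ContinuousOn (fun q : ℝ × ℝ => b q.1 q.2) O →
      ContinuousOn (fun q : ℝ × ℝ => a q.1 q.2) O →
      ContinuousOn (fun q : ℝ × ℝ => lin (b q.1 q.2) (a q.1 q.2)) O := fun hb ha =>
    ((ContinuousLinearMap.smulRightL ℝ (ℝ × ℝ) V (ContinuousLinearMap.fst ℝ ℝ ℝ)).continuous.comp_continuousOn
      hb).add ((ContinuousLinearMap.smulRightL ℝ (ℝ × ℝ) V
        (ContinuousLinearMap.snd ℝ ℝ ℝ)).continuous.comp_continuousOn ha)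
  have one : ∀ {g b a : ℝ → ℝ → V}, (∀ x t, (x, t) ∈ O → HasFDerivAt (fun q : ℝ × ℝ => g q.1 q.2)
      (lin (b x t) (a x t)) (x, t)) → ContinuousOn (fun q : ℝ × ℝ => b q.1 q.2) O →
      ContinuousOn (fun q : ℝ × ℝ => a q.1 q.2) O →
      ContDiffOn ℝ 1 (fun q : ℝ × ℝ => g q.1 q.2) O := fun {g b a} hg hb ha => by
    refine (contDiffOn_succ_iff_hasFDerivWithinAt_of_uniqueDiffOn (n := 0) h.op.uniqueDiffOn).2
      ⟨by simp, fun q => lin (b q.1 q.2) (a q.1 q.2), contDiffOn_zero.2 (clin0 hb ha), fun q hq =>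
        (hg q.1 q.2 hq).hasFDerivWithinAt⟩
  have cN : ContinuousOn (fun q : ℝ × ℝ => G q.1 q.2 + nl p (u q.1 q.2)) O :=
    h.cG.add ((continuous_nl hp).comp_continuousOn h.cu)
  have hA := one (g := A) (b := C) (a := fun x t => G x t + nl p (u x t)) h.dA h.cC cN
  have hB := one (g := B) h.dB h.cG h.cC
  exact (contDiffOn_succ_iff_hasFDerivWithinAt_of_uniqueDiffOn (n := 1) h.op.uniqueDiffOn).2
      ⟨by simp, fun q => lin (B q.1 q.2) (A q.1 q.2), clin hB hA, fun q hq =>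
        (h.du q.1 q.2 hq).hasFDerivWithinAt⟩

theorem dd_congr {f g a b : ℝ → ℝ → V} {W : Set (ℝ × ℝ)} (hW : IsOpen W)
    (hfg : ∀ x t, (x, t) ∈ W → f x t = g x t) {x t : ℝ} (hx : (x, t) ∈ W) :
    deriv (fun τ => deriv (fun τ' => f x τ') τ) t = deriv (fun τ => deriv (fun τ' => g x τ') τ) t ∧
    deriv (fun z => deriv (fun z' => f z' t) z) x = deriv (fun z => deriv (fun z' => g z' t) z) x := by
  have n1 : ∀ {x t}, (x, t) ∈ W → ∀ᶠ τ in nhds t, (x, τ) ∈ W := fun {x t} h =>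
    (Continuous.continuousAt (f := fun τ : ℝ => (x, τ)) (by fun_prop)).preimage_mem_nhds
      (hW.mem_nhds h)
  have n2 : ∀ {x t}, (x, t) ∈ W → ∀ᶠ z in nhds x, (z, t) ∈ W := fun {x t} h =>
    (Continuous.continuousAt (f := fun z : ℝ => (z, t)) (by fun_prop)).preimage_mem_nhds
      (hW.mem_nhds h)
  constructor
  · refine EventuallyEq.deriv_eq ?_
    filter_upwards [n1 hx] with τ hτ
    refine EventuallyEq.deriv_eq ?_
    filter_upwards [n1 hτ] with τ' h'
    exact hfg _ _ h'
  · refine EventuallyEq.deriv_eq ?_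
    filter_upwards [n2 hx] with τ hτ
    refine EventuallyEq.deriv_eq ?_
    filter_upwards [n2 hτ] with τ' h'
    exact hfg _ _ h'

theorem Sol.eqn (h : Sol p O u A B C G) {x t : ℝ} (hx : (x, t) ∈ O) :
    deriv (fun τ => deriv (fun τ' => u x τ') τ) t =
        deriv (fun z => deriv (fun z' => u z' t) z) x + ‖u x t‖ ^ (p - 1) • u x t := by
  have n1 : ∀ᶠ τ in nhds t, (x, τ) ∈ O :=
    (Continuous.continuousAt (f := fun τ : ℝ => (x, τ)) (by fun_prop)).preimage_mem_nhds
      (h.op.mem_nhds hx)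
  have n2 : ∀ᶠ z in nhds x, (z, t) ∈ O :=
    (Continuous.continuousAt (f := fun z : ℝ => (z, t)) (by fun_prop)).preimage_mem_nhds
      (h.op.mem_nhds hx)
  have d1 : ∀ {g b a : ℝ → ℝ → V} {x t : ℝ}, HasFDerivAt (fun q : ℝ × ℝ => g q.1 q.2)
      (lin (b x t) (a x t)) (x, t) → HasDerivAt (fun z => g z t) (b x t) x := by
    intro g b a x t hg
    simpa using lin_comp (X := fun x => x) (S := fun _ => t) hg (hasDerivAt_id x)
      (hasDerivAt_const x t)
  have d2 : ∀ {g b a : ℝ → ℝ → V} {x t : ℝ}, HasFDerivAt (fun q : ℝ × ℝ => g q.1 q.2)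
      (lin (b x t) (a x t)) (x, t) → HasDerivAt (fun τ => g x τ) (a x t) t := by
    intro g b a x t hg
    simpa using lin_comp (X := fun _ => x) (S := fun y => y) hg (hasDerivAt_const t x)
      (hasDerivAt_id t)
  have e1 : deriv (fun τ => deriv (fun τ' => u x τ') τ) t = G x t + nl p (u x t) := by
    rw [EventuallyEq.deriv_eq (f := fun τ => A x τ)]
    · exact (d2 (g := A) (b := C) (a := fun x t => G x t + nl p (u x t)) (h.dA x t hx)).deriv
    · filter_upwards [n1] with τ hτ
      exact (d2 (h.du x τ hτ)).deriv
  have e2 : deriv (fun z => deriv (fun z' => u z' t) z) x = G x t := by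
    rw [EventuallyEq.deriv_eq (f := fun z => B z t)]
    · exact (d1 (g := B) (h.dB x t hx)).deriv
    · filter_upwards [n2] with z hz
      exact (d1 (h.du z t hz)).deriv
  rw [e1, e2]; rfl

end PartNineteen

section PartTwenty
variable {V : Type*} [NormedAddCommGroup V] [InnerProductSpace ℝ V]

set_option maxHeartbeats 1000000 in
theorem no_small [CompleteSpace V] {p : ℝ} (hp : 1 < p) {T : ℝ → ℝ} (hTpos : ∀ x, 0 < T x)
    (hTlip : LipschitzWith 1 T) {u : ℝ → ℝ → V}
    (hreg : ContDiffOn ℝ 2 (fun q : ℝ × ℝ => u q.1 q.2)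
      {q : ℝ × ℝ | 0 ≤ q.2 ∧ q.2 < T q.1})
    (heq : ∀ x t, 0 ≤ t → t < T x →
      deriv (fun τ => deriv (fun τ' => u x τ') τ) t =
        deriv (fun z => deriv (fun z' => u z' t) z) x + ‖u x t‖ ^ (p - 1) • u x t)
    (hmax : ¬ ∃ (T' : ℝ → ℝ) (u' : ℝ → ℝ → V),
      LipschitzWith 1 T' ∧ T ≤ T' ∧ T ≠ T' ∧
      ContDiffOn ℝ 2 (fun q : ℝ × ℝ => u' q.1 q.2) {q : ℝ × ℝ | 0 ≤ q.2 ∧ q.2 < T' q.1} ∧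
      (∀ x t, 0 ≤ t → t < T' x →
        deriv (fun τ => deriv (fun τ' => u' x τ') τ) t =
          deriv (fun z => deriv (fun z' => u' z' t) z) x + ‖u' x t‖ ^ (p - 1) • u' x t) ∧
      (∀ x t, 0 ≤ t → t < T x → u' x t = u x t))
    {x0 δ : ℝ} (hδ : δ ∈ Ioo (0 : ℝ) 1) (hnc : ∀ x t, (x, t) ≠ (x0, T x0) →
      0 ≤ t → t ≤ T x0 - δ * |x - x0| → t < T x)
    {e ε h : ℝ} (he : 0 < e) (he1 : e ≤ 1 / 4) (hδe : δ * (1 + e) ≤ 1 - e) (hε : 0 < ε)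
    (hsm : p * (4 * ε) ^ (p - 1) ≤ 1 / 4) (hh : 0 < h) (hhT : h < T x0)
    (ha : ∀ r ∈ Icc (-1) e, ‖h ^ al p • u (x0 + h * ((r + 1) / 2)) (T x0 + h * ((r - 1) / 2))‖ ≤ ε)
    (hb : ∀ r ∈ Icc (-1) e,
      ‖h ^ al p • u (x0 + h * (-(r + 1) / 2)) (T x0 + h * ((r - 1) / 2))‖ ≤ ε) : False := by
  have cT := hTlip.continuous
  set O := {q : ℝ × ℝ | 0 < q.2 ∧ q.2 < T q.1} with hO
  have oO : IsOpen O := (isOpen_lt continuous_const continuous_snd).inter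
    (isOpen_lt continuous_snd (cT.comp continuous_fst))
  have hS := sol_of_C2 oO (hreg.mono fun q hq => ⟨hq.1.le, hq.2⟩)
    (fun x t hq => heq x t hq.1.le hq.2)
  have hS1 := hS.scale hp x0 (T x0) hh
  have seg : ∀ r ∈ Icc (-1) e, ∀ s : ℝ, |s| ≤ (r + 1) / 2 →
      (s, (r - 1) / 2) ∈ {q : ℝ × ℝ | (x0 + h * q.1, T x0 + h * q.2) ∈ O} := by
    intro r hr s hs
    have t0 : 0 < T x0 + h * ((r - 1) / 2) := by nlinarith [hr.1]
    refine ⟨t0, hnc _ _ ?_ t0.le ?_⟩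
    · intro hc
      have := (Prod.ext_iff.1 hc).2
      simp only at this
      nlinarith [hr.2]
    · have e1 : x0 + h * s - x0 = h * s := by ring
      rw [e1, abs_mul, abs_of_pos hh]
      have h1 : δ * |s| ≤ δ * ((r + 1) / 2) := mul_le_mul_of_nonneg_left hs hδ.1.le
      have h2 : δ * (1 + r) ≤ δ * (1 + e) := mul_le_mul_of_nonneg_left (by linarith [hr.2]) hδ.1.le
      have h3 : δ * |s| ≤ -((r - 1) / 2) := by linarith [hr.2]
      have := mul_le_mul_of_nonneg_left h3 hh.le
      linarith
  obtain ⟨U, A', B', C', G', hU, hUu⟩ := ext_sq hp hS1 he he1 hε hsm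
    (fun r hr => seg r hr _ (by rw [abs_of_nonneg]; linarith [hr.1]))
    (fun r hr => seg r hr _ (by rw [neg_div, abs_neg, abs_of_nonneg]; linarith [hr.1])) ha hb
  have hS2 := hU.scale hp (-(1 / h) * x0) (-(1 / h) * T x0) (k := 1 / h) (by positivity)
  set Sq := {q : ℝ × ℝ | (-(1 / h) * x0 + 1 / h * q.1, -(1 / h) * T x0 + 1 / h * q.2) ∈
    {q : ℝ × ℝ | q.1 + q.2 ∈ Ioo (-1) e ∧ q.2 - q.1 ∈ Ioo (-1) e}} with hSq
  set U2 : ℝ → ℝ → V := fun x t =>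
    (1 / h) ^ al p • U (-(1 / h) * x0 + 1 / h * x) (-(1 / h) * T x0 + 1 / h * t) with hU2
  have lipT : ∀ x x', T x ≤ T x' + |x' - x| := fun x x' => by
    have := hTlip.dist_le_mul x x'
    rw [Real.dist_eq, Real.dist_eq] at this
    have h2 := le_abs_self (T x - T x')
    rw [abs_sub_comm x x'] at this
    simp only [NNReal.coe_one, one_mul] at this
    linarith
  have agree : ∀ x t, (x, t) ∈ Sq → t < T x → U2 x t = u x t := by
    intro x t hq ht
    have ex : x0 + h * (-(1 / h) * x0 + 1 / h * x) = x := by field_simp; ring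
    have et : T x0 + h * (-(1 / h) * T x0 + 1 / h * t) = t := by field_simp; ring
    have := hUu (-(1 / h) * x0 + 1 / h * x) (-(1 / h) * T x0 + 1 / h * t) hq.1 hq.2 (by
      intro x' t' h1 h2
      have t0 : 0 < T x0 + h * t' := by nlinarith
      refine ⟨t0, ?_⟩
      have h3 := lipT x (x0 + h * x')
      have h4 : |x0 + h * x' - x| ≤ t - (T x0 + h * t') := by
        have h5 := mul_le_mul_of_nonneg_left h2 hh.le
        have e2 : x0 + h * x' - x = h * (x' - (-(1 / h) * x0 + 1 / h * x)) := by linarith [ex]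
        rw [e2, abs_mul, abs_of_pos hh]
        linarith [et]
      change T x0 + h * t' < T (x0 + h * x')
      linarith)
    simp only [hU2, this, ex, et, smul_smul]
    rw [← mul_rpow (by positivity) hh.le, one_div_mul_cancel hh.ne', one_rpow, one_smul]
  set e' := e * (1 - δ) / 2 with he'
  have e'0 : 0 < e' := by have := hδ.2; have : 0 < 1 - δ := by linarith
                          positivity
  set T' : ℝ → ℝ := fun x => max (T x) (T x0 + h * e' - |x - x0|) with hT'
  set u' : ℝ → ℝ → V := fun x t => if t < T x then u x t else U2 x t with hu'
  have inSq : ∀ x t, 0 ≤ t → T x ≤ t → t < T' x → (x, t) ∈ Sq := by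
    intro x t t0 h1 h2
    have h3 : t < T x0 + h * e' - |x - x0| := by
      rcases lt_max_iff.1 h2 with h | h
      · linarith
      · exact h
    have h4 : T x0 - δ * |x - x0| ≤ T x := by
      by_contra hcon
      push Not at hcon
      have := hnc x (T x) (fun hc => by
        have e1 := (Prod.ext_iff.1 hc).1
        simp only at e1
        rw [e1] at hcon; simp at hcon) (hTpos x).le hcon.le
      exact lt_irrefl _ this
    set X := -(1 / h) * x0 + 1 / h * x with hX
    set Y := -(1 / h) * T x0 + 1 / h * t with hY
    have ex : x - x0 = h * X := by rw [hX]; field_simp; ring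
    have et : t - T x0 = h * Y := by rw [hY]; field_simp; ring
    rw [ex, abs_mul, abs_of_pos hh] at h3 h4
    have h5 : Y < e' - |X| := by
      refine lt_of_mul_lt_mul_left ?_ hh.le
      linarith
    have h6 : -δ * |X| ≤ Y := by
      refine le_of_mul_le_mul_left ?_ hh
      linarith
    have h7 : |X| ≤ e / 2 := by
      have hd : 0 < 1 - δ := by linarith [hδ.2]
      refine le_of_mul_le_mul_left ?_ hd
      linarith
    have a1 := abs_le.1 (le_refl |X|)
    have h8 : e' ≤ e / 2 := by
      have := mul_pos he hδ.1
      rw [he']; linarith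
    have h9 : δ * |X| ≤ |X| := mul_le_of_le_one_left (abs_nonneg _) hδ.2.le
    refine ⟨⟨?_, ?_⟩, ⟨?_, ?_⟩⟩
    · change -1 < X + Y; linarith
    · change X + Y < e; linarith
    · change -1 < Y - X; linarith
    · change Y - X < e; linarith
  have oW : IsOpen {q : ℝ × ℝ | q.2 < T q.1} := isOpen_lt continuous_snd (cT.comp continuous_fst)
  have w1 : ∀ x t, (x, t) ∈ {q : ℝ × ℝ | q.2 < T q.1} → u' x t = u x t := fun x t h => if_pos h
  have w2 : ∀ x t, (x, t) ∈ Sq → u' x t = U2 x t := fun x t h => by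
    by_cases ht : t < T x
    · simp only [hu', if_pos ht]; exact (agree x t h ht).symm
    · simp only [hu', if_neg ht]
  refine hmax ⟨T', u', ?_, fun x => le_max_left _ _, ?_, ?_, ?_, fun x t _ ht => w1 x t ht⟩
  · have l1 : LipschitzWith 1 (fun x : ℝ => T x0 + h * e' - |x - x0|) := by
      refine LipschitzWith.of_dist_le_mul fun x y => ?_
      rw [Real.dist_eq, Real.dist_eq]
      have := abs_abs_sub_abs_le_abs_sub (y - x0) (x - x0)
      have e1 : T x0 + h * e' - |x - x0| - (T x0 + h * e' - |y - x0|) = |y - x0| - |x - x0| := by ring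
      have e2 : y - x0 - (x - x0) = y - x := by ring
      rw [e1]
      rw [e2, abs_sub_comm y x] at this
      simpa using this
    simpa using hTlip.max l1
  · intro hc
    have h1 := congrFun hc x0
    have h2 : T x0 + h * e' - |x0 - x0| ≤ T' x0 := le_max_right _ _
    rw [← h1, sub_self, abs_zero] at h2
    have := mul_pos hh e'0
    linarith
  · rintro ⟨x, t⟩ ⟨ht0, ht1⟩
    by_cases ht : t < T x
    · have h1 := hreg (x, t) ⟨ht0, ht⟩
      have n1 : {q : ℝ × ℝ | q.2 < T q.1} ∈ nhds (x, t) := oW.mem_nhds ht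
      have h2 := h1.mono_of_mem_nhdsWithin (t := {q : ℝ × ℝ | 0 ≤ q.2 ∧ q.2 < T' q.1}) (by
        filter_upwards [mem_nhdsWithin_of_mem_nhds n1, self_mem_nhdsWithin] with q hq hq2
        exact ⟨hq2.1, hq⟩)
      refine h2.congr_of_eventuallyEq ?_ (w1 x t ht)
      filter_upwards [mem_nhdsWithin_of_mem_nhds n1] with q hq
      exact w1 q.1 q.2 hq
    · have hm := inSq x t ht0 (not_lt.1 ht) ht1
      have h1 := (hS2.smooth hp).contDiffAt (hS2.op.mem_nhds hm)
      refine (h1.congr_of_eventuallyEq ?_).contDiffWithinAt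
      filter_upwards [hS2.op.mem_nhds hm] with q hq
      exact w2 q.1 q.2 hq
  · intro x t ht0 ht1
    by_cases ht : t < T x
    · obtain ⟨e1, e2⟩ := dd_congr (a := u) (b := u) oW w1 (x := x) (t := t) ht
      rw [e1, e2, w1 x t ht]
      exact heq x t ht0 ht
    · have hm := inSq x t ht0 (not_lt.1 ht) ht1
      obtain ⟨e1, e2⟩ := dd_congr (a := u) (b := u) hS2.op w2 hm
      rw [e1, e2, w2 x t hm]
      exact hS2.eqn hm

end PartTwenty

section PartTwentyOne

theorem seq_crit {f : ℝ → ℝ} {l : ℝ} (H : ∀ σ : ℕ → ℝ, (∀ n, 0 ≤ σ n) → Tendsto σ atTop atTop →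
    ∃ φ : ℕ → ℕ, Tendsto (fun n => f (σ (φ n))) atTop (nhds l)) : Tendsto f atTop (nhds l) := by
  refine tendsto_of_subseq_tendsto fun ns hns => ?_
  obtain ⟨N, hN⟩ := eventually_atTop.1 (hns.eventually_ge_atTop 0)
  obtain ⟨φ, hφ⟩ := H (fun n => ns (n + N)) (fun n => hN _ (by omega))
    (hns.comp (tendsto_add_atTop_nat N))
  exact ⟨fun n => φ n + N, hφ⟩

variable {V : Type*} [NormedAddCommGroup V] [InnerProductSpace ℝ V] {p : ℝ}
  {w v z vy zy : ℝ → ℝ → V} {K : ℝ}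

theorem WB.fE_seq (hp : 1 < p) (h : WB p w v z vy zy K) {σ : ℕ → ℝ} (h0 : ∀ n, 0 ≤ σ n)
    {W Z : ℝ → V}
    (hw : TendstoUniformlyOn (fun n y => w y (σ n)) W atTop (Icc (-1) 1))
    (hz : TendstoUniformlyOn (fun n y => z y (σ n)) Z atTop (Icc (-1) 1))
    (hv : TendstoUniformlyOn (fun n y => v y (σ n)) (fun _ => 0) atTop (Icc (-1) 1)) :
    Tendsto (fun n => fE p w v z (σ n)) atTop (nhds (eS p W Z)) := by
  have K0 : 0 ≤ K := (norm_nonneg _).trans (h.bw 0 (by norm_num) 0 le_rfl)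
  have ha := al_pos hp
  unfold fE eS II
  refine int_lim (k := sig p) (by norm_num) (sig_int hp)
    (K := 1 / 2 * K ^ 2 + 1 / 2 * K ^ 2 + al p * (al p + 1) / 2 * K ^ 2 + K ^ (p + 1) / (p + 1)) ?_ ?_ ?_
  · intro n
    have cw := WSys.slice h.sys.cw (memJ (h0 n))
    have cv := WSys.slice h.sys.cv (memJ (h0 n))
    have cz := WSys.slice h.sys.cz (memJ (h0 n))
    have cp := cont_pow hp cw
    fun_prop
  · intro n y hy
    have b1 := h.bw y hy _ (h0 n)
    have b2 := h.bv y hy _ (h0 n)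
    have b3 := h.bz y hy _ (h0 n)
    have q0 : 0 ≤ 1 - y ^ 2 := by nlinarith [hy.1, hy.2]
    have q1 : 1 - y ^ 2 ≤ 1 := by nlinarith [sq_nonneg y]
    have p1 : 0 < p + 1 := by linarith
    have c1 : ‖w y (σ n)‖ ^ 2 ≤ K ^ 2 := by gcongr
    have c2 : ‖v y (σ n)‖ ^ 2 ≤ K ^ 2 := by gcongr
    have c3 : ‖z y (σ n)‖ ^ 2 ≤ K ^ 2 := by gcongr
    have c4 : ‖w y (σ n)‖ ^ (p + 1) / (p + 1) ≤ K ^ (p + 1) / (p + 1) := by gcongr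
    have c5 : 0 ≤ ‖w y (σ n)‖ ^ (p + 1) / (p + 1) := by positivity
    have c6 : ‖z y (σ n)‖ ^ 2 * (1 - y ^ 2) ≤ K ^ 2 :=
      (mul_le_of_le_one_right (by positivity) q1).trans c3
    have c7 : 0 ≤ ‖z y (σ n)‖ ^ 2 * (1 - y ^ 2) := by positivity
    have c8 : al p * (al p + 1) / 2 * ‖w y (σ n)‖ ^ 2 ≤ al p * (al p + 1) / 2 * K ^ 2 := by gcongr
    have c9 : 0 ≤ al p * (al p + 1) / 2 * ‖w y (σ n)‖ ^ 2 := by positivity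
    have c10 := sq_nonneg ‖v y (σ n)‖
    have d1 : |1 / 2 * ‖v y (σ n)‖ ^ 2 + 1 / 2 * ‖z y (σ n)‖ ^ 2 * (1 - y ^ 2)
        + al p * (al p + 1) / 2 * ‖w y (σ n)‖ ^ 2 - ‖w y (σ n)‖ ^ (p + 1) / (p + 1)|
        ≤ 1 / 2 * K ^ 2 + 1 / 2 * K ^ 2 + al p * (al p + 1) / 2 * K ^ 2 + K ^ (p + 1) / (p + 1) := by
      rw [abs_le]; constructor <;> linarith
    rw [Real.norm_eq_abs, abs_mul, abs_of_nonneg q0]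
    exact (mul_le_of_le_one_left (abs_nonneg _) q1).trans d1
  · intro y hy
    have a1 := (hw.tendsto_at hy).norm
    have a2 := (hz.tendsto_at hy).norm
    have a3 := (hv.tendsto_at hy).norm
    have a4 : Tendsto (fun n => ‖w y (σ n)‖ ^ (p + 1)) atTop (nhds (‖W y‖ ^ (p + 1))) :=
      a1.rpow_const (Or.inr (by linarith))
    have := (((((a3.pow 2).const_mul (1 / 2)).add (((a2.pow 2).const_mul (1 / 2)).mul_const (1 - y ^ 2))).add
      ((a1.pow 2).const_mul (al p * (al p + 1) / 2))).sub (a4.div_const (p + 1))).const_mul (1 - y ^ 2)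
    simpa using this

noncomputable def cst (p : ℝ) : ℝ :=
  (1 / 2 - 1 / (p + 1)) * (al p * (al p + 1)) * (kappa0 p ^ 2 * ∫ y in (-1 : ℝ)..1, rho p y)

theorem cst_pos (hp : 1 < p) : 0 < cst p := by
  have ha := al_pos hp
  have hk := (kappa0_pow hp).1
  have hr : 0 < ∫ y in (-1 : ℝ)..1, rho p y := by
    refine intervalIntegral.intervalIntegral_pos_of_pos_on
      ((continuous_rho hp).intervalIntegrable _ _) (fun y hy => ?_) (by norm_num)
    exact Real.rpow_pos_of_pos (by nlinarith [hy.1, hy.2]) _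
  have : 0 < 1 / 2 - 1 / (p + 1) := by
    rw [sub_pos]; exact one_div_lt_one_div_of_lt two_pos (by linarith)
  unfold cst; positivity

theorem WB.dich [FiniteDimensional ℝ V] (hp : 1 < p) (h : WB p w v z vy zy K) :
    (∀ ε > 0, ∃ S, ∀ s ≥ S, ∀ y ∈ Icc (-1 : ℝ) 1, ‖w y s‖ ≤ ε) ∨
    (Tendsto (fE p w v z) atTop (nhds (cst p)) ∧
      ∀ σ : ℕ → ℝ, (∀ n, 0 ≤ σ n) → Tendsto σ atTop atTop → ∃ φ : ℕ → ℕ, ∃ d ∈ Ioo (-1 : ℝ) 1,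
        ∃ Ω : V, ‖Ω‖ = 1 ∧
        TendstoUniformlyOn (fun n y => w y (σ (φ n))) (fun y => kappa p d y • Ω) atTop (Icc (-1) 1) ∧
        TendstoUniformlyOn (fun n y => z y (σ (φ n)))
          (fun y => (-(al p * d) / (1 + d * y) * kappa p d y) • Ω) atTop (Icc (-1) 1) ∧
        TendstoUniformlyOn (fun n y => v y (σ (φ n))) (fun _ => 0) atTop (Icc (-1) 1)) := by
  obtain ⟨e, he⟩ := h.fE_lim hp
  have key : ∀ σ : ℕ → ℝ, (∀ n, 0 ≤ σ n) → Tendsto σ atTop atTop → ∃ φ : ℕ → ℕ,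
      (e = 0 ∧ TendstoUniformlyOn (fun n y => w y (σ (φ n))) (fun _ => 0) atTop (Icc (-1) 1)) ∨
      (e = cst p ∧ ∃ d ∈ Ioo (-1 : ℝ) 1,
        ∃ Ω : V, ‖Ω‖ = 1 ∧
        TendstoUniformlyOn (fun n y => w y (σ (φ n))) (fun y => kappa p d y • Ω) atTop (Icc (-1) 1) ∧
        TendstoUniformlyOn (fun n y => z y (σ (φ n)))
          (fun y => (-(al p * d) / (1 + d * y) * kappa p d y) • Ω) atTop (Icc (-1) 1) ∧
        TendstoUniformlyOn (fun n y => v y (σ (φ n))) (fun _ => 0) atTop (Icc (-1) 1)) := by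
    intro σ h0 hσ
    obtain ⟨φ, hφ, W, Z, cW, cZ, hw, hz, hv⟩ := h.sub hp hσ
    have hσ' : Tendsto (fun n => σ (φ n)) atTop atTop := hσ.comp hφ.tendsto_atTop
    have st := h.stat hp hσ' cW cZ hw hz hv
    have lim := h.fE_seq hp (fun n => h0 (φ n)) hw hz hv
    have ee := tendsto_nhds_unique (he.comp hσ') lim
    refine ⟨φ, ?_⟩
    rcases st.classify hp with h1 | ⟨d, hd, Ω, hΩ, h1⟩
    · left
      have p1 : p + 1 ≠ 0 := by linarith
      refine ⟨?_, hw.congr_right fun y hy => (h1 y hy).1⟩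
      rw [ee]
      have : eS p W Z = II p (fun _ => 0) := by
        refine II_congr fun y hy => ?_
        rw [(h1 y hy).1, (h1 y hy).2]
        simp [Real.zero_rpow p1]
      rw [this]; simp [II]
    · right
      refine ⟨?_, d, hd, Ω, hΩ, hw.congr_right fun y hy => (h1 y hy).1,
        hz.congr_right fun y hy => (h1 y hy).2, hv⟩
      rw [ee, cst, ← eS_kappa hp hd hΩ]
      refine II_congr fun y hy => ?_
      rw [(h1 y hy).1, (h1 y hy).2]
  have hc := cst_pos hp
  by_cases e0 : e = 0
  · left
    by_contra hcon
    push Not at hcon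
    obtain ⟨ε, ε0, H⟩ := hcon
    choose σ hσ y hy hH using fun n : ℕ => H n
    have h0 : ∀ n, 0 ≤ σ n := fun n => (Nat.cast_nonneg n).trans (hσ n)
    obtain ⟨φ, ⟨_, h1⟩ | ⟨h1, _⟩⟩ := key σ h0 (tendsto_atTop_mono hσ tendsto_natCast_atTop_atTop)
    · obtain ⟨n, hn⟩ := (Metric.tendstoUniformlyOn_iff.1 h1 ε ε0).exists
      have h2 := hn (y (φ n)) (hy (φ n))
      rw [dist_zero_left] at h2
      exact absurd (hH (φ n)) (not_lt.2 h2.le)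
    · rw [h1] at e0; exact hc.ne' e0
  · right
    obtain ⟨φ, ⟨h1, _⟩ | ⟨h1, _⟩⟩ := key (fun n => n) (fun n => Nat.cast_nonneg n) tendsto_natCast_atTop_atTop
    · exact absurd h1 e0
    refine ⟨h1 ▸ he, fun σ h0 hσ => ?_⟩
    obtain ⟨φ, ⟨h1, _⟩ | ⟨_, h1⟩⟩ := key σ h0 hσ
    · exact absurd h1 e0
    · exact ⟨φ, h1⟩

end PartTwentyOne

section PartTwentyTwo
variable {V : Type*} [NormedAddCommGroup V] [InnerProductSpace ℝ V] {p : ℝ}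

theorem ss_bd {a K y s : ℝ} {g : ℝ → ℝ → V}
    (hg : ‖g (0 + y * exp (-s)) (0 - exp (-s))‖ ≤ K * (-(0 - exp (-s))) ^ (-a)) :
    ‖ss a 0 0 g y s‖ ≤ K := by
  have e1 : (-(0 - exp (-s))) ^ (-a) = exp (a * s) := by
    rw [zero_sub, neg_neg, ← Real.exp_mul]; congr 1; ring
  rw [e1] at hg
  unfold ss
  rw [norm_smul, Real.norm_eq_abs, abs_of_pos (exp_pos _)]
  calc exp (-a * s) * ‖g (0 + y * exp (-s)) (0 - exp (-s))‖ ≤ exp (-a * s) * (K * exp (a * s)) := by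
        gcongr
    _ = K * (exp (-a * s) * exp (a * s)) := by ring
    _ = K := by rw [← Real.exp_add]; simp

/-- from smallness on the light cone to smallness on a slightly larger cone -/
theorem cone_ext {u B : ℝ → ℝ → V} {L K ε c a t : ℝ} (t1 : -1 ≤ t) (t0 : t < 0) (c0 : 0 < c) (cL : 1 + c < L)
    (hd : ∀ x, |x| < L * (-t) → HasDerivAt (fun x => u x t) (B x t) x)
    (hB : ∀ x, |x| < L * (-t) → ‖B x t‖ ≤ K * (-t) ^ (-(a + 1))) (K0 : 0 < K)
    (hs : ∀ x, |x| ≤ -t → ‖u x t‖ ≤ ε * (-t) ^ (-a)) {x : ℝ} (hx : |x| ≤ (1 + c) * (-t)) :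
    ‖u x t‖ ≤ (ε + K * c) * (-t) ^ (-a) := by
  have n0 : 0 < -t := by linarith
  have hlt : ∀ y ∈ Icc (-((1 + c) * (-t))) ((1 + c) * (-t)), |y| < L * (-t) := fun y hy =>
    (abs_le.2 hy).trans_lt (mul_lt_mul_of_pos_right cL n0)
  have hcn : 0 < c * (-t) := mul_pos c0 n0
  set x1 := max t (min x (-t)) with hx1
  have hx1' : |x1| ≤ -t := by
    rw [abs_le, hx1]; constructor
    · rw [neg_neg]; exact le_max_left _ _
    · exact max_le (by linarith) (min_le_right _ _)
  have hdx : |x - x1| ≤ c * (-t) := by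
    rw [abs_le] at hx ⊢
    rw [hx1]
    rcases le_total x (-t) with h1 | h1
    · rw [min_eq_left h1]
      rcases le_total t x with h2 | h2
      · rw [max_eq_right h2]; constructor <;> linarith
      · rw [max_eq_left h2]; constructor <;> linarith
    · rw [min_eq_right h1, max_eq_right (by linarith)]; constructor <;> linarith
  have m1 : x1 ∈ Icc (-((1 + c) * (-t))) ((1 + c) * (-t)) := abs_le.1 (hx1'.trans (by linarith))
  have := lipS (fun y hy => hd y (hlt y hy)) (fun y hy => hB y (hlt y hy)) m1 (abs_le.1 hx)
  have e : (-t) ^ (-(a + 1)) * (-t) = (-t) ^ (-a) := by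
    rw [← Real.rpow_add_one n0.ne']; congr 1; ring
  have k0 : 0 ≤ K * (-t) ^ (-(a + 1)) := mul_nonneg K0.le (Real.rpow_nonneg n0.le _)
  have b1 : ‖u x t - u x1 t‖ ≤ K * c * (-t) ^ (-a) := by
    refine (this.trans (mul_le_mul_of_nonneg_left hdx k0)).trans (le_of_eq ?_)
    rw [← e]; ring
  have b2 := hs x1 hx1'
  have b3 := norm_le_norm_add_norm_sub (u x1 t) (u x t)
  rw [norm_sub_rev] at b1
  rw [norm_sub_rev] at b1
  calc ‖u x t‖ ≤ ‖u x1 t‖ + ‖u x t - u x1 t‖ := by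
        have := norm_add_le (u x1 t) (u x t - u x1 t); simpa using this
    _ ≤ ε * (-t) ^ (-a) + K * c * (-t) ^ (-a) := add_le_add b2 b1
    _ = _ := by ring

/-- smallness on the segments -/
theorem seg_small {un : ℝ → ℝ → V} {e ε h a x r : ℝ} (a0 : 0 < a) (he : 0 < e) (he1 : e ≤ 1 / 4) (hh : 0 < h)
    (hh1 : h ≤ 1) (ε0 : 0 ≤ ε)
    (H : ∀ x t, -h ≤ t → t < 0 → |x| ≤ (1 + 8 / 3 * e) * (-t) → ‖un x t‖ ≤ ε * (-t) ^ (-a))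
    (hr : r ∈ Icc (-1) e) (hx : |x| ≤ (r + 1) / 2) :
    ‖h ^ a • un (h * x) (h * ((r - 1) / 2))‖ ≤ ε * (8 / 3) ^ a := by
  obtain ⟨r1, r2⟩ := hr
  have t0 : 3 / 8 ≤ -((r - 1) / 2) := by linarith
  have t1 : -((r - 1) / 2) ≤ 1 := by linarith
  generalize ht : -((r - 1) / 2) = τ at *
  have e1 : (r - 1) / 2 = -τ := by linarith
  have e2 : (r + 1) / 2 = 1 - τ := by linarith
  rw [e1]; rw [e2] at hx
  have hτ : 0 < τ := by linarith
  have := H (h * x) (h * -τ) (by nlinarith) (by nlinarith) (by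
    rw [abs_mul, abs_of_pos hh]
    have : |x| ≤ (1 + 8 / 3 * e) * τ := by
      have : e ≤ 8 / 3 * e * τ := by nlinarith
      have : r ≤ e := r2
      have : 1 - τ = τ + r := by linarith
      linarith
    calc h * |x| ≤ h * ((1 + 8 / 3 * e) * τ) := by gcongr
      _ = _ := by ring)
  rw [norm_smul, Real.norm_eq_abs, abs_of_pos (Real.rpow_pos_of_pos hh _)]
  have e3 : -(h * -τ) = h * τ := by ring
  rw [e3, Real.mul_rpow hh.le hτ.le] at this
  have hp0 := Real.rpow_pos_of_pos hh a
  calc h ^ a * ‖un (h * x) (h * -τ)‖ ≤ h ^ a * (ε * (h ^ (-a) * τ ^ (-a))) := by gcongr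
    _ = (h ^ a * h ^ (-a)) * (ε * τ ^ (-a)) := by ring
    _ = ε * τ ^ (-a) := by rw [← Real.rpow_add hh]; simp
    _ ≤ ε * (8 / 3) ^ a := by
        refine mul_le_mul_of_nonneg_left ?_ ε0
        rw [Real.rpow_neg hτ.le, ← Real.inv_rpow hτ.le]
        refine Real.rpow_le_rpow (by positivity) ?_ a0.le
        rw [inv_le_comm₀ hτ (by norm_num)]; norm_num; linarith

end PartTwentyTwo

section PartTwentyThree
variable {V : Type*} [NormedAddCommGroup V] [InnerProductSpace ℝ V] {p : ℝ}

theorem WB_of_Sol (hp : 1 < p) {O : Set (ℝ × ℝ)} {u A B C G : ℝ → ℝ → V} (h : Sol p O u A B C G)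
    {δ L K : ℝ} (hδ : 0 < δ) (hδ1 : δ < 1) (hL : 1 < L) (K0 : 0 < K)
    (hO : ∀ x t, -(exp 4 + 2) ≤ t → t ≤ -δ * |x| → t < 0 → (x, t) ∈ O)
    (hK : ∀ x t, -1 ≤ t → t < 0 → |x| < L * (-t) → ‖u x t‖ ≤ K * (-t) ^ (-al p) ∧
      ‖A x t‖ ≤ K * (-t) ^ (-(al p + 1)) ∧
      ‖B x t‖ ≤ K * (-t) ^ (-(al p + 1)) ∧ ‖C x t‖ ≤ K * (-t) ^ (-(al p + 2)) ∧
      ‖G x t‖ ≤ K * (-t) ^ (-(al p + 2))) :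
    ∃ v z vy zy K', WB p (ss (al p) 0 0 u) v z vy zy K' := by
  have ha := al_pos hp
  have habs : ∀ y s : ℝ, |0 + y * exp (-s)| = |y| * exp (-s) := fun y s => by
    rw [zero_add, abs_mul, abs_of_pos (exp_pos _)]
  have sy := h.wsys hp 0 0 (S := Icc (-1) 1 ×ˢ Ioi (-1)) (by
    rintro y s ⟨hy, hs⟩
    have hy' : |y| ≤ 1 := abs_le.2 hy
    have hs' : -1 < s := hs
    have h1 : exp (-s) ≤ exp 4 := exp_le_exp.2 (by linarith)
    have h2 := exp_pos (-s)
    refine hO _ _ (by linarith) ?_ (by linarith)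
    rw [habs]
    have : δ * |y| ≤ 1 := mul_le_one₀ hδ1.le (abs_nonneg _) hy'
    have := mul_le_mul_of_nonneg_right this h2.le
    linarith)
  have bd : ∀ y ∈ Icc (-1 : ℝ) 1, ∀ s, 0 ≤ s → ‖ss (al p) 0 0 u y s‖ ≤ K ∧
      ‖ss (al p + 1) 0 0 A y s‖ ≤ K ∧ ‖ss (al p + 1) 0 0 B y s‖ ≤ K ∧
      ‖ss (al p + 2) 0 0 C y s‖ ≤ K ∧ ‖ss (al p + 2) 0 0 G y s‖ ≤ K := by
    intro y hy s hs
    have h2 := exp_pos (-s)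
    have h1 : exp (-s) ≤ 1 := by rw [exp_le_one_iff]; linarith
    obtain ⟨b1, b2, b3, b4, b5⟩ := hK (0 + y * exp (-s)) (0 - exp (-s)) (by linarith) (by linarith) (by
      rw [habs, zero_sub, neg_neg]
      exact mul_lt_mul_of_pos_right ((abs_le.2 hy).trans_lt hL) h2)
    exact ⟨ss_bd b1, ss_bd b2, ss_bd b3, ss_bd b4, ss_bd b5⟩
  have tri : ∀ (c y : ℝ) (X Y Z : V), 0 ≤ c → y ∈ Icc (-1 : ℝ) 1 → ‖X‖ ≤ K → ‖Y‖ ≤ K → ‖Z‖ ≤ K →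
      ‖-c • X - y • Y + Z‖ ≤ c * K + K + K := by
    intro c y X Y Z hc hy hX hY hZ
    have n1 : ‖-c • X‖ ≤ c * K := by
      rw [norm_smul, norm_neg, Real.norm_eq_abs, abs_of_nonneg hc]; gcongr
    have n2 : ‖y • Y‖ ≤ K := by
      rw [norm_smul, Real.norm_eq_abs]
      exact (mul_le_of_le_one_left (norm_nonneg _) (abs_le.2 hy)).trans hY
    exact (norm_add_le _ _).trans (add_le_add ((norm_sub_le _ _).trans (add_le_add n1 n2)) hZ)
  refine ⟨_, _, _, _, (al p + 1) * K + K + K, sy, ?_, ?_, ?_, ?_, ?_⟩ <;> intro y hy s hs <;>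
    obtain ⟨b1, b2, b3, b4, b5⟩ := bd y hy s hs <;> have aK := mul_pos ha K0
  · linarith
  · have := tri (al p) y _ _ _ ha.le hy b1 b3 b2
    linarith
  · linarith
  · exact tri (al p + 1) y _ _ _ (by linarith) hy b3 b5 b4
  · linarith

set_option maxHeartbeats 1000000 in
theorem setup [CompleteSpace V] (hp : 1 < p) {T : ℝ → ℝ} (hTpos : ∀ x, 0 < T x)
    (hTlip : LipschitzWith 1 T) {u : ℝ → ℝ → V}
    (hreg : ContDiffOn ℝ 2 (fun q : ℝ × ℝ => u q.1 q.2)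
      {q : ℝ × ℝ | 0 ≤ q.2 ∧ q.2 < T q.1})
    (heq : ∀ x t, 0 ≤ t → t < T x →
      deriv (fun τ => deriv (fun τ' => u x τ') τ) t =
        deriv (fun z => deriv (fun z' => u z' t) z) x + ‖u x t‖ ^ (p - 1) • u x t)
    (hmax : ¬ ∃ (T' : ℝ → ℝ) (u' : ℝ → ℝ → V),
      LipschitzWith 1 T' ∧ T ≤ T' ∧ T ≠ T' ∧
      ContDiffOn ℝ 2 (fun q : ℝ × ℝ => u' q.1 q.2) {q : ℝ × ℝ | 0 ≤ q.2 ∧ q.2 < T' q.1} ∧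
      (∀ x t, 0 ≤ t → t < T' x →
        deriv (fun τ => deriv (fun τ' => u' x τ') τ) t =
          deriv (fun z => deriv (fun z' => u' z' t) z) x + ‖u' x t‖ ^ (p - 1) • u' x t) ∧
      (∀ x t, 0 ≤ t → t < T x → u' x t = u x t))
    {x0 δ : ℝ} (hδ : δ ∈ Ioo (0 : ℝ) 1) (hnc : ∀ x t, (x, t) ≠ (x0, T x0) →
      0 ≤ t → t ≤ T x0 - δ * |x - x0| → t < T x) :
    ∃ k : ℝ, ∃ w v z vy zy : ℝ → ℝ → V, ∃ K : ℝ, WB p w v z vy zy K ∧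
      (∀ y s, w y s = ss (al p) x0 (T x0) u y (s - log k)) ∧
      ¬ (∀ ε > 0, ∃ S, ∀ s ≥ S, ∀ y ∈ Icc (-1 : ℝ) 1, ‖w y s‖ ≤ ε) := by
  have ha := al_pos hp
  obtain ⟨δ0, δ1⟩ := hδ
  have cT := hTlip.continuous
  have oO : IsOpen {q : ℝ × ℝ | 0 < q.2 ∧ q.2 < T q.1} := (isOpen_lt continuous_const continuous_snd).inter
    (isOpen_lt continuous_snd (cT.comp continuous_fst))
  have hS := sol_of_C2 oO (hreg.mono fun q hq => ⟨hq.1.le, hq.2⟩)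
    (fun x t hq => heq x t hq.1.le hq.2)
  have T0 := hTpos x0
  have e4 := exp_pos 4
  obtain ⟨k, hk⟩ : ∃ k, k = T x0 / (exp 4 + 3) := ⟨_, rfl⟩
  have k0 : 0 < k := by rw [hk]; positivity
  have kT : T x0 = k * (exp 4 + 3) := by rw [hk]; field_simp
  have hn := hS.scale hp x0 (T x0) k0
  generalize hA : (fun x t => k ^ (al p + 1) • deriv (fun τ => u (x0 + k * x) τ) (T x0 + k * t)) = A at hn
  generalize hB : (fun x t => k ^ (al p + 1) • deriv (fun z => u z (T x0 + k * t)) (x0 + k * x)) = B at hn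
  generalize hC : (fun x t => k ^ (al p + 2) • deriv (fun z => deriv (fun τ => u z τ) (T x0 + k * t)) (x0 + k * x)) = C at hn
  generalize hG : (fun x t => k ^ (al p + 2) • deriv (fun z => deriv (fun z' => u z' (T x0 + k * t)) z) (x0 + k * x)) = G at hn
  clear hA hB hC hG
  obtain ⟨un, hun⟩ : ∃ un : ℝ → ℝ → V, un = fun x t => k ^ al p • u (x0 + k * x) (T x0 + k * t) := ⟨_, rfl⟩
  rw [← hun] at hn
  have hO : ∀ x t, -(exp 4 + 2) ≤ t → t ≤ -δ * |x| → t < 0 →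
      (x, t) ∈ {q : ℝ × ℝ | (x0 + k * q.1, T x0 + k * q.2) ∈ {q : ℝ × ℝ | 0 < q.2 ∧ q.2 < T q.1}} := by
    intro x t h1 h2 h3
    have q1 : 0 < T x0 + k * t := by
      rw [kT]
      have : 0 < k * (exp 4 + 3 + t) := mul_pos k0 (by linarith)
      linarith
    have q2 : k * t < 0 := mul_neg_of_pos_of_neg k0 h3
    refine ⟨q1, hnc _ _ (fun h => ?_) q1.le ?_⟩
    · have := (Prod.mk.inj h).2; linarith
    · rw [add_sub_cancel_left, abs_mul, abs_of_pos k0]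
      have := mul_le_mul_of_nonneg_left h2 k0.le
      linarith
  obtain ⟨L, hL⟩ : ∃ L, L = (1 + 1 / δ) / 2 := ⟨_, rfl⟩
  have hδL : δ * L = (δ + 1) / 2 := by rw [hL]; field_simp
  have hL1 : 1 + (1 - δ) / 2 < L := by
    refine lt_of_mul_lt_mul_left ?_ δ0.le
    rw [hδL]; nlinarith
  obtain ⟨K1, K10, hK1⟩ := linf (L := L) hp hn δ0 δ1 (by linarith) (by linarith) hO
  have hO1 : ∀ x t, -1 ≤ t → t < 0 → |x| ≤ L * (-t) →
      (x, t) ∈ {q : ℝ × ℝ | (x0 + k * q.1, T x0 + k * q.2) ∈ {q : ℝ × ℝ | 0 < q.2 ∧ q.2 < T q.1}} := by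
    intro x t h1 h2 h3
    refine hO x t (by linarith) ?_ h2
    have h4 := mul_le_mul_of_nonneg_left h3 δ0.le
    rw [← mul_assoc, hδL] at h4
    nlinarith
  obtain ⟨K, K0, hK⟩ := all_der hn (by linarith) hO1 K10 hK1 hp
  obtain ⟨v, z, vy, zy, K', hWB⟩ := WB_of_Sol hp hn δ0 δ1 (by linarith) K0 hO hK
  refine ⟨k, _, v, z, vy, zy, K', hWB, fun y s => by rw [hun]; exact ss_scale _ _ _ k0 u y s, fun H => ?_⟩
  obtain ⟨ε0, hε0⟩ : ∃ ε0, ε0 = (1 / (4 * p)) ^ (1 / (p - 1)) / 4 := ⟨_, rfl⟩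
  have p0 : 0 < p := by linarith
  have ε00 : 0 < ε0 := by rw [hε0]; positivity
  have hsm : p * (4 * ε0) ^ (p - 1) ≤ 1 / 4 := by
    have : 4 * ε0 = (1 / (4 * p)) ^ (1 / (p - 1)) := by rw [hε0]; ring
    rw [this, ← Real.rpow_mul (by positivity), one_div_mul_cancel (by linarith), Real.rpow_one]
    apply le_of_eq; field_simp
  have Q0 : (0:ℝ) < (8 / 3) ^ al p := by positivity
  obtain ⟨e, he⟩ : ∃ e, e = min ((1 - δ) / 8) (3 / 16 * (ε0 / (K * (8 / 3) ^ al p))) := ⟨_, rfl⟩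
  have e0 : 0 < e := by rw [he]; exact lt_min (by linarith) (by positivity)
  have e1 : e ≤ (1 - δ) / 8 := by rw [he]; exact min_le_left _ _
  have e2 : K * (8 / 3 * e) * (8 / 3) ^ al p ≤ ε0 / 2 := by
    have : e ≤ 3 / 16 * (ε0 / (K * (8 / 3) ^ al p)) := by rw [he]; exact min_le_right _ _
    calc K * (8 / 3 * e) * (8 / 3) ^ al p
        ≤ K * (8 / 3 * (3 / 16 * (ε0 / (K * (8 / 3) ^ al p)))) * (8 / 3) ^ al p := by gcongr
      _ = ε0 / 2 := by
        generalize (8 / 3 : ℝ) ^ al p = Q at Q0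
        field_simp; norm_num
  obtain ⟨S, hSS⟩ := H (ε0 / (2 * (8 / 3) ^ al p)) (by positivity)
  obtain ⟨h, hh⟩ : ∃ h, h = min 1 (exp (-S)) := ⟨_, rfl⟩
  have h0 : 0 < h := by rw [hh]; exact lt_min one_pos (exp_pos _)
  have h1 : h ≤ 1 := by rw [hh]; exact min_le_left _ _
  have h2 : h ≤ exp (-S) := by rw [hh]; exact min_le_right _ _
  have small : ∀ x t, -h ≤ t → t < 0 → |x| ≤ (1 + 8 / 3 * e) * (-t) →
      ‖un x t‖ ≤ (ε0 / (2 * (8 / 3) ^ al p) + K * (8 / 3 * e)) * (-t) ^ (-al p) := by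
    intro x t t1 t0 hx
    have t1' : -1 ≤ t := by linarith
    refine cone_ext (B := B) (L := L) t1' t0 (by linarith) (by linarith) (fun x hx => ?_)
      (fun x hx => (hK x t t1' t0 hx).2.2.1) K0 (fun x hx => ?_) hx
    · have := lin_comp (X := fun x => x) (S := fun _ => t) (hn.du x t (hO1 x t t1' t0 hx.le))
        (hasDerivAt_id x) (hasDerivAt_const x t)
      simpa using this
    · have n0 : 0 < -t := by linarith
      have es : exp (-(-log (-t))) = -t := by rw [neg_neg, exp_log n0]
      have := hSS (-log (-t)) (by
        have : -t ≤ exp (-S) := by linarith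
        have := (Real.log_le_iff_le_exp n0).2 this
        linarith) (x / (-t)) (by
        refine abs_le.1 ?_
        rw [abs_div, abs_of_pos n0]; exact (div_le_one n0).2 hx)
      unfold ss at this
      rw [es, div_mul_cancel₀ _ n0.ne', zero_add, zero_sub, neg_neg, norm_smul, Real.norm_eq_abs,
        abs_of_pos (exp_pos _)] at this
      have e5 : exp (-al p * -log (-t)) = (-t) ^ al p := by
        rw [Real.rpow_def_of_pos n0]; congr 1; ring
      rw [e5] at this
      rw [Real.rpow_neg n0.le, ← div_eq_mul_inv, le_div_iff₀ (Real.rpow_pos_of_pos n0 _), mul_comm]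
      exact this
  have fin : (ε0 / (2 * (8 / 3) ^ al p) + K * (8 / 3 * e)) * (8 / 3) ^ al p ≤ ε0 := by
    have : ε0 / (2 * (8 / 3) ^ al p) * (8 / 3) ^ al p = ε0 / 2 := by field_simp
    rw [add_mul, this]; linarith
  have seg : ∀ r ∈ Icc (-1) e, ∀ x, |x| ≤ (r + 1) / 2 →
      ‖(k * h) ^ al p • u (x0 + k * h * x) (T x0 + k * h * ((r - 1) / 2))‖ ≤ ε0 := by
    intro r hr x hx
    have := seg_small (un := un) (a := al p) ha e0 (by linarith) h0 h1
      (by positivity) small hr hx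
    rw [hun] at this
    rw [Real.mul_rpow k0.le h0.le, mul_comm (k ^ al p), mul_smul, mul_assoc k h x,
      mul_assoc k h ((r - 1) / 2)]
    exact this.trans fin
  have kh : k * h < T x0 := by
    rw [kT]
    have : h < exp 4 + 3 := by linarith
    exact mul_lt_mul_of_pos_left this k0
  refine no_small hp hTpos hTlip hreg heq hmax ⟨δ0, δ1⟩ hnc e0 (by linarith) (by nlinarith) ε00 hsm
    (mul_pos k0 h0) kh (fun r hr => seg r hr _ ?_) (fun r hr => seg r hr _ ?_)
  · rw [abs_of_nonneg (by linarith [hr.1])]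
  · rw [neg_div, abs_neg, abs_of_nonneg (by linarith [hr.1])]

end PartTwentyThree

section PartTwentyFour
variable {V : Type*} [NormedAddCommGroup V] [InnerProductSpace ℝ V] {p : ℝ}

theorem energy_eq (hp : 1 < p) {W U Z : ℝ → V} (hd : ∀ y ∈ Ioo (-1 : ℝ) 1, deriv W y = Z y) :
    energyE p W U = II p (fun y => (1 - y ^ 2) * (1 / 2 * ‖U y‖ ^ 2 + 1 / 2 * ‖Z y‖ ^ 2 * (1 - y ^ 2)
    + al p * (al p + 1) / 2 * ‖W y‖ ^ 2 - ‖W y‖ ^ (p + 1) / (p + 1))) := by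
  unfold energyE II
  rw [intervalIntegral.integral_of_le (by norm_num), integral_Ioc_eq_integral_Ioo]
  refine setIntegral_congr_fun measurableSet_Ioo fun y hy => ?_
  have hc : (p + 1) / (p - 1) ^ 2 = al p * (al p + 1) / 2 := by
    have : p - 1 ≠ 0 := by linarith
    unfold al; field_simp; ring
  simp only [hd y hy, rho_eq hp (Ioo_subset_Icc_self hy), hc]
  ring

theorem energy_k0 (hp : 1 < p) : energyE p (fun _ : ℝ => kappa0 p) (0 : ℝ → ℝ) = cst p := by
  rw [energy_eq hp (Z := fun _ => 0) (fun y _ => by simp), cst,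
    ← eS_kappa hp (d := 0) (by norm_num) (Ω := (1 : ℝ)) (by norm_num)]
  refine II_congr fun y _ => ?_
  have : kappa p 0 y = kappa0 p := by simp [kappa]
  simp [this]

theorem Abound {f : ℝ → ℝ → V} {s : ℝ} {Z : ℝ → V} {d η : ℝ} {Ω : V} (hd : d ∈ Ioo (-1 : ℝ) 1)
    (hΩ : ‖Ω‖ = 1) (η0 : 0 ≤ η) (h1 : ∀ y ∈ Ioo (-1 : ℝ) 1, ‖f y s - kappa p d y • Ω‖ ≤ η)
    (hz : ∀ y ∈ Ioo (-1 : ℝ) 1, HasDerivAt (fun z => f z s) (Z y) y)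
    (h2 : ∀ y ∈ Ioo (-1 : ℝ) 1, ‖Z y - (-(al p * d) / (1 + d * y) * kappa p d y) • Ω‖ ≤ η)
    (h3 : ∀ y ∈ Ioo (-1 : ℝ) 1, ‖deriv (fun τ => f y τ) s‖ ≤ η) :
    |(⨅ dΩ : Set.Ioo (-1 : ℝ) 1 × {v : V // ‖v‖ = 1},
          Real.sqrt (∫ y in Set.Ioo (-1 : ℝ) 1,
            (‖f y s - kappa p (dΩ.1 : ℝ) y • (dΩ.2 : V)‖ ^ 2 +
              ‖deriv (fun z => f z s - kappa p (dΩ.1 : ℝ) z • (dΩ.2 : V)) y‖ ^ 2)))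
        + Real.sqrt (∫ y in Set.Ioo (-1 : ℝ) 1, ‖deriv (fun τ => f y τ) s‖ ^ 2)| ≤ 4 * η := by
  rw [abs_of_nonneg (add_nonneg (Real.iInf_nonneg fun _ => Real.sqrt_nonneg _) (Real.sqrt_nonneg _))]
  have vol : volume.real (Ioo (-1 : ℝ) 1) = 2 := by simp; norm_num
  have fin : volume (Ioo (-1 : ℝ) 1) < ⊤ := by simp
  have b1 : (⨅ dΩ : Set.Ioo (-1 : ℝ) 1 × {v : V // ‖v‖ = 1},
          Real.sqrt (∫ y in Set.Ioo (-1 : ℝ) 1,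
            (‖f y s - kappa p (dΩ.1 : ℝ) y • (dΩ.2 : V)‖ ^ 2 +
              ‖deriv (fun z => f z s - kappa p (dΩ.1 : ℝ) z • (dΩ.2 : V)) y‖ ^ 2))) ≤ 2 * η := by
    refine (ciInf_le ⟨0, ?_⟩ (⟨⟨d, hd⟩, ⟨Ω, hΩ⟩⟩ : Set.Ioo (-1 : ℝ) 1 × {v : V // ‖v‖ = 1})).trans ?_
    · rintro _ ⟨_, rfl⟩; exact Real.sqrt_nonneg _
    · refine Real.sqrt_le_iff.2 ⟨by positivity, ?_⟩
      refine (le_abs_self _).trans ?_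
      rw [← Real.norm_eq_abs]
      refine (norm_setIntegral_le_of_norm_le_const (C := 2 * η ^ 2) fin fun y hy => ?_).trans
        (by rw [vol]; apply le_of_eq; ring)
      have dd : deriv (fun z => f z s - kappa p d z • Ω) y
          = Z y - (-(al p * d) / (1 + d * y) * kappa p d y) • Ω :=
        ((hz y hy).sub ((kappa_deriv p (kap_pos hd (Ioo_subset_Icc_self hy))).smul_const Ω)).deriv
      simp only [dd]
      rw [Real.norm_eq_abs, abs_of_nonneg (by positivity)]
      have c1 := pow_le_pow_left₀ (norm_nonneg _) (h1 y hy) 2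
      have c2 := pow_le_pow_left₀ (norm_nonneg _) (h2 y hy) 2
      linarith
  have b2 : Real.sqrt (∫ y in Set.Ioo (-1 : ℝ) 1, ‖deriv (fun τ => f y τ) s‖ ^ 2) ≤ 2 * η := by
    refine Real.sqrt_le_iff.2 ⟨by positivity, ?_⟩
    refine (le_abs_self _).trans ?_
    rw [← Real.norm_eq_abs]
    refine (norm_setIntegral_le_of_norm_le_const (C := η ^ 2) fin fun y hy => ?_).trans
      (by rw [vol]; nlinarith [sq_nonneg η])
    rw [Real.norm_eq_abs, abs_of_nonneg (by positivity)]
    exact pow_le_pow_left₀ (norm_nonneg _) (h3 y hy) 2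
  linarith

theorem shift_lim {F : ℝ → ℝ} {c l : ℝ} (h : Tendsto (fun s => F (s - c)) atTop (nhds l)) :
    Tendsto F atTop (nhds l) := by
  have := h.comp (tendsto_atTop_add_const_right atTop c tendsto_id)
  simpa [Function.comp_def] using this

theorem final [FiniteDimensional ℝ V] (hp : 1 < p) {w v z vy zy : ℝ → ℝ → V} {K c : ℝ} {f : ℝ → ℝ → V}
    (h : WB p w v z vy zy K) (hf : ∀ y s, w y s = f y (s - c))
    (hN : ¬ (∀ ε > 0, ∃ S, ∀ s ≥ S, ∀ y ∈ Icc (-1 : ℝ) 1, ‖w y s‖ ≤ ε)) :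
    Tendsto (fun s =>
        (⨅ dΩ : Set.Ioo (-1 : ℝ) 1 × {v : V // ‖v‖ = 1},
          Real.sqrt (∫ y in Set.Ioo (-1 : ℝ) 1,
            (‖f y s - kappa p (dΩ.1 : ℝ) y • (dΩ.2 : V)‖ ^ 2 +
              ‖deriv (fun z => f z s - kappa p (dΩ.1 : ℝ) z • (dΩ.2 : V)) y‖ ^ 2)))
        + Real.sqrt (∫ y in Set.Ioo (-1 : ℝ) 1, ‖deriv (fun τ => f y τ) s‖ ^ 2)) atTop (nhds 0) ∧
    Tendsto (fun s => energyE p (fun y => f y s) (fun y => deriv (fun τ => f y τ) s))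
      atTop (nhds (energyE p (fun _ : ℝ => kappa0 p) (0 : ℝ → ℝ))) := by
  obtain hc | ⟨hE, hsub⟩ := h.dich hp
  · exact absurd hc hN
  have hs : ∀ y ∈ Icc (-1 : ℝ) 1, ∀ s, 0 ≤ s → deriv (fun τ => f y τ) (s - c) = v y s := by
    intro y hy s hs
    have h1 := h.sys.ws y s ⟨hy, memJ hs⟩
    have h2 : (fun τ => f y τ) = fun τ => w y (τ + c) := by funext τ; rw [hf]; simp
    rw [h2]
    have h3 : HasDerivAt (fun s => w y s) (v y s) (s - c + c) := by rwa [sub_add_cancel]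
    exact (h3.comp_add_const (s - c) c).deriv
  have hy : ∀ y ∈ Icc (-1 : ℝ) 1, ∀ s, 0 ≤ s → HasDerivAt (fun y => f y (s - c)) (z y s) y := by
    intro y hy s hs
    have h1 := h.sys.wy y s ⟨hy, memJ hs⟩
    simpa only [hf] using h1
  constructor
  · refine shift_lim (c := c) (seq_crit fun σ h0 hσ => ?_)
    obtain ⟨φ, d, hd, Ω, hΩ, hw, hz, hv⟩ := hsub σ h0 hσ
    refine ⟨φ, ?_⟩
    rw [Metric.tendsto_nhds]
    intro ε ε0
    rw [Metric.tendstoUniformlyOn_iff] at hw hz hv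
    filter_upwards [hw (ε / 8) (by linarith), hz (ε / 8) (by linarith), hv (ε / 8) (by linarith)]
      with n n1 n2 n3
    rw [Real.dist_0_eq_abs]
    refine lt_of_le_of_lt (Abound (Z := fun y => z y (σ (φ n))) hd hΩ (η := ε / 8) (by linarith) ?_ ?_ ?_ ?_)
      (by linarith)
    · intro y hy
      have := n1 y (Ioo_subset_Icc_self hy)
      rw [dist_comm, dist_eq_norm, hf] at this
      exact this.le
    · exact fun y hy' => hy y (Ioo_subset_Icc_self hy') _ (h0 _)
    · intro y hy
      have := n2 y (Ioo_subset_Icc_self hy)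
      rw [dist_comm, dist_eq_norm] at this
      exact this.le
    · intro y hy
      have := n3 y (Ioo_subset_Icc_self hy)
      rw [dist_zero_left] at this
      rw [hs y (Ioo_subset_Icc_self hy) _ (h0 _)]
      exact this.le
  · rw [energy_k0 hp]
    refine shift_lim (c := c) (hE.congr' ?_)
    filter_upwards [eventually_ge_atTop 0] with s s0
    rw [energy_eq hp (Z := fun y => z y s) (fun y hy' => (hy y (Ioo_subset_Icc_self hy') s s0).deriv)]
    refine II_congr fun y hy' => ?_
    rw [hs y hy' s s0, hf]

end PartTwentyFour

/-- **Approaching the set of non-zero stationary solutions near a non-characteristic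
point** (Proposition 1.3). -/
theorem approach_stationary_set (p : ℝ) (hp : 1 < p) (m : ℕ) (hm : 2 ≤ m)
    (T : ℝ → ℝ) (hTpos : ∀ x, 0 < T x) (hTlip : LipschitzWith 1 T)
    (u : ℝ → ℝ → EuclideanSpace ℝ (Fin m))
    (hreg : ContDiffOn ℝ 2 (fun q : ℝ × ℝ => u q.1 q.2)
      {q : ℝ × ℝ | 0 ≤ q.2 ∧ q.2 < T q.1})
    (heq : ∀ x t, 0 ≤ t → t < T x →
      deriv (fun τ => deriv (fun τ' => u x τ') τ) t =
        deriv (fun z => deriv (fun z' => u z' t) z) x + ‖u x t‖ ^ (p - 1) • u x t)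
    (hmax : ¬ ∃ (T' : ℝ → ℝ) (u' : ℝ → ℝ → EuclideanSpace ℝ (Fin m)),
      LipschitzWith 1 T' ∧ T ≤ T' ∧ T ≠ T' ∧
      ContDiffOn ℝ 2 (fun q : ℝ × ℝ => u' q.1 q.2) {q : ℝ × ℝ | 0 ≤ q.2 ∧ q.2 < T' q.1} ∧
      (∀ x t, 0 ≤ t → t < T' x →
        deriv (fun τ => deriv (fun τ' => u' x τ') τ) t =
          deriv (fun z => deriv (fun z' => u' z' t) z) x + ‖u' x t‖ ^ (p - 1) • u' x t) ∧
      (∀ x t, 0 ≤ t → t < T x → u' x t = u x t))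
    (x0 : ℝ)
    (hnc : ∃ δ ∈ Set.Ioo (0 : ℝ) 1, ∀ x t, (x, t) ≠ (x0, T x0) →
      0 ≤ t → t ≤ T x0 - δ * |x - x0| → t < T x) :
    -- (A.i)
    Tendsto (fun s =>
        (⨅ dΩ : Set.Ioo (-1 : ℝ) 1 × {v : EuclideanSpace ℝ (Fin m) // ‖v‖ = 1},
          Real.sqrt (∫ y in Set.Ioo (-1 : ℝ) 1,
            (‖selfSim p u T x0 y s - kappa p (dΩ.1 : ℝ) y • (dΩ.2 : EuclideanSpace ℝ (Fin m))‖ ^ 2 +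
              ‖deriv (fun z => selfSim p u T x0 z s
                  - kappa p (dΩ.1 : ℝ) z • (dΩ.2 : EuclideanSpace ℝ (Fin m))) y‖ ^ 2)))
        + Real.sqrt (∫ y in Set.Ioo (-1 : ℝ) 1,
            ‖deriv (fun τ => selfSim p u T x0 y τ) s‖ ^ 2))
      atTop (nhds 0) ∧
    -- (A.ii)
    Tendsto (fun s =>
        energyE p (fun y => selfSim p u T x0 y s)
          (fun y => deriv (fun τ => selfSim p u T x0 y τ) s))
      atTop (nhds (energyE p (fun _ : ℝ => kappa0 p) (0 : ℝ → ℝ))) := by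
  obtain ⟨δ, hδ, hnc⟩ := hnc
  obtain ⟨k, w, v, z, vy, zy, K, hW, hf, hN⟩ := setup hp hTpos hTlip hreg heq hmax hδ hnc
  exact final (f := fun y s => selfSim p u T x0 y s) hp hW hf hN
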